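/- Weighted L^p bound of the full gradient by divergence and vorticity in ℝ²: for every 1 < p < ∞ and every α with −2 < α < 2(p−1), there exists a constant C = C(p,α) > 0 such that for all vector fields u = (u₁,u₂) ∈ C_c^∞(ℝ²;ℝ²), ∫_{ℝ²} |∇u|^p |x|^α dx ≤ C (∫_{ℝ²} |div u|^p |x|^α dx + ∫_{ℝ²} |ω|^p |x|^α dx), where div u = ∂_{x₁}u₁ + ∂_{x₂}u₂ and ω = ∂_{x₁}u₂ − ∂_{x₂}u₁. -/

import Mathlib

noncomputable section

open MeasureTheory Real Set ENNReal

/-- The plane `ℝ²`. -/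
abbrev E2 := EuclideanSpace ℝ (Fin 2)

/-- `L^p(ℝ²)` norm of a function on `ℝ²`. -/
def lpnorm {α : Type*} [NormedAddCommGroup α] (f : E2 → α) (p : ℝ≥0∞) : ℝ :=
  (eLpNorm f p volume).toReal

/-- `i`-th partial derivative of a scalar field on `ℝ²`. -/
def pd (f : E2 → ℝ) (i : Fin 2) (x : E2) : ℝ := fderiv ℝ f x (EuclideanSpace.single i 1)

/-- Divergence of a vector field on `ℝ²`. -/
def div2 (u : E2 → E2) (x : E2) : ℝ := ∑ i : Fin 2, pd (fun y => u y i) i x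

/-- Vorticity `ω = ∂₁u₂ − ∂₂u₁` of a vector field on `ℝ²`. -/
def vort (u : E2 → E2) (x : E2) : ℝ := pd (fun y => u y 1) 0 x - pd (fun y => u y 0) 1 x


def belS (r ζ η : ℝ) : ℝ := ζ ^ r + η
def belP (r ζ η : ℝ) : ℝ := (belS r ζ η) ^ (1 - 1 / r)
def bel (r ζ η : ℝ) : ℝ := ζ ^ 2 * belP r ζ η + 9 * r * η ^ (1 + 1 / r)
def belz (r ζ η : ℝ) : ℝ :=
  2 * ζ * belP r ζ η + (r - 1) * ζ * ζ ^ r * (belP r ζ η / belS r ζ η)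
def bele (r ζ η : ℝ) : ℝ :=
  (1 - 1 / r) * ζ ^ 2 * (belP r ζ η / belS r ζ η) + 9 * r * (1 + 1 / r) * η ^ (1 / r)
def belzz (r ζ η : ℝ) : ℝ :=
  2 * belP r ζ η + (r - 1) * (r + 3) * ζ ^ r * (belP r ζ η / belS r ζ η)
    - (r - 1) * (ζ ^ r) ^ 2 * (belP r ζ η / belS r ζ η ^ 2)
def belze (r ζ η : ℝ) : ℝ :=
  2 * (1 - 1 / r) * ζ * (belP r ζ η / belS r ζ η)
    - (1 - 1 / r) * ζ * ζ ^ r * (belP r ζ η / belS r ζ η ^ 2)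
def belee (r ζ η : ℝ) : ℝ :=
  (1 - 1 / r) * (-1 / r) * ζ ^ 2 * (belP r ζ η / belS r ζ η ^ 2)
    + 9 * (1 + 1 / r) * η ^ (1 / r - 1)

lemma belS_pos {r ζ η : ℝ} (hz : 0 < ζ) (he : 0 < η) : 0 < belS r ζ η :=
  add_pos (rpow_pos_of_pos hz _) he
lemma belP_pos {r ζ η : ℝ} (hz : 0 < ζ) (he : 0 < η) : 0 < belP r ζ η :=
  rpow_pos_of_pos (belS_pos hz he) _

section deriv
variable {r : ℝ} {f g : ℝ → ℝ} {f' g' s : ℝ}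

lemma hasDerivAt_Z (hf : HasDerivAt f f' s) (h0 : 0 < f s) :
    HasDerivAt (fun s => f s ^ r) (r * f s ^ r / f s * f') s := by
  have := hf.rpow_const (p := r) (Or.inl h0.ne')
  convert this using 1
  rw [rpow_sub_one h0.ne']; field_simp

lemma hasDerivAt_belS (hf : HasDerivAt f f' s) (hg : HasDerivAt g g' s) (h0 : 0 < f s) :
    HasDerivAt (fun s => belS r (f s) (g s)) (r * f s ^ r / f s * f' + g') s :=
  (hasDerivAt_Z hf h0).add hg

lemma hasDerivAt_belP (hf : HasDerivAt f f' s) (hg : HasDerivAt g g' s) (h0 : 0 < f s)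
    (h1 : 0 < g s) :
    HasDerivAt (fun s => belP r (f s) (g s))
      ((1 - 1 / r) * belP r (f s) (g s) / belS r (f s) (g s) * (r * f s ^ r / f s * f' + g')) s :=
  hasDerivAt_Z (f := fun s => belS r (f s) (g s)) (hasDerivAt_belS hf hg h0) (belS_pos h0 h1)

lemma hasDerivAt_bel (hr : 1 ≤ r) (hf : HasDerivAt f f' s) (hg : HasDerivAt g g' s) (h0 : 0 < f s)
    (h1 : 0 < g s) :
    HasDerivAt (fun s => bel r (f s) (g s))
      (belz r (f s) (g s) * f' + bele r (f s) (g s) * g') s := by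
  have hS := belS_pos (r := r) h0 h1
  have h := ((hf.pow 2).mul (hasDerivAt_belP (r := r) hf hg h0 h1)).add
    ((hg.rpow_const (p := 1 + 1 / r) (Or.inl h1.ne')).const_mul (9 * r))
  refine h.congr_deriv ?_
  have hr0 : r ≠ 0 := by positivity
  have e : (1 + 1 / r - 1) = 1 / r := by ring
  rw [e]
  simp only [belz, bele, Pi.pow_apply]
  generalize belP r (f s) (g s) = P at *
  generalize belS r (f s) (g s) = S at *
  have := h0.ne'
  have := hS.ne'
  push_cast
  field_simp
  ring

lemma hasDerivAt_belz (hr : 1 ≤ r) (hf : HasDerivAt f f' s) (hg : HasDerivAt g g' s) (h0 : 0 < f s)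
    (h1 : 0 < g s) :
    HasDerivAt (fun s => belz r (f s) (g s))
      (belzz r (f s) (g s) * f' + belze r (f s) (g s) * g') s := by
  have hS := belS_pos (r := r) h0 h1
  have hP := (hasDerivAt_belP (r := r) hf hg h0 h1)
  have h := ((hf.const_mul 2).mul hP).add
    (((hf.const_mul (r - 1)).mul (hasDerivAt_Z (r := r) hf h0)).mul (hP.div
      (hasDerivAt_belS hf hg h0) hS.ne'))
  refine h.congr_deriv ?_
  have hr0 : r ≠ 0 := by positivity
  simp only [belzz, belze, Pi.mul_apply, Pi.div_apply]
  generalize belP r (f s) (g s) = P at *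
  generalize belS r (f s) (g s) = S at *
  have := h0.ne'
  have := hS.ne'
  field_simp
  ring

lemma hasDerivAt_bele (hr : 1 ≤ r) (hf : HasDerivAt f f' s) (hg : HasDerivAt g g' s) (h0 : 0 < f s)
    (h1 : 0 < g s) :
    HasDerivAt (fun s => bele r (f s) (g s))
      (belze r (f s) (g s) * f' + belee r (f s) (g s) * g') s := by
  have hS := belS_pos (r := r) h0 h1
  have hP := (hasDerivAt_belP (r := r) hf hg h0 h1)
  have h := (((hf.pow 2).const_mul (1 - 1 / r)).mul (hP.div
      (hasDerivAt_belS hf hg h0) hS.ne')).add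
      ((hg.rpow_const (p := 1 / r) (Or.inl h1.ne')).const_mul (9 * r * (1 + 1 / r)))
  refine h.congr_deriv ?_
  have hr0 : r ≠ 0 := by positivity
  simp only [belee, belze, Pi.div_apply, Pi.pow_apply]
  generalize belP r (f s) (g s) = P at *
  generalize belS r (f s) (g s) = S at *
  have := h0.ne'
  have := hS.ne'
  push_cast
  field_simp
  ring
end deriv

/-- basic sizes -/
lemma bel_sizes {r ζ η : ℝ} (hr : 1 ≤ r) (hz : 0 < ζ) (he : 0 < η) :
    ζ * (belP r ζ η / belS r ζ η) ≤ 1 ∧ ζ ^ r ≤ belS r ζ η ∧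
    belP r ζ η * η ^ (1 / r - 1) ≥ 1 := by
  have hS := belS_pos (r := r) hz he
  have hr0 : (0 : ℝ) < r := by linarith
  have hZ := rpow_pos_of_pos hz r
  have h2 : ζ ^ r ≤ belS r ζ η := by unfold belS; linarith
  refine ⟨?_, h2, ?_⟩
  · have : belP r ζ η / belS r ζ η = (belS r ζ η) ^ (-(1 / r)) := by
      unfold belP
      rw [← rpow_sub_one hS.ne']; congr 1; ring
    rw [this, rpow_neg hS.le, ← div_eq_mul_inv, div_le_one (rpow_pos_of_pos hS _)]
    calc ζ = (ζ ^ r) ^ (1 / r) := by rw [← rpow_mul hz.le]; simp [hr0.ne']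
      _ ≤ _ := rpow_le_rpow hZ.le h2 (by positivity)
  · unfold belP
    have h3 : η ≤ belS r ζ η := by unfold belS; linarith
    have h4 : 0 ≤ 1 - 1 / r := by rw [sub_nonneg, div_le_one hr0]; exact hr
    calc (1 : ℝ) = η ^ (1 - 1 / r) * η ^ (1 / r - 1) := by
          rw [← rpow_add he]; simp
      _ ≤ _ := by gcongr

lemma bel_hess {r ζ η : ℝ} (hr : 1 ≤ r) (hz : 0 < ζ) (he : 0 < η) :
    2 * belP r ζ η ≤ belzz r ζ η ∧ |belze r ζ η| ≤ 2 ∧ 8 / belP r ζ η ≤ belee r ζ η := by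
  obtain ⟨h1, h2, h3⟩ := bel_sizes hr hz he
  have hS := belS_pos (r := r) hz he
  have hP := belP_pos (r := r) hz he
  have hr0 : (0 : ℝ) < r := by linarith
  have hZ := rpow_pos_of_pos hz r
  unfold belzz belze belee
  have hm0 : 0 ≤ 1 / r := by positivity
  have hm1 : 1 / r ≤ 1 := by rw [div_le_one hr0]; exact hr
  have e2 : ∀ P S : ℝ, P / S ^ 2 = (P / S) / S := by intros; rw [div_div, sq]
  set P := belP r ζ η
  set S := belS r ζ η
  set Z := ζ ^ r
  set T := η ^ (1 / r - 1)
  have hT : 0 < T := rpow_pos_of_pos he _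
  have hW : 0 < P / S := by positivity
  have hPS : P = (P / S) * S := by field_simp
  have hZS : Z / S ≤ 1 := by rw [div_le_one hS]; exact h2
  have hZS0 : 0 < Z / S := by positivity
  refine ⟨?_, ?_, ?_⟩
  · have : Z ^ 2 * (P / S ^ 2) ≤ Z * (P / S) := by
      have : Z ^ 2 * (P / S ^ 2) = Z * (P / S) * (Z / S) := by field_simp
      rw [this]
      exact mul_le_of_le_one_right (by positivity) hZS
    have h5 : 0 ≤ (r - 1) * (r + 2) * (Z * (P / S)) := by
      apply mul_nonneg (mul_nonneg (by linarith) (by linarith)); positivity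
    nlinarith
  · have e : 2 * (1 - 1 / r) * ζ * (P / S) - (1 - 1 / r) * ζ * Z * (P / S ^ 2)
      = (1 - 1 / r) * ((ζ * (P / S)) * (2 - Z / S)) := by field_simp
    rw [e, abs_of_nonneg]
    · calc (1 - 1 / r) * ((ζ * (P / S)) * (2 - Z / S)) ≤ 1 * (1 * 2) := by
            gcongr
            · apply mul_nonneg (by positivity); linarith
            · linarith
            · linarith
            · linarith
        _ = 2 := by norm_num
    · apply mul_nonneg (by linarith); apply mul_nonneg (by positivity); linarith
  · have e : (1 - 1 / r) * (-1 / r) * ζ ^ 2 * (P / S ^ 2)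
      = - ((1 - 1 / r) * (1 / r) * ((ζ * (P / S)) ^ 2 * (1 / P))) := by field_simp
    rw [e]
    have h6 : (ζ * (P / S)) ^ 2 * (1 / P) ≤ 1 / P := by
      apply mul_le_of_le_one_left (by positivity)
      apply pow_le_one₀ (by positivity) h1
    have h7 : (1 - 1 / r) * (1 / r) * ((ζ * (P / S)) ^ 2 * (1 / P)) ≤ 1 * 1 * (1 / P) := by
      gcongr <;> linarith
    have h8 : 1 / P ≤ T := by rw [div_le_iff₀ hP]; linarith
    have h9 : 8 / P = 8 * (1 / P) := by ring
    have h10 : 9 * T ≤ 9 * (1 + 1 / r) * T := by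
      apply mul_le_mul_of_nonneg_right _ hT.le; linarith
    linarith

lemma bel_quad {r ζ η : ℝ} (hr : 1 ≤ r) (hz : 0 < ζ) (he : 0 < η) (a b : Fin 2 → ℝ) (i j : Fin 2) :
    |a j| * |b i| ≤ ∑ m, (belzz r ζ η * a m ^ 2 + 2 * belze r ζ η * (a m * b m)
      + belee r ζ η * b m ^ 2) := by
  obtain ⟨h1, h2, h3⟩ := bel_hess hr hz he
  have hP := belP_pos (r := r) hz he
  generalize belP r ζ η = P at *
  generalize belzz r ζ η = A at *
  generalize belze r ζ η = B at *
  generalize belee r ζ η = C at *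
  have hA : ∑ m, (2 * P * a m ^ 2 - 4 * (|a m| * |b m|) + 8 / P * b m ^ 2) ≤
      ∑ m, (A * a m ^ 2 + 2 * B * (a m * b m) + C * b m ^ 2) := by
    apply Finset.sum_le_sum
    intro m _
    have t1 : |B * (a m * b m)| ≤ 2 * (|a m| * |b m|) := by
      rw [abs_mul, abs_mul]; gcongr
    have t2 := neg_le_of_abs_le t1
    have t3 : 2 * P * a m ^ 2 ≤ A * a m ^ 2 := by gcongr
    have t4 : 8 / P * b m ^ 2 ≤ C * b m ^ 2 := by gcongr
    nlinarith
  refine le_trans ?_ hA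
  have key : ∀ x y : ℝ, |x| * |y| ≤ P / 4 * x ^ 2 + 2 * (1 / (2 * P)) * y ^ 2 := by
    intro x y
    have : 0 ≤ (P * |x| / 2 - |y|) ^ 2 / P := by positivity
    have e : (P * |x| / 2 - |y|) ^ 2 / P
        = P / 4 * x ^ 2 + 2 * (1 / (2 * P)) * y ^ 2 - |x| * |y| := by
      rw [← sq_abs x, ← sq_abs y]; field_simp; ring
    linarith
  have e8 : 8 / P = 16 * (1 / (2 * P)) := by field_simp; norm_num
  rw [e8]
  simp only [Fin.sum_univ_two]
  set Q := 1 / (2 * P)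
  have hQ : 0 < Q := by positivity
  have k00 := key (a 0) (b 0)
  have k01 := key (a 0) (b 1)
  have k10 := key (a 1) (b 0)
  have k11 := key (a 1) (b 1)
  have : 0 ≤ P * a 0 ^ 2 := by positivity
  have : 0 ≤ P * a 1 ^ 2 := by positivity
  have : 0 ≤ Q * b 0 ^ 2 := by positivity
  have : 0 ≤ Q * b 1 ^ 2 := by positivity
  fin_cases i <;> fin_cases j <;> simp <;> linarith

lemma bel_bounds {r ζ η A : ℝ} (hr : 1 ≤ r) (hz : 0 < ζ) (he : 0 < η) (hzA : ζ ≤ A) (heA : η ≤ A) :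
    |belz r ζ η| ≤ (r + 1) * A * (A ^ r + A) ^ (1 - 1 / r) ∧
    |bele r ζ η| ≤ A + 9 * (r + 1) * A ^ (1 / r) ∧
    |belzz r ζ η| ≤ (2 + (r - 1) * (r + 3)) * (A ^ r + A) ^ (1 - 1 / r) ∧
    |belee r ζ η| * η ^ 2 ≤ 19 * A ^ (1 / r) * η := by
  obtain ⟨h1, h2, h3⟩ := bel_sizes hr hz he
  obtain ⟨g1, g2, g3⟩ := bel_hess hr hz he
  have hS := belS_pos (r := r) hz he
  have hP := belP_pos (r := r) hz he
  have hr0 : (0 : ℝ) < r := by linarith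
  have hZ := rpow_pos_of_pos hz r
  have hm0 : 0 ≤ 1 / r := by positivity
  have hm1 : 1 / r ≤ 1 := by rw [div_le_one hr0]; exact hr
  have hA : 0 < A := hz.trans_le hzA
  have hPA : belP r ζ η ≤ (A ^ r + A) ^ (1 - 1 / r) := by
    unfold belP belS
    gcongr
  have hη : η ^ (1 / r) ≤ A ^ (1 / r) := by gcongr
  have hη0 : 0 < η ^ (1 / r) := rpow_pos_of_pos he _
  have hη1 : η ^ (1 / r - 1) * η = η ^ (1 / r) := by
    rw [rpow_sub_one he.ne']; field_simp
  have hZS : ζ ^ r * (belP r ζ η / belS r ζ η) ≤ belP r ζ η := by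
    rw [mul_div_assoc', div_le_iff₀ hS, mul_comm]; gcongr
  have h31 : 1 / belP r ζ η ≤ η ^ (1 / r - 1) := by rw [div_le_iff₀ hP]; linarith
  have hP0 : 8 / belP r ζ η > 0 := by positivity
  rw [abs_of_nonneg (a := belzz r ζ η) (by linarith),
    abs_of_nonneg (a := belee r ζ η) (by linarith)]
  unfold belz bele belzz belee at *
  set P := belP r ζ η
  set S := belS r ζ η
  set Z := ζ ^ r
  set PA := (A ^ r + A) ^ (1 - 1 / r)
  have hW : 0 < P / S := by positivity
  refine ⟨?_, ?_, ?_, ?_⟩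
  · have e : 2 * ζ * P + (r - 1) * ζ * Z * (P / S) = ζ * (2 * P + (r - 1) * (Z * (P / S))) := by ring
    have hn : 0 ≤ (r - 1) * (Z * (P / S)) := mul_nonneg (by linarith) (by positivity)
    rw [e, abs_of_nonneg (mul_nonneg hz.le (by linarith))]
    have : 2 * P + (r - 1) * (Z * (P / S)) ≤ (r + 1) * PA := by
      have := mul_le_mul_of_nonneg_left hZS (by linarith : 0 ≤ r - 1)
      nlinarith
    calc _ ≤ A * ((r + 1) * PA) := by gcongr
      _ = _ := by ring
  · have e1 : 0 ≤ ζ ^ 2 * (P / S) := by positivity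
    have e2 : ζ ^ 2 * (P / S) ≤ A := by
      have : ζ ^ 2 * (P / S) = ζ * (ζ * (P / S)) := by ring
      rw [this]
      calc _ ≤ ζ * 1 := by gcongr
        _ ≤ A := by linarith
    have e3 : 9 * r * (1 + 1 / r) = 9 * (r + 1) := by field_simp
    rw [e3, mul_assoc (1 - 1 / r), abs_of_nonneg]
    · have : (1 - 1 / r) * (ζ ^ 2 * (P / S)) ≤ 1 * A := by gcongr <;> linarith
      have : 9 * (r + 1) * η ^ (1 / r) ≤ 9 * (r + 1) * A ^ (1 / r) := by gcongr
      linarith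
    · have := mul_nonneg (by linarith : 0 ≤ 1 - 1 / r) e1
      positivity
  · have t1 : (r - 1) * (r + 3) * Z * (P / S) ≤ (r - 1) * (r + 3) * PA := by
      rw [mul_assoc]
      apply mul_le_mul_of_nonneg_left (hZS.trans hPA)
      apply mul_nonneg <;> linarith
    have t2 : 0 ≤ (r - 1) * Z ^ 2 * (P / S ^ 2) := by
      apply mul_nonneg (mul_nonneg (by linarith) (by positivity)); positivity
    linarith
  · have t1 : (1 - 1 / r) * (-1 / r) * ζ ^ 2 * (P / S ^ 2) ≤ 0 := by
      have : (1 - 1 / r) * (-1 / r) * ζ ^ 2 * (P / S ^ 2)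
        = - ((1 - 1 / r) * ((1 / r) * ζ ^ 2 * (P / S ^ 2))) := by ring
      rw [this, neg_nonpos]
      exact mul_nonneg (by linarith) (by positivity)
    have t2 : 9 * (1 + 1 / r) * η ^ (1 / r - 1) * η ^ 2 = 9 * (1 + 1 / r) * (η ^ (1 / r) * η) := by
      rw [← hη1]; ring
    calc _ ≤ 9 * (1 + 1 / r) * η ^ (1 / r - 1) * η ^ 2 := by
          gcongr; linarith
      _ = 9 * (1 + 1 / r) * (η ^ (1 / r) * η) := t2
      _ ≤ 19 * (A ^ (1 / r) * η) := by gcongr; linarith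
      _ = _ := by ring

lemma bel_le {r ζ η : ℝ} (hr : 1 ≤ r) (hz : 0 < ζ) (he : 0 < η) :
    0 ≤ bel r ζ η ∧ bel r ζ η ≤ (9 * r + 2) * (ζ ^ (r + 1) + η ^ (1 + 1 / r)) := by
  obtain ⟨h1, h2, h3⟩ := bel_sizes hr hz he
  have hS := belS_pos (r := r) hz he
  have hP := belP_pos (r := r) hz he
  have hr0 : (0 : ℝ) < r := by linarith
  have hc : (r + 1).HolderConjugate (1 + 1 / r) := by
    rw [Real.holderConjugate_iff]
    refine ⟨by linarith, by field_simp; ring⟩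
  have hy := Real.young_inequality_of_nonneg hz.le he.le hc
  have ha := rpow_pos_of_pos hz (r + 1)
  have hb := rpow_pos_of_pos he (1 + 1 / r)
  have ha' : ζ ^ (r + 1) / (r + 1) ≤ ζ ^ (r + 1) := div_le_self ha.le (by linarith)
  have hb' : η ^ (1 + 1 / r) / (1 + 1 / r) ≤ η ^ (1 + 1 / r) :=
    div_le_self hb.le (by have : 0 < 1 / r := by positivity
                          linarith)
  constructor
  · unfold bel; positivity
  · have e : ζ ^ 2 * belP r ζ η = ζ * belS r ζ η * (ζ * (belP r ζ η / belS r ζ η)) := by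
      field_simp
    have e2 : ζ * belS r ζ η = ζ ^ (r + 1) + ζ * η := by
      unfold belS; rw [rpow_add_one hz.ne']; ring
    have : ζ ^ 2 * belP r ζ η ≤ ζ ^ (r + 1) + ζ * η := by
      rw [← e2, e]; exact mul_le_of_le_one_right (by positivity) h1
    unfold bel
    nlinarith


abbrev ee (i : Fin 2) : E2 := EuclideanSpace.single i (1 : ℝ)

def gk (t : ℝ) (z : E2) : ℝ := (4 * π * t)⁻¹ * Real.exp (-(‖z‖ ^ 2) / (4 * t))
def gk1 (t : ℝ) (i : Fin 2) (z : E2) : ℝ := -(z i / (2 * t)) * gk t z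
def gk2 (t : ℝ) (i j : Fin 2) (z : E2) : ℝ :=
  (z i * z j / (4 * t ^ 2) - (if i = j then 1 / (2 * t) else 0)) * gk t z
def cv (f k : E2 → ℝ) (x : E2) : ℝ := ∫ y, f y * k (x - y)

lemma gk_pos {t : ℝ} (ht : 0 < t) (z : E2) : 0 < gk t z := by unfold gk; positivity

@[fun_prop] lemma gk_cont (t : ℝ) : Continuous (gk t) := by unfold gk; fun_prop
@[fun_prop] lemma gk1_cont (t : ℝ) (i) : Continuous (gk1 t i) := by unfold gk1; fun_prop
@[fun_prop] lemma gk2_cont (t : ℝ) (i j) : Continuous (gk2 t i j) := by unfold gk2; fun_prop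

lemma normsq_line (z : E2) (s : ℝ) (i : Fin 2) :
    ‖z + s • ee i‖ ^ 2 = ‖z‖ ^ 2 + 2 * s * z i + s ^ 2 := by
  rw [norm_add_sq_real, inner_smul_right, norm_smul]
  simp [EuclideanSpace.inner_single_right]
  ring

lemma gk_line (t : ℝ) (z : E2) (i : Fin 2) :
    HasLineDerivAt ℝ (gk t) (gk1 t i z) z (ee i) := by
  unfold HasLineDerivAt
  simp only [gk, gk1, normsq_line]
  have h1 : HasDerivAt (fun s : ℝ => -(‖z‖ ^ 2 + 2 * s * z i + s ^ 2) / (4 * t))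
      (-(2 * z i) / (4 * t)) 0 := by
    have := (((((hasDerivAt_id (0 : ℝ)).const_mul 2).mul_const (z i)).const_add (‖z‖ ^ 2)).add
      ((hasDerivAt_id (0 : ℝ)).pow 2)).neg.div_const (4 * t)
    refine this.congr_deriv ?_
    simp
  have h2 := (h1.exp).const_mul (4 * π * t)⁻¹
  refine h2.congr_deriv ?_
  simp only [mul_zero, zero_mul, add_zero, ne_eq, OfNat.ofNat_ne_zero, not_false_eq_true, zero_pow]
  ring

lemma gk1_line (t : ℝ) (z : E2) (i j : Fin 2) :
    HasLineDerivAt ℝ (gk1 t i) (gk2 t i j z) z (ee j) := by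
  have h := gk_line t z j
  unfold HasLineDerivAt at *
  have hc : HasDerivAt (fun s : ℝ => -((z + s • ee j) i / (2 * t)))
      (-((if i = j then 1 else 0) / (2 * t))) 0 := by
    have : HasDerivAt (fun s : ℝ => -((z i + s * (if i = j then 1 else 0)) / (2 * t)))
      (-((1 * (if i = j then 1 else 0)) / (2 * t))) 0 :=
      (((((hasDerivAt_id (0 : ℝ)).mul_const _).const_add (z i)).div_const (2 * t))).neg
    convert this using 1
    · ext s
      simp [PiLp.single_apply]
    · ring
  have h2 := hc.mul h
  refine h2.congr_deriv ?_
  simp only [gk1, gk2, zero_smul, add_zero]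
  split_ifs <;> ring

lemma gk_time {t : ℝ} (ht : t ≠ 0) (z : E2) :
    HasDerivAt (fun t => gk t z) (gk2 t 0 0 z + gk2 t 1 1 z) t := by
  unfold gk
  have h1 : HasDerivAt (fun t : ℝ => (4 * π * t)⁻¹) (-(4 * π) / (4 * π * t) ^ 2) t := by
    have := ((hasDerivAt_id t).const_mul (4 * π)).inv (by simp [pi_ne_zero, ht])
    refine this.congr_deriv ?_
    simp
  have h2 : HasDerivAt (fun t : ℝ => -(‖z‖ ^ 2) / (4 * t)) (‖z‖ ^ 2 * 4 / (4 * t) ^ 2) t := by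
    have := (hasDerivAt_const t (-(‖z‖ ^ 2))).div ((hasDerivAt_id t).const_mul 4)
      (by simp [ht])
    refine this.congr_deriv ?_
    simp
  have h3 := h1.mul h2.exp
  refine h3.congr_deriv ?_
  have hn : ‖z‖ ^ 2 = z 0 ^ 2 + z 1 ^ 2 := by
    rw [EuclideanSpace.norm_sq_eq]; simp
  simp only [gk2, gk, if_true]
  generalize Real.exp _ = X
  rw [hn]
  have := pi_ne_zero
  field_simp
  ring

/-- differentiation under the integral -/
lemma param_deriv {f : E2 → ℝ} (hf : Continuous f) (hc : HasCompactSupport f)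
    {κ κ' : ℝ → E2 → ℝ} {s0 δ : ℝ} (hδ : 0 < δ)
    (h : ∀ s ∈ Metric.closedBall s0 δ, ∀ y, HasDerivAt (fun s => κ s y) (κ' s y) s)
    (hκ : ∀ s, Continuous (κ s))
    (hκ' : ContinuousOn (Function.uncurry κ') (Metric.closedBall s0 δ ×ˢ univ)) :
    HasDerivAt (fun s => ∫ y, f y * κ s y) (∫ y, f y * κ' s0 y) s0 := by
  have hcomp : IsCompact (Metric.closedBall s0 δ ×ˢ tsupport f) :=
    (isCompact_closedBall s0 δ).prod hc
  obtain ⟨M, hM⟩ := hcomp.exists_bound_of_continuousOn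
    (hκ'.mono (prod_mono_right (subset_univ _)))
  have hk0 : Continuous (κ' s0) := by
    have : ContinuousOn (fun y => Function.uncurry κ' (s0, y)) univ :=
      hκ'.comp (by fun_prop) (fun y _ => ⟨Metric.mem_closedBall_self hδ.le, mem_univ _⟩)
    exact continuousOn_univ.1 this
  refine (hasDerivAt_integral_of_dominated_loc_of_deriv_le (F := fun s y => f y * κ s y)
    (F' := fun s y => f y * κ' s y) (bound := fun y => |f y| * M)
    (Metric.closedBall_mem_nhds s0 hδ) ?_ ?_ ?_ ?_ ?_ ?_).2
  · filter_upwards with s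
    exact (hf.mul (hκ s)).aestronglyMeasurable
  · exact (hf.mul (hκ s0)).integrable_of_hasCompactSupport hc.mul_right
  · exact (hf.mul hk0).aestronglyMeasurable
  · filter_upwards with y s hs
    rw [norm_mul]
    by_cases hy : y ∈ tsupport f
    · exact mul_le_mul_of_nonneg_left (hM (s, y) ⟨hs, hy⟩) (norm_nonneg _)
    · simp [image_eq_zero_of_notMem_tsupport hy]
  · exact (hf.abs.mul continuous_const).integrable_of_hasCompactSupport
      (hc.abs.mul_right)
  · filter_upwards with y s hs
    exact (h s hs y).const_mul _

lemma cv_line {f : E2 → ℝ} (hf : Continuous f) (hc : HasCompactSupport f) {k k' : E2 → ℝ}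
    (v : E2) (h : ∀ z, HasLineDerivAt ℝ k (k' z) z v) (hk : Continuous k) (hk' : Continuous k')
    (x : E2) : HasLineDerivAt ℝ (cv f k) (cv f k' x) x v := by
  unfold HasLineDerivAt cv
  have := param_deriv hf hc (κ := fun s y => k (x + s • v - y))
    (κ' := fun s y => k' (x + s • v - y)) (s0 := 0) (δ := 1) one_pos ?_ ?_ ?_
  · simpa using this
  · intro s _ y
    have h1 := h (x + s • v - y)
    unfold HasLineDerivAt at h1
    have h2 : HasDerivAt (fun r : ℝ => r - s) 1 s := (hasDerivAt_id s).sub_const s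
    have h3 : HasDerivAt (fun t : ℝ => k (x + s • v - y + t • v)) (k' (x + s • v - y)) (s - s) := by
      simpa using h1
    have h4 := HasDerivAt.comp (h := fun r : ℝ => r - s) s h3 h2
    simp only [mul_one] at h4
    have e : (fun r : ℝ => k (x + r • v - y))
        = ((fun t => k (x + s • v - y + t • v)) ∘ fun r => r - s) := by
      funext r
      simp only [Function.comp]
      congr 1
      module
    show HasDerivAt (fun r : ℝ => k (x + r • v - y)) _ s
    rw [e]
    exact h4
  · intro s; fun_prop
  · apply Continuous.continuousOn
    simp only [Function.uncurry_def]
    fun_prop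

lemma cv_time {f : E2 → ℝ} (hf : Continuous f) (hc : HasCompactSupport f) {t : ℝ} (ht : 0 < t)
    (x : E2) : HasDerivAt (fun t => cv f (gk t) x)
      (cv f (gk2 t 0 0) x + cv f (gk2 t 1 1) x) t := by
  have hpos : ∀ s ∈ Metric.closedBall t (t / 2), s ≠ 0 := by
    intro s hs
    rw [Metric.mem_closedBall, Real.dist_eq] at hs
    have := neg_le_of_abs_le hs
    linarith
  have := param_deriv hf hc (κ := fun s y => gk s (x - y))
    (κ' := fun s y => gk2 s 0 0 (x - y) + gk2 s 1 1 (x - y)) (s0 := t) (δ := t / 2) (by linarith)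
    ?_ ?_ ?_
  · unfold cv
    convert this using 1
    rw [← integral_add]
    · congr 1; ext y; ring
    · exact (by fun_prop : Continuous fun y => f y * gk2 t 0 0 (x - y)).integrable_of_hasCompactSupport
        hc.mul_right
    · exact (by fun_prop : Continuous fun y => f y * gk2 t 1 1 (x - y)).integrable_of_hasCompactSupport
        hc.mul_right
  · intro s hs y
    exact gk_time (hpos s hs) _
  · intro s; fun_prop
  · simp only [Function.uncurry_def, gk2, gk, if_true]
    have hp1 : ∀ p ∈ Metric.closedBall t (t / 2) ×ˢ (univ : Set E2), p.1 ≠ 0 :=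
      fun p hp => hpos p.1 hp.1
    have := pi_ne_zero
    intro p hp
    apply ContinuousAt.continuousWithinAt
    have hp' := hp1 p hp
    have h4 : 4 * p.1 ≠ 0 := by positivity
    have h5 : 4 * p.1 ^ 2 ≠ 0 := by positivity
    have h6 : 2 * p.1 ≠ 0 := by positivity
    have h7 : 4 * π * p.1 ≠ 0 := by positivity
    fun_prop (disch := assumption)

/-- kernels decay -/
lemma gk_decay {a b : ℝ} (ha : 0 < a) (hab : a ≤ b) : ∃ A c : ℝ, 0 ≤ A ∧ 0 < c ∧
    ∀ t ∈ Icc a b, ∀ z : E2, |gk t z| ≤ A * Real.exp (-c * ‖z‖ ^ 2) ∧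
      (∀ i, |gk1 t i z| ≤ A * Real.exp (-c * ‖z‖ ^ 2)) ∧
      (∀ i j, |gk2 t i j z| ≤ A * Real.exp (-c * ‖z‖ ^ 2)) := by
  have hb : 0 < b := ha.trans_le hab
  set A0 := (4 * π * a)⁻¹
  have hA0 : 0 < A0 := by positivity
  refine ⟨A0 * (1 + 2 / a + 8 * b / (a * a) + 8 * b + 1 / a), 1 / (8 * b), by positivity,
    by positivity, ?_⟩
  intro t ht z
  have ht0 : 0 < t := ha.trans_le ht.1
  set E := Real.exp (-(1 / (8 * b)) * ‖z‖ ^ 2) with hE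
  have hE0 : 0 < E := Real.exp_pos _
  have hX : Real.exp (-(‖z‖ ^ 2) / (4 * t)) ≤ E * E := by
    rw [hE, ← Real.exp_add]
    apply Real.exp_le_exp.2
    have : ‖z‖ ^ 2 / (4 * b) ≤ ‖z‖ ^ 2 / (4 * t) := by gcongr; exact ht.2
    have e : -(1 / (8 * b)) * ‖z‖ ^ 2 + -(1 / (8 * b)) * ‖z‖ ^ 2 = - (‖z‖ ^ 2 / (4 * b)) := by
      field_simp; ring
    rw [e, neg_div]; linarith
  have hEle : E ≤ 1 := by
    rw [hE]; apply Real.exp_le_one_iff.2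
    have : 0 ≤ 1 / (8 * b) * ‖z‖ ^ 2 := by positivity
    linarith
  have hzE : ‖z‖ ^ 2 * E ≤ 8 * b := by
    have h1 : ‖z‖ ^ 2 / (8 * b) ≤ Real.exp (1 / (8 * b) * ‖z‖ ^ 2) := by
      have := Real.add_one_le_exp (1 / (8 * b) * ‖z‖ ^ 2)
      have e : ‖z‖ ^ 2 / (8 * b) = 1 / (8 * b) * ‖z‖ ^ 2 := by ring
      linarith
    have h2 : E * Real.exp (1 / (8 * b) * ‖z‖ ^ 2) = 1 := by
      rw [hE, ← Real.exp_add]; simp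
    have h3 : ‖z‖ ^ 2 / (8 * b) * E ≤ 1 := by
      rw [← h2, mul_comm E]; gcongr
    rw [div_mul_eq_mul_div, div_le_iff₀ (by positivity)] at h3
    linarith
  have hg : gk t z ≤ A0 * (E * E) := by
    have hA1 : (4 * π * t)⁻¹ ≤ A0 := by
      show _ ≤ (4 * π * a)⁻¹
      gcongr
      exact ht.1
    unfold gk
    exact mul_le_mul hA1 hX (Real.exp_pos _).le hA0.le
  have hg0 := gk_pos ht0 z
  have hcoord : ∀ i, |z i| ≤ ‖z‖ := fun i => by
    simpa using PiLp.norm_apply_le z i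
  have h1t : 1 / t ≤ 1 / a := by gcongr; exact ht.1
  -- general
  have gen : ∀ (m : ℝ) , |m| ≤ (1 + 2 / a + 1 / a) + (1 / (a * a) + 1) * ‖z‖ ^ 2 →
      |m * gk t z| ≤ A0 * (1 + 2 / a + 8 * b / (a * a) + 8 * b + 1 / a) * E := by
    intro m hm
    rw [abs_mul, abs_of_pos hg0]
    calc |m| * gk t z ≤ ((1 + 2 / a + 1 / a) + (1 / (a * a) + 1) * ‖z‖ ^ 2) * (A0 * (E * E)) := by
          gcongr
      _ = A0 * ((1 + 2 / a + 1 / a) * E + (1 / (a * a) + 1) * (‖z‖ ^ 2 * E)) * E := by ring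
      _ ≤ A0 * ((1 + 2 / a + 1 / a) * 1 + (1 / (a * a) + 1) * (8 * b)) * E := by gcongr
      _ = _ := by ring
  have ha2 : 0 < 1 / (a * a) := by positivity
  have ha1 : 0 < 1 / a := by positivity
  have ha3 : 2 / a = 2 * (1 / a) := by ring
  refine ⟨?_, ?_, ?_⟩
  · have := gen 1 (by rw [abs_one, ha3]; nlinarith [sq_nonneg ‖z‖, mul_nonneg ha2.le (sq_nonneg ‖z‖)])
    simpa using this
  · intro i
    apply gen
    rw [abs_neg, abs_div, abs_of_pos (by positivity : 0 < 2 * t)]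
    have h2 : |z i| / (2 * t) ≤ ‖z‖ * (1 / a) := by
      rw [div_eq_mul_one_div]
      gcongr
      · exact hcoord i
      · linarith [ht.1]
    have h3 : ‖z‖ * (1 / a) ≤ 1 / (a * a) * ‖z‖ ^ 2 + 1 := by
      have : 0 ≤ (‖z‖ * (1 / a) - 1) ^ 2 := sq_nonneg _
      have e : (‖z‖ * (1 / a)) ^ 2 = 1 / (a * a) * ‖z‖ ^ 2 := by field_simp
      nlinarith
    nlinarith [sq_nonneg ‖z‖]
  · intro i j
    apply gen
    have h2 : |z i * z j / (4 * t ^ 2)| ≤ 1 / (a * a) * ‖z‖ ^ 2 := by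
      rw [abs_div, abs_mul, abs_of_pos (by positivity : 0 < 4 * t ^ 2)]
      have : |z i| * |z j| ≤ ‖z‖ ^ 2 := by
        rw [sq]; exact mul_le_mul (hcoord i) (hcoord j) (abs_nonneg _) (norm_nonneg _)
      rw [div_eq_mul_one_div, mul_comm]
      exact mul_le_mul (one_div_le_one_div_of_le (by positivity) (by nlinarith [ht.1])) this
        (by positivity) (by positivity)
    have h3 : |(if i = j then 1 / (2 * t) else 0)| ≤ 1 / a := by
      split_ifs
      · rw [abs_of_pos (by positivity)]
        gcongr
        linarith [ht.1]
      · simp [ha.le]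
    have := abs_sub (z i * z j / (4 * t ^ 2)) (if i = j then 1 / (2 * t) else 0)
    nlinarith [sq_nonneg ‖z‖]

lemma exists_supp_ball {f : E2 → ℝ} (hc : HasCompactSupport f) :
    ∃ R : ℝ, 1 ≤ R ∧ ∀ y, R < ‖y‖ → f y = 0 := by
  obtain ⟨R, hR⟩ := hc.isBounded.subset_closedBall 0
  refine ⟨max R 1, le_max_right _ _, fun y hy => ?_⟩
  apply image_eq_zero_of_notMem_tsupport
  intro h
  have := hR h
  simp only [mem_closedBall_zero_iff] at this
  exact absurd this (not_le.2 (lt_of_le_of_lt (le_max_left _ _) hy))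

lemma cv_decay_aux {f : E2 → ℝ} (hf : Continuous f) (hc : HasCompactSupport f) {c A : ℝ}
    (hA : 0 ≤ A) (hcc : 0 < c) :
    ∃ A' : ℝ, 0 ≤ A' ∧ ∀ k : E2 → ℝ, (∀ z, |k z| ≤ A * Real.exp (-c * ‖z‖ ^ 2)) →
      ∀ x, |cv f k x| ≤ A' * Real.exp (-(c / 2) * ‖x‖ ^ 2) := by
  obtain ⟨R, hR1, hR⟩ := exists_supp_ball hc
  have hi : Integrable (fun y => |f y|) := hf.abs.integrable_of_hasCompactSupport hc.abs
  have hi0 : 0 ≤ ∫ y, |f y| := integral_nonneg (fun _ => abs_nonneg _)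
  refine ⟨(∫ y, |f y|) * (A * Real.exp (c * R ^ 2)), by positivity, ?_⟩
  intro k hk x
  unfold cv
  have : ∀ y, ‖f y * k (x - y)‖ ≤ |f y| * (A * Real.exp (c * R ^ 2) * Real.exp (-(c / 2) * ‖x‖ ^ 2)) := by
    intro y
    rw [norm_mul, Real.norm_eq_abs, Real.norm_eq_abs]
    by_cases hy : R < ‖y‖
    · simp [hR y hy]
    · gcongr
      refine (hk _).trans ?_
      rw [mul_assoc, ← Real.exp_add]
      gcongr
      push Not at hy
      have h1 : ‖x‖ ≤ ‖x - y‖ + ‖y‖ := by simpa using norm_add_le (x - y) y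
      have h2 : ‖x‖ ^ 2 ≤ 2 * ‖x - y‖ ^ 2 + 2 * R ^ 2 := by
        nlinarith [norm_nonneg x, norm_nonneg (x - y), norm_nonneg y, sq_nonneg (‖x - y‖ - R)]
      nlinarith
  calc |∫ y, f y * k (x - y)| ≤ ∫ y, |f y| * (A * Real.exp (c * R ^ 2) * Real.exp (-(c / 2) * ‖x‖ ^ 2)) :=
        norm_integral_le_of_norm_le (hi.mul_const _) (Filter.Eventually.of_forall this)
    _ = _ := by rw [integral_mul_const]; ring

lemma cv_decay {f : E2 → ℝ} (hf : Continuous f) (hc : HasCompactSupport f) {a b : ℝ} (ha : 0 < a)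
    (hab : a ≤ b) : ∃ A c : ℝ, 0 ≤ A ∧ 0 < c ∧
    ∀ t ∈ Icc a b, ∀ x : E2, |cv f (gk t) x| ≤ A * Real.exp (-c * ‖x‖ ^ 2) ∧
      (∀ i, |cv f (gk1 t i) x| ≤ A * Real.exp (-c * ‖x‖ ^ 2)) ∧
      (∀ i j, |cv f (gk2 t i j) x| ≤ A * Real.exp (-c * ‖x‖ ^ 2)) := by
  obtain ⟨A, c, hA, hcc, h⟩ := gk_decay ha hab
  obtain ⟨A', hA', h'⟩ := cv_decay_aux hf hc hA hcc
  exact ⟨A', c / 2, hA', by positivity, fun t ht x => ⟨h' _ (fun z => (h t ht z).1) x,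
    fun i => h' _ (fun z => (h t ht z).2.1 i) x, fun i j => h' _ (fun z => (h t ht z).2.2 i j) x⟩⟩

lemma cv_cont {f : E2 → ℝ} (hf : Continuous f) (hc : HasCompactSupport f) {k : E2 → ℝ}
    (hk : Continuous k) : Continuous (cv f k) := by
  have := hc.continuous_convolution_left (ContinuousLinearMap.mul ℝ ℝ) hf
    (hk.locallyIntegrable (μ := volume))
  exact this

lemma gauss_integrable {c : ℝ} (hc : 0 < c) : Integrable (fun x : E2 => Real.exp (-c * ‖x‖ ^ 2)) := by
  have := GaussianFourier.integrable_cexp_neg_mul_sq_norm_add (V := E2) (b := (c : ℂ)) (by simpa) 0 0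
  have := this.re
  convert this using 1
  ext x
  simp only [zero_mul, add_zero]
  have : (-(c : ℂ) * (‖x‖ : ℂ) ^ 2) = ((-c * ‖x‖ ^ 2 : ℝ) : ℂ) := by push_cast; ring
  rw [this, ← Complex.ofReal_exp]
  exact (Complex.ofReal_re _).symm


def GB (h : E2 → ℝ) : Prop := ∃ A c : ℝ, 0 ≤ A ∧ 0 < c ∧ ∀ x, |h x| ≤ A * Real.exp (-c * ‖x‖ ^ 2)

lemma GB.add {h k : E2 → ℝ} (hh : GB h) (hk : GB k) : GB (fun x => h x + k x) := by
  obtain ⟨A, c, hA, hc, h1⟩ := hh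
  obtain ⟨B, d, hB, hd, h2⟩ := hk
  refine ⟨A + B, min c d, by positivity, lt_min hc hd, fun x => ?_⟩
  have e1 : Real.exp (-c * ‖x‖ ^ 2) ≤ Real.exp (-(min c d) * ‖x‖ ^ 2) := by
    gcongr; exact min_le_left _ _
  have e2 : Real.exp (-d * ‖x‖ ^ 2) ≤ Real.exp (-(min c d) * ‖x‖ ^ 2) := by
    gcongr; exact min_le_right _ _
  calc |h x + k x| ≤ |h x| + |k x| := abs_add_le _ _
    _ ≤ A * Real.exp (-c * ‖x‖ ^ 2) + B * Real.exp (-d * ‖x‖ ^ 2) := add_le_add (h1 x) (h2 x)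
    _ ≤ A * Real.exp (-(min c d) * ‖x‖ ^ 2) + B * Real.exp (-(min c d) * ‖x‖ ^ 2) := by gcongr
    _ = _ := by ring

lemma GB.of_le {h k : E2 → ℝ} {M : ℝ} (hM : 0 ≤ M) (hk : GB k) (hh : ∀ x, |h x| ≤ M * |k x|) : GB h := by
  obtain ⟨B, d, hB, hd, h2⟩ := hk
  refine ⟨M * B, d, by positivity, hd, fun x => (hh x).trans ?_⟩
  rw [mul_assoc]
  exact mul_le_mul_of_nonneg_left (h2 x) hM

lemma GB.bdd {h k : E2 → ℝ} {M : ℝ} (hk : GB k) (hh : ∀ x, |h x| ≤ M) : GB (fun x => h x * k x) :=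
  GB.of_le ((abs_nonneg _).trans (hh 0)) hk (fun x => by
    rw [abs_mul]; exact mul_le_mul_of_nonneg_right (hh x) (abs_nonneg _))

lemma GB.bounded {h : E2 → ℝ} (hh : GB h) : ∃ A, 0 ≤ A ∧ ∀ x, |h x| ≤ A := by
  obtain ⟨A, c, hA, hc, h1⟩ := hh
  refine ⟨A, hA, fun x => (h1 x).trans ?_⟩
  have : Real.exp (-c * ‖x‖ ^ 2) ≤ 1 := by
    apply Real.exp_le_one_iff.2
    have : 0 ≤ c * ‖x‖ ^ 2 := by positivity
    linarith
  nlinarith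

lemma GB.mul {h k : E2 → ℝ} (hh : GB h) (hk : GB k) : GB (fun x => h x * k x) := by
  obtain ⟨A, hA, h1⟩ := hh.bounded
  exact hk.bdd h1

lemma GB.abs {h : E2 → ℝ} (hh : GB h) : GB (fun x => |h x|) :=
  GB.of_le zero_le_one hh (fun x => by simp)

lemma GB.integrable {h : E2 → ℝ} (hh : GB h) (hm : Measurable h) : Integrable h := by
  obtain ⟨A, c, hA, hc, h1⟩ := hh
  exact ((gauss_integrable hc).const_mul A).mono' hm.aestronglyMeasurable
    (Filter.Eventually.of_forall h1)

lemma GB.poly {h k : E2 → ℝ} {M R : ℝ} (hM : 0 ≤ M) (hk : GB k)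
    (hh : ∀ x, |h x| ≤ M * (‖x‖ + R) ^ 2 * |k x|) : GB h := by
  obtain ⟨B, d, hB, hd, h2⟩ := hk
  refine ⟨M * B * (2 * (2 / d) + 2 * R ^ 2), d / 2, by positivity, by positivity, fun x => (hh x).trans ?_⟩
  set E := Real.exp (-(d / 2) * ‖x‖ ^ 2) with hE
  have hE0 : 0 < E := Real.exp_pos _
  have hE1 : E ≤ 1 := by
    apply Real.exp_le_one_iff.2
    have : 0 ≤ (d / 2) * ‖x‖ ^ 2 := by positivity
    linarith
  have hEE : Real.exp (-d * ‖x‖ ^ 2) = E * E := by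
    rw [hE, ← Real.exp_add]; congr 1; ring
  have hxE : ‖x‖ ^ 2 * E ≤ 2 / d := by
    have h1 := Real.add_one_le_exp ((d / 2) * ‖x‖ ^ 2)
    have h3 : E * Real.exp ((d / 2) * ‖x‖ ^ 2) = 1 := by
      rw [hE, ← Real.exp_add]; simp
    have h4 : ((d / 2) * ‖x‖ ^ 2) * E ≤ 1 := by nlinarith
    rw [le_div_iff₀ hd]; nlinarith
  calc M * (‖x‖ + R) ^ 2 * |k x| ≤ M * (2 * ‖x‖ ^ 2 + 2 * R ^ 2) * (B * (E * E)) := by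
        have := h2 x
        rw [hEE] at this
        gcongr
        nlinarith [sq_nonneg (‖x‖ - R)]
    _ = M * B * (2 * (‖x‖ ^ 2 * E) + 2 * R ^ 2 * E) * E := by ring
    _ ≤ M * B * (2 * (2 / d) + 2 * R ^ 2 * 1) * E := by gcongr
    _ = _ := by ring

section
variable {f : E2 → ℝ} (hf : Continuous f) (hc : HasCompactSupport f)
include hf hc

lemma cv_gb {t : ℝ} (ht : 0 < t) : GB (cv f (gk t)) ∧ (∀ i, GB (cv f (gk1 t i))) ∧
    ∀ i j, GB (cv f (gk2 t i j)) := by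
  obtain ⟨A, c, hA, hc, h⟩ := cv_decay hf hc ht le_rfl
  have := h t ⟨le_rfl, le_rfl⟩
  exact ⟨⟨A, c, hA, hc, fun x => (this x).1⟩, fun i => ⟨A, c, hA, hc, fun x => (this x).2.1 i⟩,
    fun i j => ⟨A, c, hA, hc, fun x => (this x).2.2 i j⟩⟩

lemma cv_pos (h0 : ∀ x, 0 ≤ f x) (hne : ∃ x, f x ≠ 0) {t : ℝ} (ht : 0 < t) (x : E2) :
    0 < cv f (gk t) x := by
  obtain ⟨y, hy⟩ := hne
  exact Continuous.integral_pos_of_hasCompactSupport_nonneg_nonzero (x := y)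
    (by fun_prop) hc.mul_right (fun y => mul_nonneg (h0 y) (gk_pos ht _).le)
    (mul_ne_zero hy (gk_pos ht _).ne')

lemma cv_gk1_bound (h0 : ∀ x, 0 ≤ f x) : ∃ R : ℝ, 0 ≤ R ∧ ∀ t : ℝ, 0 < t → ∀ (i : Fin 2) (x : E2),
    |cv f (gk1 t i) x| ≤ (‖x‖ + R) / (2 * t) * cv f (gk t) x := by
  obtain ⟨R, hR1, hR⟩ := exists_supp_ball hc
  refine ⟨R, by linarith, fun t ht i x => ?_⟩
  unfold cv
  rw [← integral_const_mul]
  refine norm_integral_le_of_norm_le (f := fun y => f y * gk1 t i (x - y)) ?_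
    (Filter.Eventually.of_forall ?_)
  · exact (by fun_prop : Continuous fun y => (‖x‖ + R) / (2 * t) * (f y * gk t (x - y))).integrable_of_hasCompactSupport
        hc.mul_right.mul_left
  · intro y
    by_cases hy : R < ‖y‖
    · simp [hR y hy]
    · push Not at hy
      have hg := gk_pos ht (x - y)
      have h1 : |(x - y) i| ≤ ‖x‖ + R := by
        have := PiLp.norm_apply_le (x - y) i
        rw [Real.norm_eq_abs] at this
        linarith [norm_sub_le x y]
      rw [norm_mul, gk1, norm_mul, Real.norm_eq_abs, Real.norm_eq_abs, Real.norm_eq_abs, abs_neg,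
        abs_div, abs_of_pos (by positivity : 0 < 2 * t), abs_of_pos hg, abs_of_nonneg (h0 y)]
      calc f y * (|(x - y) i| / (2 * t) * gk t (x - y)) ≤ f y * ((‖x‖ + R) / (2 * t) * gk t (x - y)) := by
            have := h0 y
            gcongr
        _ = _ := by ring
end

lemma int_line_zero {V V' : E2 → ℝ} {v : E2} (h : ∀ x, HasLineDerivAt ℝ V (V' x) x v)
    (hV : Integrable V) (hV' : Integrable V') : ∫ x, V' x = 0 := by
  have := integral_bilinear_hasLineDerivAt_right_eq_neg_left_of_integrable (μ := (volume : Measure E2))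
    (f := fun _ : E2 => (1 : ℝ)) (f' := fun _ => 0) (g := V) (g' := V') (v := v)
    (B := ContinuousLinearMap.mul ℝ ℝ) (by simp) (by simpa using hV') (by simpa using hV)
    (fun x _ => by simpa [HasLineDerivAt] using hasDerivAt_const (0 : ℝ) (1 : ℝ)) (fun x _ => h x)
  simpa using this

lemma line_comp2 {F G : E2 → ℝ} {F' G' : ℝ} {x v : E2} {Φ : ℝ → ℝ → ℝ} {d : ℝ}
    (hF : HasLineDerivAt ℝ F F' x v) (hG : HasLineDerivAt ℝ G G' x v)
    (H : ∀ {f g : ℝ → ℝ} {f' g' s : ℝ}, HasDerivAt f f' s → HasDerivAt g g' s → f s = F x → g s = G x →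
      f' = F' → g' = G' → HasDerivAt (fun s => Φ (f s) (g s)) d s) :
    HasLineDerivAt ℝ (fun y => Φ (F y) (G y)) d x v := by
  unfold HasLineDerivAt at *
  exact H hF hG (by simp) (by simp) rfl rfl

section
variable {r : ℝ} (hr : 1 ≤ r) {f g : E2 → ℝ} (hf : Continuous f) (hfc : HasCompactSupport f)
  (hg : Continuous g) (hgc : HasCompactSupport g) (hf0 : ∀ x, 0 ≤ f x) (hg0 : ∀ x, 0 ≤ g x)
  (hfn : ∃ x, f x ≠ 0) (hgn : ∃ x, g x ≠ 0)
include hr hf hfc hg hgc hf0 hg0 hfn hgn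

lemma hb_ibp {t : ℝ} (ht : 0 < t) (i j : Fin 2) :
    ∫ x, |cv f (gk1 t j) x| * |cv g (gk1 t i) x| ≤
    -∫ x, (belz r (cv f (gk t) x) (cv g (gk t) x) * (cv f (gk2 t 0 0) x + cv f (gk2 t 1 1) x)
      + bele r (cv f (gk t) x) (cv g (gk t) x) * (cv g (gk2 t 0 0) x + cv g (gk2 t 1 1) x)) := by
  have hFp := fun x => cv_pos hf hfc hf0 hfn ht x
  have hGp := fun x => cv_pos hg hgc hg0 hgn ht x
  obtain ⟨hF0, hF1, hF2⟩ := cv_gb hf hfc ht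
  obtain ⟨hG0, hG1, hG2⟩ := cv_gb hg hgc ht
  obtain ⟨R, hR, hGR⟩ := cv_gk1_bound hg hgc hg0
  replace hGR := hGR t ht
  have lF := fun m x => cv_line hf hfc (ee m) (fun z => gk_line t z m) (by fun_prop) (by fun_prop) x
  have lG := fun m x => cv_line hg hgc (ee m) (fun z => gk_line t z m) (by fun_prop) (by fun_prop) x
  have lF2 := fun m x => cv_line hf hfc (ee m) (fun z => gk1_line t z m m) (by fun_prop) (by fun_prop) x
  have lG2 := fun m x => cv_line hg hgc (ee m) (fun z => gk1_line t z m m) (by fun_prop) (by fun_prop) x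
  have mF : Measurable (cv f (gk t)) := (cv_cont hf hfc (by fun_prop)).measurable
  have mG : Measurable (cv g (gk t)) := (cv_cont hg hgc (by fun_prop)).measurable
  have mF1 : ∀ m, Measurable (cv f (gk1 t m)) := fun m => (cv_cont hf hfc (by fun_prop)).measurable
  have mG1 : ∀ m, Measurable (cv g (gk1 t m)) := fun m => (cv_cont hg hgc (by fun_prop)).measurable
  have mF2 : ∀ m, Measurable (cv f (gk2 t m m)) := fun m => (cv_cont hf hfc (by fun_prop)).measurable
  have mG2 : ∀ m, Measurable (cv g (gk2 t m m)) := fun m => (cv_cont hg hgc (by fun_prop)).measurable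
  generalize cv f (gk t) = F at *
  generalize cv g (gk t) = G at *
  generalize hFF1 : (fun m => cv f (gk1 t m)) = F1 at *
  generalize hGG1 : (fun m => cv g (gk1 t m)) = G1 at *
  generalize hFF2 : (fun m => cv f (gk2 t m m)) = F2 at *
  generalize hGG2 : (fun m => cv g (gk2 t m m)) = G2 at *
  have eF1 : ∀ m, cv f (gk1 t m) = F1 m := fun m => congrFun hFF1 m
  have eG1 : ∀ m, cv g (gk1 t m) = G1 m := fun m => congrFun hGG1 m
  have eF2 : ∀ m, cv f (gk2 t m m) = F2 m := fun m => congrFun hFF2 m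
  have eG2 : ∀ m, cv g (gk2 t m m) = G2 m := fun m => congrFun hGG2 m
  replace hF2 : ∀ m, GB (F2 m) := fun m => eF2 m ▸ hF2 m m
  replace hG2 : ∀ m, GB (G2 m) := fun m => eG2 m ▸ hG2 m m
  simp only [eF1, eG1, eF2, eG2] at *
  clear hFF1 hGG1 hFF2 hGG2 eF1 eG1 eF2 eG2
  obtain ⟨A1, hA1, hFA⟩ := hF0.bounded
  obtain ⟨A2, hA2, hGA⟩ := hG0.bounded
  set A := max A1 A2
  have hB := fun x => bel_bounds hr (hFp x) (hGp x)
    (((le_abs_self _).trans (hFA x)).trans (le_max_left A1 A2))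
    (((le_abs_self _).trans (hGA x)).trans (le_max_right A1 A2))
  have mz : Measurable (fun x => belz r (F x) (G x)) := by unfold belz belP belS; fun_prop
  have me : Measurable (fun x => bele r (F x) (G x)) := by unfold bele belP belS; fun_prop
  have mzz : Measurable (fun x => belzz r (F x) (G x)) := by unfold belzz belP belS; fun_prop
  have mze : Measurable (fun x => belze r (F x) (G x)) := by unfold belze belP belS; fun_prop
  have mee : Measurable (fun x => belee r (F x) (G x)) := by unfold belee belP belS; fun_prop
  -- quadratic form
  set Q : Fin 2 → E2 → ℝ := fun m x => belzz r (F x) (G x) * F1 m x ^ 2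
    + 2 * belze r (F x) (G x) * (F1 m x * G1 m x) + belee r (F x) (G x) * G1 m x ^ 2 with hQ
  set W : Fin 2 → E2 → ℝ := fun m x => belz r (F x) (G x) * F2 m x + bele r (F x) (G x) * G2 m x with hW
  have iQ : ∀ m, Integrable (Q m) := by
    intro m
    apply GB.integrable
    · refine GB.add (GB.add ?_ ?_) ?_
      · simp only [pow_two]
        exact GB.bdd ((hF1 m).mul (hF1 m)) (fun x => (hB x).2.2.1)
      · refine GB.bdd (M := 4) ((hF1 m).mul (hG1 m)) (fun x => ?_)
        have := (bel_hess hr (hFp x) (hGp x)).2.1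
        rw [abs_mul, abs_two]; linarith
      · refine GB.poly (k := G) (M := 19 * A ^ (1 / r) / (2 * t) ^ 2) (R := R) (by positivity) hG0 (fun x => ?_)
        rw [abs_mul, abs_of_pos (hGp x), abs_of_nonneg (sq_nonneg (G1 m x)), ← sq_abs (G1 m x)]
        calc |belee r (F x) (G x)| * |G1 m x| ^ 2
            ≤ |belee r (F x) (G x)| * ((‖x‖ + R) / (2 * t) * G x) ^ 2 := by
              gcongr; exact hGR m x
          _ = (|belee r (F x) (G x)| * G x ^ 2) * ((‖x‖ + R) / (2 * t)) ^ 2 := by ring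
          _ ≤ (19 * A ^ (1 / r) * G x) * ((‖x‖ + R) / (2 * t)) ^ 2 := by
              exact mul_le_mul_of_nonneg_right (hB x).2.2.2 (by positivity)
          _ = _ := by rw [div_pow]; ring
    · have := mF1 m; have := mG1 m
      fun_prop
  have iW : ∀ m, Integrable (W m) := by
    intro m
    apply GB.integrable
    · exact GB.add (GB.bdd (hF2 m) (fun x => (hB x).1)) (GB.bdd (hG2 m) (fun x => (hB x).2.1))
    · have := mF2 m; have := mG2 m
      fun_prop
  have key : ∀ m, ∫ x, (Q m x + W m x) = 0 := by
    intro m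
    refine int_line_zero (V := fun x => belz r (F x) (G x) * F1 m x + bele r (F x) (G x) * G1 m x)
      (v := ee m) (fun x => ?_) ?_ ((iQ m).add (iW m))
    · have hz : HasLineDerivAt ℝ (fun x => belz r (F x) (G x))
          (belzz r (F x) (G x) * F1 m x + belze r (F x) (G x) * G1 m x) x (ee m) := by
        refine line_comp2 (lF m x) (lG m x) ?_
        intro f g f' g' s h1 h2 e1 e2 e3 e4
        have := hasDerivAt_belz hr h1 h2 (by rw [e1]; exact hFp x) (by rw [e2]; exact hGp x)
        rwa [e1, e2, e3, e4] at this
      have he : HasLineDerivAt ℝ (fun x => bele r (F x) (G x))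
          (belze r (F x) (G x) * F1 m x + belee r (F x) (G x) * G1 m x) x (ee m) := by
        refine line_comp2 (lF m x) (lG m x) ?_
        intro f g f' g' s h1 h2 e1 e2 e3 e4
        have := hasDerivAt_bele hr h1 h2 (by rw [e1]; exact hFp x) (by rw [e2]; exact hGp x)
        rwa [e1, e2, e3, e4] at this
      have h3 := lF2 m x
      have h4 := lG2 m x
      unfold HasLineDerivAt at *
      refine ((hz.mul h3).add (he.mul h4)).congr_deriv ?_
      simp only [zero_smul, add_zero, hQ, hW]
      ring
    · apply GB.integrable
      · exact GB.add (GB.bdd (hF1 m) (fun x => (hB x).1)) (GB.bdd (hG1 m) (fun x => (hB x).2.1))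
      · have := mF1 m; have := mG1 m
        fun_prop
  have h1 : ∫ x, |F1 j x| * |G1 i x| ≤ ∫ x, (Q 0 x + Q 1 x) := by
    apply integral_mono
    · exact ((hF1 j).abs.mul (hG1 i).abs).integrable ((mF1 j).abs.mul (mG1 i).abs)
    · exact (iQ 0).add (iQ 1)
    · intro x
      have := bel_quad hr (hFp x) (hGp x) (fun m => F1 m x) (fun m => G1 m x) i j
      rw [Fin.sum_univ_two] at this
      exact this
  refine h1.trans (le_of_eq ?_)
  have h2 : ∀ m, ∫ x, Q m x = - ∫ x, W m x := by
    intro m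
    have := key m
    rw [integral_add (iQ m) (iW m)] at this
    linarith
  rw [integral_add (iQ 0) (iQ 1), h2, h2, ← neg_add, ← integral_add (iW 0) (iW 1)]
  congr 2
  ext x
  simp only [hW]; ring
end


lemma cv_zero (k : E2 → ℝ) {f : E2 → ℝ} (h : ¬ ∃ x, f x ≠ 0) (x : E2) : cv f k x = 0 := by
  push Not at h
  simp [cv, h]

lemma cv_nonneg {f : E2 → ℝ} (h0 : ∀ x, 0 ≤ f x) {t : ℝ} (ht : 0 < t) (x : E2) :
    0 ≤ cv f (gk t) x :=
  integral_nonneg (fun y => mul_nonneg (h0 y) (gk_pos ht _).le)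

lemma cv_rpow_int {f : E2 → ℝ} (hf : Continuous f) (hfc : HasCompactSupport f) (h0 : ∀ x, 0 ≤ f x)
    {t : ℝ} (ht : 0 < t) {r : ℝ} (hr : 0 < r) : Integrable (fun x => cv f (gk t) x ^ (1 + r)) := by
  obtain ⟨hF0, -⟩ := cv_gb hf hfc ht
  have mF : Measurable (cv f (gk t)) := (cv_cont hf hfc (by fun_prop)).measurable
  obtain ⟨A, hA, hb⟩ := hF0.bounded
  refine GB.integrable (GB.of_le (M := A ^ r) (by positivity) hF0 (fun x => ?_)) (by fun_prop)
  have hn := cv_nonneg h0 ht x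
  have hb' := hb x
  rw [abs_of_nonneg hn] at hb'
  rw [abs_of_nonneg (rpow_nonneg hn _), abs_of_nonneg hn, rpow_add_of_nonneg hn zero_le_one hr.le,
    Real.rpow_one, mul_comm]
  gcongr

section
variable {r : ℝ} (hr : 1 ≤ r) {f g : E2 → ℝ} (hf : Continuous f) (hfc : HasCompactSupport f)
  (hg : Continuous g) (hgc : HasCompactSupport g) (hf0 : ∀ x, 0 ≤ f x) (hg0 : ∀ x, 0 ≤ g x)
include hr hf hfc hg hgc hf0 hg0

lemma hb_time (hfn : ∃ x, f x ≠ 0) (hgn : ∃ x, g x ≠ 0) {t : ℝ} (ht : 0 < t) :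
    HasDerivAt (fun t => ∫ x, bel r (cv f (gk t) x) (cv g (gk t) x))
    (∫ x, (belz r (cv f (gk t) x) (cv g (gk t) x) * (cv f (gk2 t 0 0) x + cv f (gk2 t 1 1) x)
      + bele r (cv f (gk t) x) (cv g (gk t) x) * (cv g (gk2 t 0 0) x + cv g (gk2 t 1 1) x))) t ∧
    0 ≤ ∫ x, bel r (cv f (gk t) x) (cv g (gk t) x) ∧
    ∫ x, bel r (cv f (gk t) x) (cv g (gk t) x) ≤
      (9 * r + 2) * ((∫ x, cv f (gk t) x ^ (1 + r)) + ∫ x, cv g (gk t) x ^ (1 + 1 / r)) := by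
  have hr0 : 0 < r := by linarith
  have hm : ∀ s, Measurable (cv f (gk s)) := fun s => (cv_cont hf hfc (by fun_prop)).measurable
  have hm' : ∀ s, Measurable (cv g (gk s)) := fun s => (cv_cont hg hgc (by fun_prop)).measurable
  have mb : ∀ s, Measurable (fun x => bel r (cv f (gk s) x) (cv g (gk s) x)) := by
    intro s; have := hm s; have := hm' s
    unfold bel belP belS; fun_prop
  have i1 := cv_rpow_int hf hfc hf0 ht hr0
  have i2 := cv_rpow_int hg hgc hg0 ht (by positivity : 0 < 1 / r)
  have hbl := fun x => bel_le hr (cv_pos hf hfc hf0 hfn ht x) (cv_pos hg hgc hg0 hgn ht x)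
  have ib : Integrable (fun x => bel r (cv f (gk t) x) (cv g (gk t) x)) := by
    refine ((i1.add i2).const_mul (9 * r + 2)).mono' (mb t).aestronglyMeasurable
      (Filter.Eventually.of_forall fun x => ?_)
    rw [Real.norm_eq_abs, abs_of_nonneg (hbl x).1]
    simpa [add_comm] using (hbl x).2
  refine ⟨?_, integral_nonneg fun x => (hbl x).1, ?_⟩
  · obtain ⟨A1, c1, hA1, hc1, h1⟩ := cv_decay hf hfc (a := t / 2) (b := 2 * t) (by linarith) (by linarith)
    obtain ⟨A2, c2, hA2, hc2, h2⟩ := cv_decay hg hgc (a := t / 2) (b := 2 * t) (by linarith) (by linarith)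
    have hs : Icc (t / 2) (2 * t) ∈ nhds t := Icc_mem_nhds (by linarith) (by linarith)
    have hexp : ∀ c : ℝ, 0 < c → ∀ x : E2, Real.exp (-c * ‖x‖ ^ 2) ≤ 1 := by
      intro c hc x
      apply Real.exp_le_one_iff.2
      have : 0 ≤ c * ‖x‖ ^ 2 := by positivity
      linarith
    set A := max A1 A2
    have hB : ∀ s ∈ Icc (t / 2) (2 * t), ∀ x, _ := fun s hs x => bel_bounds (A := A) hr
      (cv_pos hf hfc hf0 hfn (by linarith [hs.1] : 0 < s) x) (cv_pos hg hgc hg0 hgn (by linarith [hs.1] : 0 < s) x)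
      (((le_abs_self _).trans ((h1 s hs x).1.trans (mul_le_of_le_one_right hA1 (hexp c1 hc1 x)))).trans (le_max_left A1 A2))
      (((le_abs_self _).trans ((h2 s hs x).1.trans (mul_le_of_le_one_right hA2 (hexp c2 hc2 x)))).trans (le_max_right A1 A2))
    have m2 : ∀ m s, Measurable (cv f (gk2 s m m)) := fun m s => (cv_cont hf hfc (by fun_prop)).measurable
    have m2' : ∀ m s, Measurable (cv g (gk2 s m m)) := fun m s => (cv_cont hg hgc (by fun_prop)).measurable
    refine (hasDerivAt_integral_of_dominated_loc_of_deriv_le (F := fun t x => bel r (cv f (gk t) x) (cv g (gk t) x))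
      (F' := fun t x => (belz r (cv f (gk t) x) (cv g (gk t) x) * (cv f (gk2 t 0 0) x + cv f (gk2 t 1 1) x)
      + bele r (cv f (gk t) x) (cv g (gk t) x) * (cv g (gk2 t 0 0) x + cv g (gk2 t 1 1) x)))
      (bound := fun x => ((r + 1) * A * (A ^ r + A) ^ (1 - 1 / r)) * (2 * (A1 * Real.exp (-c1 * ‖x‖ ^ 2)))
        + (A + 9 * (r + 1) * A ^ (1 / r)) * (2 * (A2 * Real.exp (-c2 * ‖x‖ ^ 2)))) hs ?_ ib ?_ ?_ ?_ ?_).2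
    · filter_upwards with s
      exact (mb s).aestronglyMeasurable
    · apply Measurable.aestronglyMeasurable
      have := hm t; have := hm' t
      have := m2 0 t; have := m2 1 t; have := m2' 0 t; have := m2' 1 t
      unfold belz bele belP belS; fun_prop
    · filter_upwards with x s hs
      have hb := hB s hs x
      have a1 := (h1 s hs x).2.2
      have a2 := (h2 s hs x).2.2
      rw [Real.norm_eq_abs]
      refine (abs_add_le _ _).trans ?_
      rw [abs_mul, abs_mul]
      refine add_le_add (mul_le_mul hb.1 ?_ (abs_nonneg _) ((abs_nonneg _).trans hb.1))
        (mul_le_mul hb.2.1 ?_ (abs_nonneg _) ((abs_nonneg _).trans hb.2.1))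
      · have := abs_add_le (cv f (gk2 s 0 0) x) (cv f (gk2 s 1 1) x)
        linarith [a1 0 0, a1 1 1]
      · have := abs_add_le (cv g (gk2 s 0 0) x) (cv g (gk2 s 1 1) x)
        linarith [a2 0 0, a2 1 1]
    · exact ((((gauss_integrable hc1).const_mul A1).const_mul 2).const_mul _).add
        ((((gauss_integrable hc2).const_mul A2).const_mul 2).const_mul _)
    · filter_upwards with x s hs
      have hs0 : 0 < s := by linarith [hs.1]
      exact hasDerivAt_bel hr (cv_time hf hfc hs0 x) (cv_time hg hgc hs0 x)
        (cv_pos hf hfc hf0 hfn hs0 x) (cv_pos hg hgc hg0 hgn hs0 x)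
  · rw [← integral_add i1 i2, ← integral_const_mul]
    apply integral_mono ib ((i1.add i2).const_mul _)
    intro x
    simpa [add_comm] using (hbl x).2

lemma heat_bellman : ∃ I I' : ℝ → ℝ, ∀ t : ℝ, 0 < t → HasDerivAt I (I' t) t ∧ 0 ≤ I t ∧
    I t ≤ (9 * r + 2) * ((∫ x, cv f (gk t) x ^ (1 + r)) + ∫ x, cv g (gk t) x ^ (1 + 1 / r)) ∧
    ∀ i j, ∫ x, |cv f (gk1 t j) x| * |cv g (gk1 t i) x| ≤ -I' t := by
  have hr0 : 0 < r := by linarith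
  by_cases hfn : ∃ x, f x ≠ 0
  · by_cases hgn : ∃ x, g x ≠ 0
    · refine ⟨fun t => ∫ x, bel r (cv f (gk t) x) (cv g (gk t) x), _, fun t ht =>
        ⟨(hb_time hr hf hfc hg hgc hf0 hg0 hfn hgn ht).1, (hb_time hr hf hfc hg hgc hf0 hg0 hfn hgn ht).2.1,
        (hb_time hr hf hfc hg hgc hf0 hg0 hfn hgn ht).2.2, 
        fun i j => hb_ibp hr hf hfc hg hgc hf0 hg0 hfn hgn ht i j⟩⟩
    · refine ⟨fun _ => 0, fun _ => 0, fun t ht => ⟨hasDerivAt_const _ _, le_rfl, ?_, fun i j => ?_⟩⟩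
      · have h1 : 0 ≤ ∫ x, cv f (gk t) x ^ (1 + r) :=
          integral_nonneg fun x => rpow_nonneg (cv_nonneg hf0 ht x) _
        have h2 : 0 ≤ ∫ x, cv g (gk t) x ^ (1 + 1 / r) :=
          integral_nonneg fun x => rpow_nonneg (cv_nonneg hg0 ht x) _
        positivity
      · simp [cv_zero _ hgn]
  · refine ⟨fun _ => 0, fun _ => 0, fun t ht => ⟨hasDerivAt_const _ _, le_rfl, ?_, fun i j => ?_⟩⟩
    · have h1 : 0 ≤ ∫ x, cv f (gk t) x ^ (1 + r) :=
        integral_nonneg fun x => rpow_nonneg (cv_nonneg hf0 ht x) _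
      have h2 : 0 ≤ ∫ x, cv g (gk t) x ^ (1 + 1 / r) :=
        integral_nonneg fun x => rpow_nonneg (cv_nonneg hg0 ht x) _
      positivity
    · simp [cv_zero _ hfn]
end


lemma heat_pq {p q : ℝ} (hpq : p.HolderConjugate q) : ∃ C : ℝ, 0 ≤ C ∧ ∀ f g : E2 → ℝ,
    Continuous f → HasCompactSupport f → Continuous g → HasCompactSupport g →
    (∀ x, 0 ≤ f x) → (∀ x, 0 ≤ g x) →
    ∃ I I' : ℝ → ℝ, ∀ t : ℝ, 0 < t → HasDerivAt I (I' t) t ∧ 0 ≤ I t ∧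
    I t ≤ C * ((∫ x, cv f (gk t) x ^ p) + ∫ x, cv g (gk t) x ^ q) ∧
    ∀ i j, ∫ x, |cv f (gk1 t j) x| * |cv g (gk1 t i) x| ≤ -I' t := by
  have hp := hpq.lt
  have hq := hpq.symm.lt
  have e := hpq.sub_one_mul_conj
  rcases le_total 2 p with h | h
  · refine ⟨9 * (p - 1) + 2, by linarith, fun f g hf hfc hg hgc hf0 hg0 => ?_⟩
    have := heat_bellman (r := p - 1) (by linarith) hf hfc hg hgc hf0 hg0
    have e1 : 1 + (p - 1) = p := by ring
    have e2 : 1 + 1 / (p - 1) = q := by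
      have : p - 1 ≠ 0 := by linarith
      field_simp; linarith
    rwa [e1, e2] at this
  · have h2 : 2 ≤ q := by nlinarith
    refine ⟨9 * (q - 1) + 2, by linarith, fun f g hf hfc hg hgc hf0 hg0 => ?_⟩
    have := heat_bellman (r := q - 1) (by linarith) hg hgc hf hfc hg0 hf0
    have e1 : 1 + (q - 1) = q := by ring
    have e2 : 1 + 1 / (q - 1) = p := by
      have : q - 1 ≠ 0 := by linarith
      have := hpq.symm.sub_one_mul_conj
      field_simp; linarith
    rw [e1, e2] at this
    obtain ⟨I, I', hI⟩ := this
    refine ⟨I, I', fun t ht => ?_⟩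
    obtain ⟨h1, h2, h3, h4⟩ := hI t ht
    refine ⟨h1, h2, h3.trans (le_of_eq (by ring)), fun i j => ?_⟩
    have := h4 j i
    simpa only [mul_comm] using this

lemma cv_int {f k : E2 → ℝ} (hf : Continuous f) (hc : HasCompactSupport f) (hk : Continuous k) (x : E2) :
    Integrable (fun y => f y * k (x - y)) :=
  (by fun_prop : Continuous fun y => f y * k (x - y)).integrable_of_hasCompactSupport hc.mul_right

def psp (f : E2 → ℝ) (x : E2) : ℝ := max (f x) 0
def psm (f : E2 → ℝ) (x : E2) : ℝ := max (-f x) 0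

lemma psp_facts {f : E2 → ℝ} (hf : Continuous f) (hc : HasCompactSupport f) :
    Continuous (psp f) ∧ HasCompactSupport (psp f) ∧ (∀ x, 0 ≤ psp f x) ∧ (∀ x, psp f x ≤ |f x|) := by
  refine ⟨by unfold psp; fun_prop, ?_, fun x => le_max_right _ _, fun x => ?_⟩
  · exact hc.comp_left (g := fun s : ℝ => max s 0) (by simp)
  · exact max_le (le_abs_self _) (abs_nonneg _)

lemma psm_facts {f : E2 → ℝ} (hf : Continuous f) (hc : HasCompactSupport f) :
    Continuous (psm f) ∧ HasCompactSupport (psm f) ∧ (∀ x, 0 ≤ psm f x) ∧ (∀ x, psm f x ≤ |f x|) := by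
  refine ⟨by unfold psm; fun_prop, ?_, fun x => le_max_right _ _, fun x => ?_⟩
  · exact hc.comp_left (g := fun s : ℝ => max (-s) 0) (by simp)
  · exact max_le (neg_le_abs _) (abs_nonneg _)

lemma cv_split {f k : E2 → ℝ} (hf : Continuous f) (hc : HasCompactSupport f) (hk : Continuous k) (x : E2) :
    cv f k x = cv (psp f) k x - cv (psm f) k x := by
  obtain ⟨h1, h2, -⟩ := psp_facts hf hc
  obtain ⟨h3, h4, -⟩ := psm_facts hf hc
  unfold cv
  rw [← integral_sub (cv_int h1 h2 hk x) (cv_int h3 h4 hk x)]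
  congr 1; ext y
  rw [← sub_mul]
  congr 1
  unfold psp psm
  rcases le_total 0 (f y) with h | h
  · rw [max_eq_left h, max_eq_right (by linarith)]; ring
  · rw [max_eq_right h, max_eq_left (by linarith)]; ring

lemma cv_rpow_mono {f g : E2 → ℝ} (hf : Continuous f) (hfc : HasCompactSupport f)
    (hg : Continuous g) (hgc : HasCompactSupport g)
    (hf0 : ∀ x, 0 ≤ f x) (h : ∀ x, f x ≤ g x) {p : ℝ} (hp : 1 < p) {t : ℝ} (ht : 0 < t) :
    ∫ x, cv f (gk t) x ^ p ≤ ∫ x, cv g (gk t) x ^ p := by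
  have e : p = 1 + (p - 1) := by ring
  have hg0 : ∀ x, 0 ≤ g x := fun x => (hf0 x).trans (h x)
  refine integral_mono ?_ ?_ (fun x => ?_)
  · rw [e]; exact cv_rpow_int hf hfc hf0 ht (by linarith)
  · rw [e]; exact cv_rpow_int hg hgc hg0 ht (by linarith)
  · refine rpow_le_rpow (cv_nonneg hf0 ht x) ?_ (by linarith)
    refine integral_mono (cv_int hf hfc (by fun_prop) x) (cv_int hg hgc (by fun_prop) x) (fun y => ?_)
    exact mul_le_mul_of_nonneg_right (h y) (gk_pos ht _).le

lemma heat_pm {p q : ℝ} (hpq : p.HolderConjugate q) : ∃ C : ℝ, 0 ≤ C ∧ ∀ f g : E2 → ℝ,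
    Continuous f → HasCompactSupport f → Continuous g → HasCompactSupport g →
    ∃ I I' : ℝ → ℝ, ∀ t : ℝ, 0 < t → HasDerivAt I (I' t) t ∧ 0 ≤ I t ∧
    I t ≤ C * ((∫ x, cv (fun y => |f y|) (gk t) x ^ p) + ∫ x, cv (fun y => |g y|) (gk t) x ^ q) ∧
    ∀ i j, ∫ x, |cv f (gk1 t j) x| * |cv g (gk1 t i) x| ≤ -I' t := by
  obtain ⟨C, hC, H⟩ := heat_pq hpq
  have hp := hpq.lt
  have hq := hpq.symm.lt
  refine ⟨4 * C, by positivity, fun f g hf hfc hg hgc => ?_⟩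
  obtain ⟨f1, f2, f3, f4⟩ := psp_facts hf hfc
  obtain ⟨f1', f2', f3', f4'⟩ := psm_facts hf hfc
  obtain ⟨g1, g2, g3, g4⟩ := psp_facts hg hgc
  obtain ⟨g1', g2', g3', g4'⟩ := psm_facts hg hgc
  obtain ⟨I1, J1, h1⟩ := H _ _ f1 f2 g1 g2 f3 g3
  obtain ⟨I2, J2, h2⟩ := H _ _ f1 f2 g1' g2' f3 g3'
  obtain ⟨I3, J3, h3⟩ := H _ _ f1' f2' g1 g2 f3' g3
  obtain ⟨I4, J4, h4⟩ := H _ _ f1' f2' g1' g2' f3' g3'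
  refine ⟨fun t => I1 t + I2 t + I3 t + I4 t, fun t => J1 t + J2 t + J3 t + J4 t, fun t ht => ?_⟩
  obtain ⟨a1, b1, c1, d1⟩ := h1 t ht
  obtain ⟨a2, b2, c2, d2⟩ := h2 t ht
  obtain ⟨a3, b3, c3, d3⟩ := h3 t ht
  obtain ⟨a4, b4, c4, d4⟩ := h4 t ht
  refine ⟨((a1.add a2).add a3).add a4, by positivity, ?_, fun i j => ?_⟩
  · have m1 := cv_rpow_mono f1 f2 hf.abs hfc.abs f3 f4 hp ht
    have m2 := cv_rpow_mono f1' f2' hf.abs hfc.abs f3' f4' hp ht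
    have m3 := cv_rpow_mono g1 g2 hg.abs hgc.abs g3 g4 hq ht
    have m4 := cv_rpow_mono g1' g2' hg.abs hgc.abs g3' g4' hq ht
    nlinarith [mul_le_mul_of_nonneg_left m1 hC, mul_le_mul_of_nonneg_left m2 hC,
      mul_le_mul_of_nonneg_left m3 hC, mul_le_mul_of_nonneg_left m4 hC]
  · have ii : ∀ {a b : E2 → ℝ}, Continuous a → HasCompactSupport a → Continuous b → HasCompactSupport b →
        Integrable (fun x => |cv a (gk1 t j) x| * |cv b (gk1 t i) x|) := by
      intro a b ha hac hb hbc
      exact (((cv_gb ha hac ht).2.1 j).abs.mul ((cv_gb hb hbc ht).2.1 i).abs).integrable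
        (((cv_cont ha hac (by fun_prop)).abs.mul (cv_cont hb hbc (by fun_prop)).abs).measurable)
    have i1 := ii f1 f2 g1 g2
    have i2 := ii f1 f2 g1' g2'
    have i3 := ii f1' f2' g1 g2
    have i4 := ii f1' f2' g1' g2'
    have := integral_mono (ii hf hfc hg hgc) (((i1.add i2).add i3).add i4) (fun x => ?_)
    · rw [integral_add' ((i1.add i2).add i3) i4, integral_add' (i1.add i2) i3,
        integral_add' i1 i2] at this
      have := d1 i j; have := d2 i j; have := d3 i j; have := d4 i j
      linarith
    · simp only [Pi.add_apply]
      rw [cv_split hf hfc (by fun_prop) x, cv_split hg hgc (by fun_prop) x]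
      have e1 := abs_sub (cv (psp f) (gk1 t j) x) (cv (psm f) (gk1 t j) x)
      have e2 := abs_sub (cv (psp g) (gk1 t i) x) (cv (psm g) (gk1 t i) x)
      refine (mul_le_mul e1 e2 (abs_nonneg _) (by positivity)).trans (le_of_eq (by ring))


lemma gk2_symm (t : ℝ) (i j : Fin 2) : gk2 t i j = gk2 t j i := by
  ext z; unfold gk2; simp only [mul_comm (z i), eq_comm (a := i)]

lemma pd_cd {v : E2 → ℝ} {n m : WithTop ℕ∞} (hv : ContDiff ℝ n v) (h : m + 1 ≤ n) (i : Fin 2) :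
    ContDiff ℝ m (pd v i) :=
  (hv.fderiv_right h).clm_apply contDiff_const

lemma pd_supp {v : E2 → ℝ} (hv : HasCompactSupport v) (i : Fin 2) : HasCompactSupport (pd v i) :=
  hv.fderiv_apply (𝕜 := ℝ) _

lemma pd_line {v : E2 → ℝ} (hv : ContDiff ℝ 1 v) (i : Fin 2) (x : E2) :
    HasLineDerivAt ℝ v (pd v i x) x (ee i) :=
  ((hv.differentiable one_ne_zero) x).hasFDerivAt.hasLineDerivAt _

lemma pd_comm {v : E2 → ℝ} (hv : ContDiff ℝ 2 v) (i j : Fin 2) : pd (pd v i) j = pd (pd v j) i := by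
  ext x
  have hs : IsSymmSndFDerivAt ℝ v x := hv.contDiffAt.isSymmSndFDerivAt (by simp)
  have hd : DifferentiableAt ℝ (fderiv ℝ v) x :=
    ((hv.fderiv_right (m := 1) (by norm_num)).differentiable one_ne_zero) x
  have key : ∀ a b : Fin 2, pd (pd v a) b x = fderiv ℝ (fderiv ℝ v) x (ee b) (ee a) := by
    intro a b
    show fderiv ℝ (fun y => fderiv ℝ v y (ee a)) x (ee b) = _
    rw [fderiv_clm_apply hd (by fun_prop)]
    simp
  rw [key, key, hs.eq]

lemma cv_ibp {v k k' : E2 → ℝ} (hv : ContDiff ℝ 1 v) (hc : HasCompactSupport v) (m : Fin 2)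
    (hk : ∀ z, HasLineDerivAt ℝ k (k' z) z (ee m)) (kc : Continuous k) (kc' : Continuous k') (x : E2) :
    cv (pd v m) k x = cv v k' x := by
  have i1 := cv_int (pd_cd (m := 0) hv (by simp) m).continuous (pd_supp hc m) kc x
  have i2 := cv_int hv.continuous hc kc' x
  have := int_line_zero (V := fun y => v y * k (x - y))
    (V' := fun y => pd v m y * k (x - y) - v y * k' (x - y)) (v := ee m) (fun y => ?_)
    (cv_int hv.continuous hc kc x) (i1.sub i2)
  · rw [integral_sub i1 i2] at this
    unfold cv; linarith
  · have h1 := pd_line hv m y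
    have h2 := hk (x - y)
    unfold HasLineDerivAt at *
    have h3 : HasDerivAt (fun s : ℝ => k (x - (y + s • ee m))) (-k' (x - y)) 0 := by
      have h4 : HasDerivAt (fun s : ℝ => -s) (-1) 0 := hasDerivAt_neg 0
      have h5 : HasDerivAt (fun s : ℝ => k (x - y + s • ee m)) (k' (x - y)) (-0) := by simpa using h2
      have h6 := HasDerivAt.comp (h := fun s : ℝ => -s) (0 : ℝ) h5 h4
      have e : (fun s : ℝ => k (x - (y + s • ee m))) = (fun s => k (x - y + s • ee m)) ∘ fun s => -s := by
        funext s; simp only [Function.comp]; congr 1; module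
      rw [e]; simpa using h6
    refine (h1.mul h3).congr_deriv ?_
    simp only [zero_smul, add_zero]; ring

lemma cv_swap {v : E2 → ℝ} (hv : ContDiff ℝ 2 v) (hc : HasCompactSupport v) (t : ℝ) (i j m : Fin 2) (x : E2) :
    cv (pd v i) (gk2 t j m) x = cv (pd v m) (gk2 t j i) x := by
  rw [← cv_ibp (pd_cd hv (by norm_num) i) (pd_supp hc i) m (fun z => gk1_line t z j m) (by fun_prop) (by fun_prop),
    ← cv_ibp (pd_cd hv (by norm_num) m) (pd_supp hc m) i (fun z => gk1_line t z j i) (by fun_prop) (by fun_prop),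
    pd_comm hv]

lemma cv_add {f g k : E2 → ℝ} (hf : Continuous f) (hfc : HasCompactSupport f) (hg : Continuous g)
    (hgc : HasCompactSupport g) (hk : Continuous k) (x : E2) :
    cv (fun y => f y + g y) k x = cv f k x + cv g k x := by
  unfold cv
  rw [← integral_add (cv_int hf hfc hk x) (cv_int hg hgc hk x)]
  congr 1; ext y; ring

lemma cv_sub {f g k : E2 → ℝ} (hf : Continuous f) (hfc : HasCompactSupport f) (hg : Continuous g)
    (hgc : HasCompactSupport g) (hk : Continuous k) (x : E2) :
    cv (fun y => f y - g y) k x = cv f k x - cv g k x := by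
  unfold cv
  rw [← integral_sub (cv_int hf hfc hk x) (cv_int hg hgc hk x)]
  congr 1; ext y; ring

def dv (v : Fin 2 → E2 → ℝ) (x : E2) : ℝ := pd (v 0) 0 x + pd (v 1) 1 x
def vo (v : Fin 2 → E2 → ℝ) (x : E2) : ℝ := pd (v 1) 0 x - pd (v 0) 1 x

section
variable {v : Fin 2 → E2 → ℝ} (hv : ∀ b, ContDiff ℝ 2 (v b)) (hc : ∀ b, HasCompactSupport (v b))
include hv

lemma pdv_cont (a b : Fin 2) : Continuous (pd (v b) a) :=
  (pd_cd (m := 1) (hv b) (by norm_num) a).continuous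
lemma dv_cont : Continuous (dv v) := (pdv_cont hv 0 0).add (pdv_cont hv 1 1)
lemma vo_cont : Continuous (vo v) := (pdv_cont hv 0 1).sub (pdv_cont hv 1 0)

omit hv in
include hc in
lemma dv_supp : HasCompactSupport (dv v) := (pd_supp (hc 0) 0).add (pd_supp (hc 1) 1)
omit hv in
include hc in
lemma vo_supp : HasCompactSupport (vo v) := (pd_supp (hc 1) 0).sub (pd_supp (hc 0) 1)

include hc
lemma lap_id (a b : Fin 2) : ∃ (s : ℝ) (j j' : Fin 2), |s| ≤ 1 ∧ ∀ t x,
    cv (pd (v b) a) (gk2 t 0 0) x + cv (pd (v b) a) (gk2 t 1 1) x =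
      cv (dv v) (gk2 t j a) x + s * cv (vo v) (gk2 t j' a) x := by
  have hd : ∀ (k : E2 → ℝ), Continuous k → ∀ x, cv (dv v) k x = cv (pd (v 0) 0) k x + cv (pd (v 1) 1) k x :=
    fun k hk x => cv_add (pdv_cont hv _ _) (pd_supp (hc _) _) (pdv_cont hv _ _) (pd_supp (hc _) _) hk x
  have hw : ∀ (k : E2 → ℝ), Continuous k → ∀ x, cv (vo v) k x = cv (pd (v 1) 0) k x - cv (pd (v 0) 1) k x :=
    fun k hk x => cv_sub (pdv_cont hv _ _) (pd_supp (hc _) _) (pdv_cont hv _ _) (pd_supp (hc _) _) hk x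
  have hs : ∀ t x, cv (pd (v b) a) (gk2 t 0 0) x + cv (pd (v b) a) (gk2 t 1 1) x =
      cv (pd (v b) 0) (gk2 t 0 a) x + cv (pd (v b) 1) (gk2 t 1 a) x := fun t x => by
    rw [cv_swap (hv b) (hc b) t a 0 0, cv_swap (hv b) (hc b) t a 1 1]
  by_cases hb : b = 0
  · refine ⟨-1, 0, 1, by simp, fun t x => ?_⟩
    rw [hs, hd _ (by fun_prop), hw _ (by fun_prop), hb]
    have := cv_swap (hv 1) (hc 1) t 1 a 0 x
    rw [gk2_symm t a 0, gk2_symm t a 1] at this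
    linarith
  · have hb : b = 1 := by omega
    refine ⟨1, 1, 0, by simp, fun t x => ?_⟩
    rw [hs, hd _ (by fun_prop), hw _ (by fun_prop), hb]
    have := cv_swap (hv 0) (hc 0) t 1 a 0 x
    rw [gk2_symm t a 0, gk2_symm t a 1] at this
    linarith
end

lemma gb_ibp {A A' B B' : E2 → ℝ} {e : E2} (hA : ∀ x, HasLineDerivAt ℝ A (A' x) x e)
    (hB : ∀ x, HasLineDerivAt ℝ B (B' x) x e) (gA : GB A) (gA' : GB A') (gB : GB B) (gB' : GB B')
    (cA : Continuous A) (cA' : Continuous A') (cB : Continuous B) (cB' : Continuous B') :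
    ∫ x, A' x * B x = - ∫ x, A x * B' x := by
  have i1 := (gA'.mul gB).integrable (cA'.mul cB).measurable
  have i2 := (gA.mul gB').integrable (cA.mul cB').measurable
  have := int_line_zero (V := fun y => A y * B y) (V' := fun y => A' y * B y + A y * B' y) (v := e)
    (fun x => ?_) ((gA.mul gB).integrable (cA.mul cB).measurable) (i1.add i2)
  · rw [integral_add i1 i2] at this; linarith
  · have h1 := hA x; have h2 := hB x
    unfold HasLineDerivAt at *
    refine (h1.mul h2).congr_deriv ?_
    simp

lemma J_deriv {h g : E2 → ℝ} (hh : Continuous h) (hhc : HasCompactSupport h) (hg : Continuous g)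
    (hgc : HasCompactSupport g) {t : ℝ} (ht : 0 < t) :
    HasDerivAt (fun t => ∫ x, cv h (gk t) x * cv g (gk t) x)
      (2 * ∫ x, (cv h (gk2 t 0 0) x + cv h (gk2 t 1 1) x) * cv g (gk t) x) t := by
  have ch : ∀ {k : E2 → ℝ}, Continuous k → Continuous (cv h k) := fun hk => cv_cont hh hhc hk
  have cg : ∀ {k : E2 → ℝ}, Continuous k → Continuous (cv g k) := fun hk => cv_cont hg hgc hk
  obtain ⟨A1, c1, hA1, hc1, h1⟩ := cv_decay hh hhc (a := t / 2) (b := 2 * t) (by linarith) (by linarith)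
  obtain ⟨A2, c2, hA2, hc2, h2⟩ := cv_decay hg hgc (a := t / 2) (b := 2 * t) (by linarith) (by linarith)
  have hs : Icc (t / 2) (2 * t) ∈ nhds t := Icc_mem_nhds (by linarith) (by linarith)
  have hexp : ∀ x : E2, Real.exp (-c2 * ‖x‖ ^ 2) ≤ 1 := by
    intro x
    apply Real.exp_le_one_iff.2
    have : 0 ≤ c2 * ‖x‖ ^ 2 := by positivity
    linarith
  have gh := cv_gb hh hhc ht
  have gg := cv_gb hg hgc ht
  have ck := fun m => (by fun_prop : Continuous (gk2 t m m))
  have D := (hasDerivAt_integral_of_dominated_loc_of_deriv_le (μ := (volume : Measure E2))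
    (F := fun t x => cv h (gk t) x * cv g (gk t) x)
    (F' := fun t x => (cv h (gk2 t 0 0) x + cv h (gk2 t 1 1) x) * cv g (gk t) x
      + cv h (gk t) x * (cv g (gk2 t 0 0) x + cv g (gk2 t 1 1) x))
    (bound := fun x => 4 * A2 * (A1 * Real.exp (-c1 * ‖x‖ ^ 2))) hs ?_ ?_ ?_ ?_ ?_ ?_).2
  · refine D.congr_deriv ?_
    have i : ∀ m, Integrable (fun x => cv h (gk2 t m m) x * cv g (gk t) x) := fun m =>
      ((gh.2.2 m m).mul gg.1).integrable ((ch (ck m)).mul (cg (by fun_prop))).measurable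
    have i' : ∀ m, Integrable (fun x => cv h (gk t) x * cv g (gk2 t m m) x) := fun m =>
      (gh.1.mul (gg.2.2 m m)).integrable ((ch (by fun_prop)).mul (cg (ck m))).measurable
    have e : ∀ m, ∫ x, cv h (gk t) x * cv g (gk2 t m m) x = ∫ x, cv h (gk2 t m m) x * cv g (gk t) x := by
      intro m
      have e1 := gb_ibp (cv_line hh hhc (ee m) (fun z => gk1_line t z m m) (by fun_prop) (by fun_prop))
        (cv_line hg hgc (ee m) (fun z => gk_line t z m) (by fun_prop) (by fun_prop))
        (gh.2.1 m) (gh.2.2 m m) gg.1 (gg.2.1 m) (ch (by fun_prop)) (ch (by fun_prop)) (cg (by fun_prop)) (cg (by fun_prop))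
      have e2 := gb_ibp (cv_line hh hhc (ee m) (fun z => gk_line t z m) (by fun_prop) (by fun_prop))
        (cv_line hg hgc (ee m) (fun z => gk1_line t z m m) (by fun_prop) (by fun_prop))
        gh.1 (gh.2.1 m) (gg.2.1 m) (gg.2.2 m m) (ch (by fun_prop)) (ch (by fun_prop)) (cg (by fun_prop)) (cg (by fun_prop))
      linarith
    simp only [add_mul, mul_add]
    refine (integral_add ((i 0).add (i 1)) ((i' 0).add (i' 1))).trans ?_
    simp only [Pi.add_apply]
    rw [integral_add (i 0) (i 1),
      integral_add (i' 0) (i' 1), e, e]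
    ring
  · filter_upwards with s
    exact ((ch (by fun_prop)).mul (cg (by fun_prop))).aestronglyMeasurable
  · exact (gh.1.mul gg.1).integrable ((ch (by fun_prop)).mul (cg (by fun_prop))).measurable
  · exact ((((ch (ck 0)).add (ch (ck 1))).mul (cg (by fun_prop))).add
      ((ch (by fun_prop)).mul ((cg (ck 0)).add (cg (ck 1))))).aestronglyMeasurable
  · filter_upwards with x s hs
    have a := h1 s hs x
    have b := h2 s hs x
    set E1 := A1 * Real.exp (-c1 * ‖x‖ ^ 2)
    have hE1 : 0 ≤ E1 := by positivity
    have hb : A2 * Real.exp (-c2 * ‖x‖ ^ 2) ≤ A2 := mul_le_of_le_one_right hA2 (hexp x)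
    rw [Real.norm_eq_abs]
    refine (abs_add_le _ _).trans ?_
    rw [abs_mul, abs_mul]
    have t1 : |cv h (gk2 s 0 0) x + cv h (gk2 s 1 1) x| * |cv g (gk s) x| ≤ (2 * E1) * A2 := by
      refine mul_le_mul ?_ (b.1.trans hb) (abs_nonneg _) (by positivity)
      linarith [abs_add_le (cv h (gk2 s 0 0) x) (cv h (gk2 s 1 1) x), a.2.2 0 0, a.2.2 1 1]
    have t2 : |cv h (gk s) x| * |cv g (gk2 s 0 0) x + cv g (gk2 s 1 1) x| ≤ E1 * (2 * A2) := by
      refine mul_le_mul a.1 ?_ (abs_nonneg _) hE1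
      linarith [abs_add_le (cv g (gk2 s 0 0) x) (cv g (gk2 s 1 1) x), b.2.2 0 0, b.2.2 1 1]
    linarith
  · exact ((gauss_integrable hc1).const_mul _).const_mul _
  · filter_upwards with x s hs
    have hs0 : 0 < s := by linarith [hs.1]
    exact (cv_time hh hhc hs0 x).mul (cv_time hg hgc hs0 x)

lemma J_bound {p q : ℝ} (hpq : p.HolderConjugate q) : ∃ C : ℝ, 0 ≤ C ∧ ∀ (v : Fin 2 → E2 → ℝ),
    (∀ b, ContDiff ℝ 2 (v b)) → (∀ b, HasCompactSupport (v b)) → ∀ g : E2 → ℝ, Continuous g →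
    HasCompactSupport g → ∀ a b, ∀ ε T : ℝ, 0 < ε → ε ≤ T →
    ∫ x, cv (pd (v b) a) (gk ε) x * cv g (gk ε) x ≤
      C * ((∫ x, cv (fun y => |dv v y|) (gk ε) x ^ p) + (∫ x, cv (fun y => |vo v y|) (gk ε) x ^ p)
        + ∫ x, cv (fun y => |g y|) (gk ε) x ^ q)
      + ∫ x, cv (pd (v b) a) (gk T) x * cv g (gk T) x := by
  obtain ⟨C, hC, H⟩ := heat_pm hpq
  refine ⟨4 * C, by positivity, fun v hv hc g hg hgc a b ε T hε hT => ?_⟩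
  obtain ⟨I1, J1, h1⟩ := H _ _ (dv_cont hv) (dv_supp hc) hg hgc
  obtain ⟨I2, J2, h2⟩ := H _ _ (vo_cont hv) (vo_supp hc) hg hgc
  obtain ⟨s, j, j', hs, hid⟩ := lap_id hv hc a b
  set h := pd (v b) a with hh
  have hhct : Continuous h := pdv_cont hv a b
  have hhc : HasCompactSupport h := pd_supp (hc b) a
  set J : ℝ → ℝ := fun t => ∫ x, cv h (gk t) x * cv g (gk t) x with hJ
  have hder : ∀ t, 0 < t → ∃ D, HasDerivAt (fun t => 2 * (I1 t + I2 t) - J t) D t ∧ D ≤ 0 := by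
    intro t ht
    obtain ⟨a1, -, -, d1⟩ := h1 t ht
    obtain ⟨a2, -, -, d2⟩ := h2 t ht
    refine ⟨_, ((a1.add a2).const_mul 2).sub (J_deriv hhct hhc hg hgc ht), ?_⟩
    have gg := cv_gb hg hgc ht
    have cg : ∀ {k : E2 → ℝ}, Continuous k → Continuous (cv g k) := fun hk => cv_cont hg hgc hk
    have key : ∀ {f : E2 → ℝ}, Continuous f → HasCompactSupport f → ∀ j,
        Integrable (fun x => cv f (gk2 t j a) x * cv g (gk t) x) ∧
        |∫ x, cv f (gk2 t j a) x * cv g (gk t) x| ≤ ∫ x, |cv f (gk1 t j) x| * |cv g (gk1 t a) x| := by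
      intro f hf hfc j
      have gf := cv_gb hf hfc ht
      have cf : ∀ {k : E2 → ℝ}, Continuous k → Continuous (cv f k) := fun hk => cv_cont hf hfc hk
      refine ⟨((gf.2.2 j a).mul gg.1).integrable ((cf (by fun_prop)).mul (cg (by fun_prop))).measurable, ?_⟩
      rw [gb_ibp (cv_line hf hfc (ee a) (fun z => gk1_line t z j a) (by fun_prop) (by fun_prop))
        (cv_line hg hgc (ee a) (fun z => gk_line t z a) (by fun_prop) (by fun_prop))
        (gf.2.1 j) (gf.2.2 j a) gg.1 (gg.2.1 a) (cf (by fun_prop)) (cf (by fun_prop)) (cg (by fun_prop)) (cg (by fun_prop)),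
        abs_neg]
      refine abs_integral_le_integral_abs.trans (le_of_eq ?_)
      simp only [abs_mul]
    obtain ⟨k1, k2⟩ := key (dv_cont hv) (dv_supp hc) j
    obtain ⟨k3, k4⟩ := key (vo_cont hv) (vo_supp hc) j'
    have e : ∫ x, (cv h (gk2 t 0 0) x + cv h (gk2 t 1 1) x) * cv g (gk t) x =
        (∫ x, cv (dv v) (gk2 t j a) x * cv g (gk t) x) + s * ∫ x, cv (vo v) (gk2 t j' a) x * cv g (gk t) x := by
      rw [← integral_const_mul, ← integral_add k1 (k3.const_mul s)]
      congr 1; ext x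
      rw [hid]; ring
    rw [e]
    have n1 := k2.trans (d1 a j)
    have n2 := k4.trans (d2 a j')
    have n3 : -(s * ∫ x, cv (vo v) (gk2 t j' a) x * cv g (gk t) x) ≤ - J2 t := by
      refine (neg_le_abs _).trans ?_
      rw [abs_mul]
      exact (mul_le_of_le_one_left (abs_nonneg _) hs).trans n2
    have n4 := (neg_le_abs _).trans n1
    linarith
  have anti : AntitoneOn (fun t => 2 * (I1 t + I2 t) - J t) (Icc ε T) := by
    have hd : ∀ t ∈ Icc ε T, 0 < t := fun t ht => hε.trans_le ht.1
    apply antitoneOn_of_deriv_nonpos (convex_Icc _ _)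
    · intro t ht
      obtain ⟨D, hD, -⟩ := hder t (hd t ht)
      exact hD.continuousAt.continuousWithinAt
    · intro t ht
      obtain ⟨D, hD, -⟩ := hder t (hd t (interior_subset ht))
      exact hD.differentiableAt.differentiableWithinAt
    · intro t ht
      obtain ⟨D, hD, hD'⟩ := hder t (hd t (interior_subset ht))
      rwa [hD.deriv]
  have hm := anti ⟨le_rfl, hT⟩ ⟨hT, le_rfl⟩ hT
  simp only at hm
  obtain ⟨-, -, c1, -⟩ := h1 ε hε
  obtain ⟨-, -, c2, -⟩ := h2 ε hε
  obtain ⟨-, b1, -, -⟩ := h1 T (hε.trans_le hT)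
  obtain ⟨-, b2, -, -⟩ := h2 T (hε.trans_le hT)
  have p1 : 0 ≤ ∫ x, cv (fun y => |dv v y|) (gk ε) x ^ p :=
    integral_nonneg fun x => rpow_nonneg (cv_nonneg (fun _ => abs_nonneg _) hε x) _
  have p2 : 0 ≤ ∫ x, cv (fun y => |vo v y|) (gk ε) x ^ p :=
    integral_nonneg fun x => rpow_nonneg (cv_nonneg (fun _ => abs_nonneg _) hε x) _
  show J ε ≤ _ + J T
  nlinarith [mul_nonneg hC p1, mul_nonneg hC p2]


lemma gauss_int {b : ℝ} (hb : 0 < b) : ∫ x : E2, Real.exp (-b * ‖x‖ ^ 2) = π / b := by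
  rw [GaussianFourier.integral_rexp_neg_mul_sq_norm hb]
  simp

lemma gk_int {t : ℝ} (ht : 0 < t) : Integrable (gk t) ∧ ∫ x : E2, gk t x = 1 := by
  have e : gk t = fun z => (4 * π * t)⁻¹ * Real.exp (-(1 / (4 * t)) * ‖z‖ ^ 2) := by
    ext z; unfold gk; congr 2; ring
  rw [e]
  refine ⟨(gauss_integrable (by positivity)).const_mul _, ?_⟩
  rw [integral_const_mul, gauss_int (by positivity)]
  have := pi_pos
  field_simp

lemma cv_tendsto {f : E2 → ℝ} (hf : Continuous f) (hc : HasCompactSupport f) (x : E2) :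
    Filter.Tendsto (fun c : ℝ => cv f (gk (c ^ 2)⁻¹) x) Filter.atTop (nhds (f x)) := by
  have h := tendsto_integral_comp_smul_smul_of_integrable' (μ := (volume : Measure E2))
    (φ := gk 1) (fun z => (gk_pos one_pos z).le) (gk_int one_pos).2 ?_
    (hf.integrable_of_hasCompactSupport hc) (x₀ := x) hf.continuousAt
  · refine h.congr' ?_
    filter_upwards [Filter.eventually_gt_atTop 0] with c hc
    unfold cv
    congr 1; ext y
    simp only [smul_eq_mul, finrank_euclideanSpace, Fintype.card_fin]
    rw [mul_comm]
    congr 1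
    unfold gk
    rw [norm_smul, Real.norm_eq_abs, abs_of_pos hc, ← mul_assoc]
    congr 1
    · field_simp
    · congr 1; field_simp
  · -- decay
    have e : (fun z : E2 => ‖z‖ ^ Module.finrank ℝ E2 * gk 1 z)
        = fun z => (4 * π)⁻¹ * (‖z‖ ^ 2 * Real.exp (-(‖z‖ ^ 2) / 4)) := by
      ext z; unfold gk; simp; ring
    rw [e]
    have h0 : Filter.Tendsto (fun s : ℝ => s * Real.exp (-s)) Filter.atTop (nhds 0) := by
      simpa using Real.tendsto_pow_mul_exp_neg_atTop_nhds_zero 1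
    have h1 : Filter.Tendsto (fun z : E2 => ‖z‖ ^ 2 / 4) (Filter.cocompact E2) Filter.atTop := by
      have := (Filter.tendsto_pow_atTop (α := ℝ) two_ne_zero).comp (tendsto_norm_cocompact_atTop (E := E2))
      exact this.atTop_div_const (by norm_num)
    have h2 := ((h0.comp h1).const_mul 4).const_mul (4 * π)⁻¹
    simp only [mul_zero] at h2
    rw [← Metric.cobounded_eq_cocompact] at h2
    refine h2.congr (fun z => ?_)
    simp only [Function.comp]
    rw [neg_div]; ring

/-- uniform domination for small times -/
lemma cv_dom {f : E2 → ℝ} (hf : Continuous f) (hc : HasCompactSupport f) :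
    ∃ A : ℝ, 0 ≤ A ∧ ∀ t : ℝ, 0 < t → t ≤ 1 → ∀ x, |cv f (gk t) x| ≤ A * (1 + ‖x‖) ^ (-4 : ℝ) := by
  obtain ⟨R, hR1, hR⟩ := exists_supp_ball hc
  obtain ⟨M, hM⟩ := hf.bounded_above_of_compact_support hc
  have hM0 : 0 ≤ M := (norm_nonneg _).trans (hM 0)
  have hi : Integrable (fun y => |f y|) := hf.abs.integrable_of_hasCompactSupport hc.abs
  have hi0 : 0 ≤ ∫ y, |f y| := integral_nonneg (fun _ => abs_nonneg _)
  set N := ∫ y, |f y|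
  refine ⟨M * (1 + 2 * R) ^ 4 + N * 128 * 16, by positivity, fun t ht ht1 x => ?_⟩
  have e4 : (1 + ‖x‖) ^ (-4 : ℝ) = ((1 + ‖x‖) ^ 4)⁻¹ := by
    rw [rpow_neg (by positivity)]; norm_cast
  rw [e4, ← div_eq_mul_inv, le_div_iff₀ (by positivity)]
  rcases le_or_gt ‖x‖ (2 * R) with hx | hx
  · have h1 : |cv f (gk t) x| ≤ M := by
      have hg : Integrable (fun y => gk t (x - y)) := (gk_int ht).1.comp_sub_left x
      have : |cv f (gk t) x| ≤ ∫ y, M * gk t (x - y) := by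
        refine norm_integral_le_of_norm_le (f := fun y => f y * gk t (x - y)) (hg.const_mul M)
          (Filter.Eventually.of_forall fun y => ?_)
        rw [norm_mul, Real.norm_of_nonneg (gk_pos ht _).le]
        exact mul_le_mul_of_nonneg_right (hM y) (gk_pos ht _).le
      rw [integral_const_mul, integral_sub_left_eq_self (gk t) volume x, (gk_int ht).2, mul_one] at this
      exact this
    calc |cv f (gk t) x| * (1 + ‖x‖) ^ 4 ≤ M * (1 + 2 * R) ^ 4 := by gcongr
      _ ≤ _ := by
        have : 0 ≤ N * 128 * 16 := by positivity
        linarith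
  · have hx0 : 0 < ‖x‖ := by linarith
    have h1 : |cv f (gk t) x| ≤ N * (128 / ‖x‖ ^ 4) := by
      have : |cv f (gk t) x| ≤ ∫ y, |f y| * (128 / ‖x‖ ^ 4) := by
        refine norm_integral_le_of_norm_le (f := fun y => f y * gk t (x - y)) (hi.mul_const _)
          (Filter.Eventually.of_forall fun y => ?_)
        rw [norm_mul, Real.norm_of_nonneg (gk_pos ht _).le, Real.norm_eq_abs]
        by_cases hy : R < ‖y‖
        · simp [hR y hy]
        · push Not at hy
          gcongr
          have h2 : ‖x‖ / 2 ≤ ‖x - y‖ := by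
            have := norm_sub_norm_le x y
            linarith
          have h3 : ‖x‖ ^ 2 / 4 ≤ ‖x - y‖ ^ 2 := by nlinarith
          set s := ‖x - y‖ ^ 2 / (4 * t) with hs
          have hs1 : ‖x‖ ^ 2 / (16 * t) ≤ s := by
            rw [hs, div_le_div_iff₀ (by positivity) (by positivity)]; nlinarith
          have hs0 : 0 < ‖x‖ ^ 2 / (16 * t) := by positivity
          have hq : s ^ 2 / 2 ≤ Real.exp s := by
            linarith [Real.quadratic_le_exp_of_nonneg (hs0.le.trans hs1)]
          have he : Real.exp (-s) ≤ 2 / s ^ 2 := by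
            rw [Real.exp_neg, inv_le_comm₀ (Real.exp_pos _) (by have := hs0.trans_le hs1; positivity), inv_div]
            exact hq
          have he2 : 2 / s ^ 2 ≤ 2 / (‖x‖ ^ 2 / (16 * t)) ^ 2 := by gcongr
          have : gk t (x - y) ≤ (4 * π * t)⁻¹ * (2 / (‖x‖ ^ 2 / (16 * t)) ^ 2) := by
            unfold gk
            rw [neg_div]
            gcongr
            exact he.trans he2
          refine this.trans ?_
          have e : (4 * π * t)⁻¹ * (2 / (‖x‖ ^ 2 / (16 * t)) ^ 2) = (t / π) * (128 / ‖x‖ ^ 4) := by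
            have := pi_pos
            field_simp; norm_num
          rw [e]
          have : t / π ≤ 1 := by
            rw [div_le_one pi_pos]; linarith [pi_gt_three]
          exact mul_le_of_le_one_left (by positivity) this
      rw [integral_mul_const] at this
      exact this
    calc |cv f (gk t) x| * (1 + ‖x‖) ^ 4 ≤ N * (128 / ‖x‖ ^ 4) * (2 * ‖x‖) ^ 4 := by
          gcongr; linarith
      _ = N * 128 * 16 := by field_simp; norm_num
      _ ≤ _ := by
        have : 0 ≤ M * (1 + 2 * R) ^ 4 := by positivity
        linarith

lemma bracket_int {s : ℝ} (hs : 2 < s) : Integrable (fun x : E2 => (1 + ‖x‖) ^ (-s)) :=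
  integrable_one_add_norm (by simpa using hs)

lemma ev_small : ∀ᶠ c : ℝ in Filter.atTop, 0 < (c ^ 2)⁻¹ ∧ (c ^ 2)⁻¹ ≤ 1 := by
  filter_upwards [Filter.eventually_ge_atTop 1] with c hc
  exact ⟨by positivity, inv_le_one_of_one_le₀ (by nlinarith)⟩

lemma lim_rpow {f : E2 → ℝ} (hf : Continuous f) (hc : HasCompactSupport f) {p : ℝ} (hp : 1 < p) :
    Filter.Tendsto (fun c : ℝ => ∫ x, cv (fun y => |f y|) (gk (c ^ 2)⁻¹) x ^ p) Filter.atTop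
      (nhds (∫ x, |f x| ^ p)) := by
  obtain ⟨A, hA, h⟩ := cv_dom hf.abs hc.abs
  refine tendsto_integral_filter_of_dominated_convergence (fun x => A ^ p * (1 + ‖x‖) ^ (-(4 * p))) ?_ ?_ ?_ ?_
  · filter_upwards with c
    have := (cv_cont hf.abs hc.abs (k := gk (c ^ 2)⁻¹) (by fun_prop)).measurable
    exact (this.pow_const p).aestronglyMeasurable
  · filter_upwards [ev_small] with c hc'
    filter_upwards with x
    have hn : 0 ≤ cv (fun y => |f y|) (gk (c ^ 2)⁻¹) x := cv_nonneg (fun _ => abs_nonneg _) hc'.1 x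
    have h1 := h _ hc'.1 hc'.2 x
    rw [abs_of_nonneg hn] at h1
    rw [Real.norm_of_nonneg (rpow_nonneg hn _)]
    calc _ ≤ (A * (1 + ‖x‖) ^ (-4 : ℝ)) ^ p := rpow_le_rpow hn h1 (by linarith)
      _ = _ := by
        rw [mul_rpow hA (by positivity), ← rpow_mul (by positivity)]
        congr 2; ring
  · exact (bracket_int (by linarith)).const_mul _
  · filter_upwards with x
    exact (cv_tendsto hf.abs hc.abs x).rpow_const (Or.inr (by linarith))

lemma lim_mul {f g : E2 → ℝ} (hf : Continuous f) (hc : HasCompactSupport f) (hg : Continuous g)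
    (hgc : HasCompactSupport g) :
    Filter.Tendsto (fun c : ℝ => ∫ x, cv f (gk (c ^ 2)⁻¹) x * cv g (gk (c ^ 2)⁻¹) x) Filter.atTop
      (nhds (∫ x, f x * g x)) := by
  obtain ⟨A, hA, h⟩ := cv_dom hf hc
  obtain ⟨B, hB, h'⟩ := cv_dom hg hgc
  refine tendsto_integral_filter_of_dominated_convergence
    (fun x => (A * B) * (1 + ‖x‖) ^ (-8 : ℝ)) ?_ ?_ ?_ ?_
  · filter_upwards with c
    exact ((cv_cont hf hc (by fun_prop)).mul (cv_cont hg hgc (by fun_prop))).aestronglyMeasurable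
  · filter_upwards [ev_small] with c hc'
    filter_upwards with x
    rw [norm_mul]
    calc _ ≤ (A * (1 + ‖x‖) ^ (-4 : ℝ)) * (B * (1 + ‖x‖) ^ (-4 : ℝ)) :=
          mul_le_mul (h _ hc'.1 hc'.2 x) (h' _ hc'.1 hc'.2 x) (abs_nonneg _) (by positivity)
      _ = (A * B) * ((1 + ‖x‖) ^ (-4 : ℝ) * (1 + ‖x‖) ^ (-4 : ℝ)) := by ring
      _ = _ := by
        rw [← Real.rpow_add (by positivity)]; norm_num
  · exact (bracket_int (by norm_num)).const_mul _
  · filter_upwards with x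
    exact (cv_tendsto hf hc x).mul (cv_tendsto hg hgc x)

lemma cv_large {f : E2 → ℝ} (hf : Continuous f) (hc : HasCompactSupport f) :
    ∃ N : ℝ, 0 ≤ N ∧ ∀ T : ℝ, 1 ≤ T → ∀ x, |cv f (gk T) x| ≤ N / T * Real.exp (-(1 / (8 * T)) * ‖x‖ ^ 2) := by
  obtain ⟨R, hR1, hR⟩ := exists_supp_ball hc
  have hi : Integrable (fun y => |f y|) := hf.abs.integrable_of_hasCompactSupport hc.abs
  have hi0 : 0 ≤ ∫ y, |f y| := integral_nonneg (fun _ => abs_nonneg _)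
  refine ⟨(∫ y, |f y|) * Real.exp (R ^ 2), by positivity, fun T hT x => ?_⟩
  have hT0 : 0 < T := by linarith
  have : |cv f (gk T) x| ≤ ∫ y, |f y| * (1 / T * Real.exp (R ^ 2) * Real.exp (-(1 / (8 * T)) * ‖x‖ ^ 2)) := by
    refine norm_integral_le_of_norm_le (f := fun y => f y * gk T (x - y)) (hi.mul_const _)
      (Filter.Eventually.of_forall fun y => ?_)
    rw [norm_mul, Real.norm_of_nonneg (gk_pos hT0 _).le, Real.norm_eq_abs]
    by_cases hy : R < ‖y‖
    · simp [hR y hy]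
    · push Not at hy
      gcongr
      unfold gk
      rw [mul_assoc (1 / T), ← Real.exp_add]
      have hpi := pi_gt_three
      have a1 : (4 * π * T)⁻¹ ≤ 1 / T := by
        rw [one_div]; gcongr; nlinarith
      refine mul_le_mul a1 (Real.exp_le_exp.2 ?_) (Real.exp_pos _).le (by positivity)
      have h1 : ‖x‖ ≤ ‖x - y‖ + ‖y‖ := by simpa using norm_add_le (x - y) y
      have h2 : ‖x‖ ^ 2 ≤ 2 * ‖x - y‖ ^ 2 + 2 * R ^ 2 := by
        nlinarith [norm_nonneg x, norm_nonneg (x - y), norm_nonneg y, sq_nonneg (‖x - y‖ - R)]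
      have e : R ^ 2 + -(1 / (8 * T)) * ‖x‖ ^ 2 = (8 * T * R ^ 2 - ‖x‖ ^ 2) / (8 * T) := by
        field_simp; ring
      rw [e, div_le_div_iff₀ (by positivity) (by positivity)]
      nlinarith [mul_le_mul_of_nonneg_right hT (sq_nonneg R)]
  rw [integral_mul_const] at this
  refine this.trans (le_of_eq (by ring))

lemma lim_large {f g : E2 → ℝ} (hf : Continuous f) (hc : HasCompactSupport f) (hg : Continuous g)
    (hgc : HasCompactSupport g) :
    Filter.Tendsto (fun T : ℝ => ∫ x, cv f (gk T) x * cv g (gk T) x) Filter.atTop (nhds 0) := by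
  obtain ⟨A, hA, h⟩ := cv_large hf hc
  obtain ⟨B, hB, h'⟩ := cv_large hg hgc
  refine squeeze_zero_norm' (a := fun T => (A * B * (8 * π)) / T) ?_
    (Filter.Tendsto.const_div_atTop Filter.tendsto_id _)
  filter_upwards [Filter.eventually_ge_atTop 1] with T hT
  have hT0 : 0 < T := by linarith
  refine (norm_integral_le_of_norm_le (g := fun x => A / T * (B / T) * Real.exp (-(1 / (8 * T)) * ‖x‖ ^ 2))
    ((gauss_integrable (by positivity)).const_mul _)
    (Filter.Eventually.of_forall fun x => ?_)).trans (le_of_eq ?_)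
  · rw [norm_mul]
    have he : Real.exp (-(1 / (8 * T)) * ‖x‖ ^ 2) ≤ 1 := by
      apply Real.exp_le_one_iff.2
      have : 0 ≤ (1 / (8 * T)) * ‖x‖ ^ 2 := by positivity
      linarith
    calc _ ≤ (A / T * 1) * (B / T * Real.exp (-(1 / (8 * T)) * ‖x‖ ^ 2)) :=
          mul_le_mul ((h T hT x).trans (by gcongr)) (h' T hT x) (abs_nonneg _) (by positivity)
      _ = _ := by ring
  · rw [integral_const_mul, gauss_int (by positivity)]
    field_simp

lemma dual_bound {p q : ℝ} (hpq : p.HolderConjugate q) : ∃ C : ℝ, 0 ≤ C ∧ ∀ (v : Fin 2 → E2 → ℝ),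
    (∀ b, ContDiff ℝ 2 (v b)) → (∀ b, HasCompactSupport (v b)) → ∀ g : E2 → ℝ, Continuous g →
    HasCompactSupport g → ∀ a b,
    ∫ x, pd (v b) a x * g x ≤
      C * ((∫ x, |dv v x| ^ p) + (∫ x, |vo v x| ^ p) + ∫ x, |g x| ^ q) := by
  obtain ⟨C, hC, H⟩ := J_bound hpq
  refine ⟨C, hC, fun v hv hc g hg hgc a b => ?_⟩
  have hh := pdv_cont hv a b
  have hhc := pd_supp (hc b) a
  have h1 : ∀ᶠ c : ℝ in Filter.atTop, ∫ x, cv (pd (v b) a) (gk (c ^ 2)⁻¹) x * cv g (gk (c ^ 2)⁻¹) x ≤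
      C * ((∫ x, cv (fun y => |dv v y|) (gk (c ^ 2)⁻¹) x ^ p) + (∫ x, cv (fun y => |vo v y|) (gk (c ^ 2)⁻¹) x ^ p)
        + ∫ x, cv (fun y => |g y|) (gk (c ^ 2)⁻¹) x ^ q) := by
    filter_upwards [ev_small] with c hc'
    have := (lim_large hh hhc hg hgc).const_add (C * ((∫ x, cv (fun y => |dv v y|) (gk (c ^ 2)⁻¹) x ^ p) + (∫ x, cv (fun y => |vo v y|) (gk (c ^ 2)⁻¹) x ^ p)
        + ∫ x, cv (fun y => |g y|) (gk (c ^ 2)⁻¹) x ^ q))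
    rw [add_zero] at this
    refine ge_of_tendsto this ?_
    filter_upwards [Filter.eventually_ge_atTop 1] with T hT
    exact H v hv hc g hg hgc a b _ T hc'.1 (hc'.2.trans hT)
  refine le_of_tendsto_of_tendsto (lim_mul hh hhc hg hgc)
    ((((lim_rpow (dv_cont hv) (dv_supp hc) hpq.lt).add (lim_rpow (vo_cont hv) (vo_supp hc) hpq.lt)).add
      (lim_rpow hg hgc hpq.symm.lt)).const_mul C) h1

/-- unweighted estimate -/
lemma unweighted {p : ℝ} (hp : 1 < p) : ∃ C : ℝ, 0 ≤ C ∧ ∀ (v : Fin 2 → E2 → ℝ),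
    (∀ b, ContDiff ℝ 2 (v b)) → (∀ b, HasCompactSupport (v b)) → ∀ a b,
    ∫ x, |pd (v b) a x| ^ p ≤ C * ((∫ x, |dv v x| ^ p) + ∫ x, |vo v x| ^ p) := by
  obtain ⟨q, hpq⟩ : ∃ q, p.HolderConjugate q := ⟨_, Real.HolderConjugate.conjExponent hp⟩
  obtain ⟨C, hC, H⟩ := dual_bound hpq
  have hq := hpq.symm.lt
  set l : ℝ := (2 * C + 1) ^ (-(p - 1)) with hl
  have hl0 : 0 < l := by positivity
  have hlq : l ^ q = l * (2 * C + 1)⁻¹ := by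
    have e : q = 1 + (q - 1) := by ring
    rw [e, Real.rpow_add hl0, Real.rpow_one]
    congr 1
    rw [hl, ← Real.rpow_mul (by positivity), ← Real.rpow_neg_one]
    congr 1
    have := hpq.sub_one_mul_conj
    nlinarith
  refine ⟨2 * C / l, by positivity, fun v hv hc a b => ?_⟩
  have hh := pdv_cont hv a b
  have hhc := pd_supp (hc b) a
  set h := pd (v b) a
  set g : E2 → ℝ := fun x => l * (psp h x ^ (p - 1) - psm h x ^ (p - 1)) with hg
  obtain ⟨f1, f2, f3, f4⟩ := psp_facts hh hhc
  obtain ⟨f1', f2', f3', f4'⟩ := psm_facts hh hhc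
  have hp1 : 0 < p - 1 := by linarith
  have gcont : Continuous g := by
    have a1 := f1.rpow_const (p := p - 1) (fun _ => Or.inr hp1.le)
    have a2 := f1'.rpow_const (p := p - 1) (fun _ => Or.inr hp1.le)
    exact continuous_const.mul (a1.sub a2)
  have gsupp : HasCompactSupport g := by
    refine hhc.mono ?_
    intro x hx
    contrapose! hx
    simp only [Function.mem_support, ne_eq, not_not] at hx ⊢
    simp [hg, psp, psm, hx]
  have e1 : ∀ x, h x * g x = l * |h x| ^ p := by
    intro x
    have key : ∀ s : ℝ, 0 ≤ s → s * s ^ (p - 1) = s ^ p := by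
      intro s hs
      have := rpow_add_of_nonneg hs zero_le_one hp1.le
      rw [Real.rpow_one] at this
      rw [← this]; congr 1; ring
    simp only [hg, psp, psm]
    rcases le_total 0 (h x) with h0 | h0
    · rw [max_eq_left h0, max_eq_right (by linarith : -h x ≤ 0), zero_rpow hp1.ne', abs_of_nonneg h0,
        ← key _ h0]; ring
    · rw [max_eq_right h0, max_eq_left (by linarith : 0 ≤ -h x), zero_rpow hp1.ne', abs_of_nonpos h0,
        ← key _ (by linarith : 0 ≤ -h x)]; ring
  have e2 : ∀ x, |g x| ^ q = l ^ q * |h x| ^ p := by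
    intro x
    have e3 : |g x| = l * |h x| ^ (p - 1) := by
      simp only [hg, psp, psm]
      rw [abs_mul, abs_of_pos hl0]
      rcases le_total 0 (h x) with h0 | h0
      · rw [max_eq_left h0, max_eq_right (by linarith : -h x ≤ 0), zero_rpow hp1.ne', abs_of_nonneg h0,
          sub_zero, abs_of_nonneg (by positivity)]
      · rw [max_eq_right h0, max_eq_left (by linarith : 0 ≤ -h x), zero_rpow hp1.ne', abs_of_nonpos h0,
          zero_sub, abs_neg, abs_of_nonneg (rpow_nonneg (by linarith) _)]
    rw [e3, mul_rpow hl0.le (by positivity), ← rpow_mul (abs_nonneg _), hpq.sub_one_mul_conj]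
  have := H v hv hc g gcont gsupp a b
  simp only [show pd (v b) a = h from rfl, e1, e2, integral_const_mul] at this
  rw [hlq] at this
  set X := ∫ x, |h x| ^ p
  have hX : 0 ≤ X := integral_nonneg fun x => by positivity
  have hD : 0 ≤ (∫ x, |dv v x| ^ p) + ∫ x, |vo v x| ^ p :=
    add_nonneg (integral_nonneg fun x => by positivity) (integral_nonneg fun x => by positivity)
  set D := (∫ x, |dv v x| ^ p) + ∫ x, |vo v x| ^ p
  have hC2 : C * (2 * C + 1)⁻¹ ≤ 1 / 2 := by
    rw [← div_eq_mul_inv, div_le_div_iff₀ (by positivity) (by norm_num)]; linarith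
  have h5 : C * (l * (2 * C + 1)⁻¹ * X) ≤ 1 / 2 * (l * X) := by
    have := mul_le_mul_of_nonneg_right hC2 (by positivity : 0 ≤ l * X)
    linarith
  have h6 : l * X ≤ 2 * C * D := by linarith
  rw [div_mul_eq_mul_div, le_div_iff₀ hl0]
  linarith


def PP (r θ : ℝ) : E2 := Complex.orthonormalBasisOneI.repr (Complex.polarCoord.symm (r, θ))

lemma PP0 (r θ : ℝ) : PP r θ 0 = r * Real.cos θ := by
  simp [PP, Complex.polarCoord_symm_apply]
  left; exact Complex.cos_ofReal_re θ

lemma PP1 (r θ : ℝ) : PP r θ 1 = r * Real.sin θ := by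
  simp [PP, Complex.polarCoord_symm_apply]
  left; exact Complex.sin_ofReal_re θ

lemma PP_eq (r θ : ℝ) : PP r θ = !₂[r * Real.cos θ, r * Real.sin θ] := by
  ext i; fin_cases i
  · simpa using PP0 r θ
  · simpa using PP1 r θ

lemma PP_norm (r θ : ℝ) : ‖PP r θ‖ = |r| := by
  simp only [PP, LinearIsometryEquiv.norm_map, Complex.norm_polarCoord_symm]

lemma polar_E2 (f : E2 → ℝ) :
    ∫ x, f x = ∫ q in Ioi (0 : ℝ) ×ˢ Ioo (-π) π, q.1 * f (PP q.1 q.2) := by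
  rw [← (LinearIsometryEquiv.measurePreserving Complex.orthonormalBasisOneI.repr).integral_comp
    (Complex.orthonormalBasisOneI.repr.toHomeomorph.measurableEmbedding),
    ← Complex.integral_comp_polarCoord_symm]
  rfl

attribute [irreducible] PP

lemma PP_cont : Continuous fun q : ℝ × ℝ => PP q.1 q.2 := by
  simp only [PP_eq]
  refine (PiLp.continuous_toLp 2 _).comp ?_
  refine continuous_pi fun i => ?_
  fin_cases i <;> simp <;> fun_prop

lemma PP_dr {f : E2 → ℝ} (hf : ContDiff ℝ 1 f) (r θ : ℝ) :
    HasDerivAt (fun r => f (PP r θ)) (Real.cos θ * pd f 0 (PP r θ) + Real.sin θ * pd f 1 (PP r θ)) r := by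
  have h1 : HasDerivAt (fun r => PP r θ) (Real.cos θ • EuclideanSpace.single 0 (1:ℝ) + Real.sin θ • EuclideanSpace.single 1 (1:ℝ) : E2) r := by
    have e : (fun r => PP r θ) = fun r => r • (Real.cos θ • EuclideanSpace.single 0 (1:ℝ) + Real.sin θ • EuclideanSpace.single 1 (1:ℝ) : E2) := by
      ext r i; rw [PP_eq]; fin_cases i <;> simp
    rw [e]
    refine ((hasDerivAt_id r).smul_const _).congr_deriv ?_
    simp
  have h2 := ((hf.differentiable one_ne_zero) (PP r θ)).hasFDerivAt.comp_hasDerivAt r h1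
  refine h2.congr_deriv ?_
  simp [pd]

lemma PP_dt {f : E2 → ℝ} (hf : ContDiff ℝ 1 f) (r θ : ℝ) :
    HasDerivAt (fun θ => f (PP r θ)) (r * (-Real.sin θ * pd f 0 (PP r θ) + Real.cos θ * pd f 1 (PP r θ))) θ := by
  have h1 : HasDerivAt (fun θ => PP r θ) (r • (-Real.sin θ • EuclideanSpace.single 0 (1:ℝ) + Real.cos θ • EuclideanSpace.single 1 (1:ℝ)) : E2) θ := by
    have e : (fun θ => PP r θ) = fun θ => r • (Real.cos θ • EuclideanSpace.single 0 (1:ℝ) + Real.sin θ • EuclideanSpace.single 1 (1:ℝ) : E2) := by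
      ext θ i; rw [PP_eq]; fin_cases i <;> simp
    rw [e]
    exact (((Real.hasDerivAt_cos θ).smul_const _).add ((Real.hasDerivAt_sin θ).smul_const _)).const_smul r
  have h2 := ((hf.differentiable one_ne_zero) (PP r θ)).hasFDerivAt.comp_hasDerivAt θ h1
  refine h2.congr_deriv ?_
  simp [pd]
  ring

lemma polar_io {g : ℝ × ℝ → ℝ} (hg : Continuous g) {R : ℝ} (hR : ∀ r θ, R < r → g (r, θ) = 0) :
    IntegrableOn g (Ioi (0 : ℝ) ×ˢ Ioo (-π) π) := by
  have h1 : IntegrableOn g (Icc 0 R ×ˢ Icc (-π) π) :=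
    hg.continuousOn.integrableOn_compact (isCompact_Icc.prod isCompact_Icc)
  refine h1.of_forall_sdiff_eq_zero (measurableSet_Ioi.prod measurableSet_Ioo) ?_
  rintro ⟨r, θ⟩ ⟨h, h'⟩
  apply hR
  simp only [mem_prod, mem_Ioi, mem_Ioo, mem_Icc, not_and, not_le] at h h'
  by_contra! hh
  have := h' ⟨h.1.le, hh⟩ h.2.1.le
  linarith [h.2.2]

set_option maxHeartbeats 1000000 in
lemma cauchy0 {f g : E2 → ℝ} (hf : ContDiff ℝ 1 f) (hfc : HasCompactSupport f)
    (hg : ContDiff ℝ 1 g) (hgc : HasCompactSupport g) :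
    ∫ z, (z 0 * pd f 0 z + z 1 * pd f 1 z + (z 0 * pd g 1 z - z 1 * pd g 0 z)) / ‖z‖ ^ 2
      = - (2 * π * f 0) := by
  have pf : ∀ i, Continuous (pd f i) := fun i => (pd_cd (m := 0) hf (by norm_num) i).continuous
  have pg : ∀ i, Continuous (pd g i) := fun i => (pd_cd (m := 0) hg (by norm_num) i).continuous
  obtain ⟨R1, h11, h1⟩ := exists_supp_ball (pd_supp hfc 0)
  obtain ⟨R2, h21, h2⟩ := exists_supp_ball (pd_supp hfc 1)
  obtain ⟨R3, h31, h3⟩ := exists_supp_ball (pd_supp hgc 0)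
  obtain ⟨R4, h41, h4⟩ := exists_supp_ball (pd_supp hgc 1)
  obtain ⟨R5, h51, h5⟩ := exists_supp_ball hfc
  have i1 : IntegrableOn (fun q : ℝ × ℝ => Real.cos q.2 * pd f 0 (PP q.1 q.2) + Real.sin q.2 * pd f 1 (PP q.1 q.2))
      (Ioi (0 : ℝ) ×ˢ Ioo (-π) π) := by
    refine polar_io (R := max R1 R2) ?_ ?_
    · have := (pf 0).comp PP_cont
      have := (pf 1).comp PP_cont
      simp only [Function.comp_def] at *
      fun_prop
    · intro r θ h
      have hr : r ≤ ‖PP r θ‖ := by rw [PP_norm]; exact le_abs_self r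
      simp [h1 _ (((le_max_left _ _).trans_lt h).trans_le hr), h2 _ (((le_max_right _ _).trans_lt h).trans_le hr)]
  have i2 : IntegrableOn (fun q : ℝ × ℝ => -Real.sin q.2 * pd g 0 (PP q.1 q.2) + Real.cos q.2 * pd g 1 (PP q.1 q.2))
      (Ioi (0 : ℝ) ×ˢ Ioo (-π) π) := by
    refine polar_io (R := max R3 R4) ?_ ?_
    · have := (pg 0).comp PP_cont
      have := (pg 1).comp PP_cont
      simp only [Function.comp_def] at *
      fun_prop
    · intro r θ h
      have hr : r ≤ ‖PP r θ‖ := by rw [PP_norm]; exact le_abs_self r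
      simp [h3 _ (((le_max_left _ _).trans_lt h).trans_le hr), h4 _ (((le_max_right _ _).trans_lt h).trans_le hr)]
  rw [polar_E2]
  have e : ∀ q ∈ Ioi (0 : ℝ) ×ˢ Ioo (-π) π, q.1 * ((PP q.1 q.2 0 * pd f 0 (PP q.1 q.2) + PP q.1 q.2 1 * pd f 1 (PP q.1 q.2) +
        (PP q.1 q.2 0 * pd g 1 (PP q.1 q.2) - PP q.1 q.2 1 * pd g 0 (PP q.1 q.2))) / ‖PP q.1 q.2‖ ^ 2)
      = (Real.cos q.2 * pd f 0 (PP q.1 q.2) + Real.sin q.2 * pd f 1 (PP q.1 q.2)) +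
        (-Real.sin q.2 * pd g 0 (PP q.1 q.2) + Real.cos q.2 * pd g 1 (PP q.1 q.2)) := by
    rintro ⟨r, θ⟩ ⟨hr, -⟩
    simp only [mem_Ioi] at hr
    rw [PP_norm, PP0, PP1, sq_abs]
    simp only
    field_simp
    ring
  rw [setIntegral_congr_fun (measurableSet_Ioi.prod measurableSet_Ioo) e]
  refine (integral_add i1 i2).trans ?_
  have a1 : ∫ q in Ioi (0 : ℝ) ×ˢ Ioo (-π) π, (Real.cos q.2 * pd f 0 (PP q.1 q.2) + Real.sin q.2 * pd f 1 (PP q.1 q.2)) = -(2 * π * f 0) := by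
    rw [Measure.volume_eq_prod] at i1 ⊢
    rw [← setIntegral_prod_swap]
    refine (setIntegral_prod _ i1.swap).trans ?_
    simp only [Function.comp]
    have : ∀ θ : ℝ, ∫ r in Ioi (0 : ℝ), (Real.cos θ * pd f 0 (PP r θ) + Real.sin θ * pd f 1 (PP r θ)) = - f 0 := by
      intro θ
      have c : Continuous (fun r => Real.cos θ * pd f 0 (PP r θ) + Real.sin θ * pd f 1 (PP r θ)) := by
        have k : Continuous fun r => PP r θ := PP_cont.comp (continuous_id.prodMk continuous_const)
        have := (pf 0).comp k
        have := (pf 1).comp k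
        simp only [Function.comp_def] at *
        fun_prop
      have io : IntegrableOn (fun r => Real.cos θ * pd f 0 (PP r θ) + Real.sin θ * pd f 1 (PP r θ)) (Ioi 0) := by
        have : IntegrableOn (fun r => Real.cos θ * pd f 0 (PP r θ) + Real.sin θ * pd f 1 (PP r θ)) (Icc 0 (max R1 R2)) :=
          c.continuousOn.integrableOn_compact isCompact_Icc
        refine this.of_forall_sdiff_eq_zero measurableSet_Ioi ?_
        rintro r ⟨h, h'⟩
        have h : max R1 R2 < r := by
          by_contra! hh
          exact h' ⟨le_of_lt h, hh⟩
        have hr : r ≤ ‖PP r θ‖ := by rw [PP_norm]; exact le_abs_self r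
        simp [h1 _ (((le_max_left _ _).trans_lt h).trans_le hr), h2 _ (((le_max_right _ _).trans_lt h).trans_le hr)]
      rw [integral_Ioi_of_hasDerivAt_of_tendsto' (f := fun r => f (PP r θ)) (m := 0) (fun r _ => PP_dr hf r θ) io]
      · simp only [zero_sub]; congr 2
        rw [← norm_eq_zero, PP_norm]; simp
      · refine tendsto_const_nhds.congr' ?_
        filter_upwards [Filter.eventually_gt_atTop R5] with r hr
        exact (h5 _ (by rw [PP_norm]; exact hr.trans_le (le_abs_self r))).symm
    simp only [Prod.swap_prod_mk, Prod.snd, Prod.fst, this]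
    simp
    left
    rw [max_eq_left (by linarith [pi_pos])]; ring
  have a2 : ∫ q in Ioi (0 : ℝ) ×ˢ Ioo (-π) π, (-Real.sin q.2 * pd g 0 (PP q.1 q.2) + Real.cos q.2 * pd g 1 (PP q.1 q.2)) = 0 := by
    rw [Measure.volume_eq_prod] at i2 ⊢
    rw [setIntegral_prod _ i2]
    refine setIntegral_eq_zero_of_forall_eq_zero fun r hr => ?_
    simp only [mem_Ioi] at hr
    have c : Continuous (fun θ => r * (-Real.sin θ * pd g 0 (PP r θ) + Real.cos θ * pd g 1 (PP r θ))) := by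
      have k : Continuous fun θ => PP r θ := PP_cont.comp (continuous_const.prodMk continuous_id)
      have := (pg 0).comp k
      have := (pg 1).comp k
      simp only [Function.comp_def] at *
      fun_prop
    have key := intervalIntegral.integral_eq_sub_of_hasDerivAt (a := -π) (b := π) (fun θ _ => PP_dt hg r θ) (c.intervalIntegrable _ _)
    have e : PP r π = PP r (-π) := by rw [PP_eq, PP_eq]; simp
    rw [e, sub_self, intervalIntegral.integral_of_le (by linarith [pi_pos]), integral_Ioc_eq_integral_Ioo, integral_const_mul] at key
    exact (mul_eq_zero.1 key).resolve_left hr.ne'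
  rw [a1, a2, add_zero]


lemma rad_in {a : ℝ} (ha : -2 < a) : ∃ C : ℝ, 0 ≤ C ∧ ∀ R : ℝ, 0 < R →
    IntegrableOn (fun z : E2 => ‖z‖ ^ a) (Metric.ball 0 R) ∧
    ∫⁻ z in Metric.ball (0 : E2) R, ENNReal.ofReal (‖z‖ ^ a) ≤ ENNReal.ofReal (C * R ^ (a + 2)) := by
  refine ⟨2 * (volume : Measure E2).real (Metric.ball 0 1) / (a + 2), by have : 0 < a + 2 := by linarith
                                                                         positivity, fun R hR => ?_⟩
  have i0 : IntegrableOn (fun y : ℝ => y ^ (a + 1)) (Ioo 0 R) :=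
    (intervalIntegral.integrableOn_Ioo_rpow_iff hR).2 (by linarith)
  have i1 : IntegrableOn (fun z : E2 => ‖z‖ ^ a) (Metric.ball 0 R) := by
    refine (integrableOn_fun_norm_addHaar (μ := (volume : Measure E2)) (f := fun y : ℝ => y ^ a) (r := R)).2 ?_
    refine i0.congr_fun (fun y hy => ?_) measurableSet_Ioo
    simp only [finrank_euclideanSpace, Fintype.card_fin, smul_eq_mul]
    rw [add_comm, Real.rpow_add hy.1]; simp
  refine ⟨i1, ?_⟩
  rw [← ofReal_integral_eq_lintegral_ofReal i1 (Filter.Eventually.of_forall fun z => by positivity)]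
  apply ENNReal.ofReal_le_ofReal
  rw [← integral_indicator measurableSet_ball]
  have e : (Metric.ball (0 : E2) R).indicator (fun z : E2 => ‖z‖ ^ a) = fun z => (Iio R).indicator (fun y : ℝ => y ^ a) ‖z‖ := by
    ext z; simp [indicator]
  rw [e, integral_fun_norm_addHaar volume (fun y => (Iio R).indicator (fun y : ℝ => y ^ a) y)]
  have e2 : ∫ y in Ioi (0 : ℝ), y ^ (Module.finrank ℝ E2 - 1) • (Iio R).indicator (fun y : ℝ => y ^ a) y = R ^ (a + 2) / (a + 2) := by
    have : ∫ y in Ioo (0 : ℝ) R, y ^ (a + 1) = R ^ (a + 2) / (a + 2) := by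
      rw [← integral_Ioc_eq_integral_Ioo, ← intervalIntegral.integral_of_le hR.le, integral_rpow (Or.inl (by linarith)), Real.zero_rpow (by linarith)]
      rw [sub_zero, show a + 1 + 1 = a + 2 by ring]
    rw [← this, ← Ioi_inter_Iio, ← setIntegral_indicator measurableSet_Iio]
    refine setIntegral_congr_fun measurableSet_Ioi fun y hy => ?_
    simp only [finrank_euclideanSpace, Fintype.card_fin, smul_eq_mul, indicator]
    split_ifs
    · rw [add_comm, Real.rpow_add hy]; simp
    · simp
  rw [e2]
  simp
  apply le_of_eq; ring

lemma rad_out {a : ℝ} (ha : a < -2) : ∃ C : ℝ, 0 ≤ C ∧ ∀ R : ℝ, 0 < R →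
    ∫⁻ z in {z : E2 | R < ‖z‖}, ENNReal.ofReal (‖z‖ ^ a) ≤ ENNReal.ofReal (C * R ^ (a + 2)) := by
  refine ⟨2 * (volume : Measure E2).real (Metric.ball 0 1) / (-(a + 2)), by have : 0 < -(a + 2) := by linarith
                                                                            positivity, fun R hR => ?_⟩
  have ms : MeasurableSet {z : E2 | R < ‖z‖} := measurableSet_lt measurable_const measurable_norm
  have e : ({z : E2 | R < ‖z‖}).indicator (fun z : E2 => ‖z‖ ^ a) = fun z => (Ioi R).indicator (fun y : ℝ => y ^ a) ‖z‖ := by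
    ext z; simp [indicator]
  have e0 : ∀ y ∈ Ioi (0:ℝ), y ^ (Module.finrank ℝ E2 - 1) • (Ioi R).indicator (fun y : ℝ => y ^ a) y = (Ioi R).indicator (fun y => y ^ (a + 1)) y := by
    intro y hy
    simp only [finrank_euclideanSpace, Fintype.card_fin, smul_eq_mul, indicator]
    split_ifs
    · rw [add_comm, Real.rpow_add hy]; simp
    · simp
  have i1 : IntegrableOn (fun z : E2 => ‖z‖ ^ a) {z : E2 | R < ‖z‖} := by
    rw [← integrable_indicator_iff ms, e]
    refine (integrable_fun_norm_addHaar (μ := (volume : Measure E2)) (f := fun y => (Ioi R).indicator (fun y : ℝ => y ^ a) y)).2 ?_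
    rw [integrableOn_congr_fun e0 measurableSet_Ioi]
    exact ((integrable_indicator_iff measurableSet_Ioi).2 (integrableOn_Ioi_rpow_of_lt (by linarith) hR)).integrableOn
  rw [← ofReal_integral_eq_lintegral_ofReal i1 (Filter.Eventually.of_forall fun z => by positivity)]
  apply ENNReal.ofReal_le_ofReal
  rw [← integral_indicator ms]
  rw [e, integral_fun_norm_addHaar volume (fun y => (Ioi R).indicator (fun y : ℝ => y ^ a) y)]
  rw [setIntegral_congr_fun measurableSet_Ioi e0, setIntegral_indicator measurableSet_Ioi, inter_eq_right.2 (Ioi_subset_Ioi hR.le),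
    integral_Ioi_rpow_of_lt (by linarith) hR, show a + 1 + 1 = a + 2 by ring]
  simp
  apply le_of_eq
  have : a + 2 ≠ 0 := by linarith
  have : -2 + -a ≠ 0 := by intro h; linarith
  have : -a - 2 ≠ 0 := by intro h; linarith
  field_simp
  ring

def EK (z : E2) (i : Fin 2) : ℝ := z i / ‖z‖ ^ 2

lemma EK_le (z : E2) (i : Fin 2) : |EK z i| ≤ ‖z‖⁻¹ := by
  unfold EK
  rcases eq_or_ne z 0 with rfl | hz
  · simp
  have : 0 < ‖z‖ := norm_pos_iff.2 hz
  rw [abs_div, abs_of_nonneg (by positivity : 0 ≤ ‖z‖ ^ 2), div_le_iff₀ (by positivity)]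
  have h := PiLp.norm_apply_le z i
  rw [Real.norm_eq_abs] at h
  refine h.trans (le_of_eq ?_)
  field_simp

lemma EK_meas (i : Fin 2) : Measurable (fun z => EK z i) := by
  unfold EK
  have : Measurable fun z : E2 => z i := by fun_prop
  fun_prop

lemma EK_sub {a b : E2} (ha : a ≠ 0) (hb : b ≠ 0) (i : Fin 2) :
    |EK a i - EK b i| ≤ ‖a - b‖ / (‖a‖ * ‖b‖) := by
  have h := dist_div_norm_sq_smul ha hb 1
  have h2 := PiLp.norm_apply_le (((1 / ‖a‖) ^ 2 • a) - ((1 / ‖b‖) ^ 2 • b)) i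
  rw [← dist_eq_norm, h, dist_eq_norm] at h2
  have e : ((1 / ‖a‖) ^ 2 • a - (1 / ‖b‖) ^ 2 • b) i = EK a i - EK b i := by
    simp [EK]; ring
  rw [e, Real.norm_eq_abs] at h2
  refine h2.trans (le_of_eq ?_)
  ring

lemma EK_int {f : E2 → ℝ} (hf : Continuous f) (hc : HasCompactSupport f) (x : E2) (i : Fin 2) :
    Integrable (fun y => f y * EK (x - y) i) := by
  obtain ⟨R, hR1, hR⟩ := exists_supp_ball hc
  obtain ⟨M, hM⟩ := hf.bounded_above_of_compact_support hc
  have hM0 : 0 ≤ M := (norm_nonneg _).trans (hM 0)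
  have : Integrable (fun z => f (x - z) * EK z i) := by
    obtain ⟨C, -, h⟩ := rad_in (a := -1) (by norm_num)
    have h1 := (h (R + ‖x‖ + 1) (by positivity)).1
    have h2 := ((integrable_indicator_iff measurableSet_ball).2 h1).const_mul M
    refine h2.mono' ?_ (Filter.Eventually.of_forall fun z => ?_)
    · have := EK_meas i
      have : Measurable fun z => f (x - z) := (hf.comp (continuous_const.sub continuous_id)).measurable
      exact (Measurable.mul (by assumption) (by assumption)).aestronglyMeasurable
    · rw [norm_mul]
      by_cases hz : z ∈ Metric.ball (0 : E2) (R + ‖x‖ + 1)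
      · rw [indicator_of_mem hz, Real.rpow_neg_one]
        exact mul_le_mul (hM _) (EK_le z i) (abs_nonneg _) hM0
      · rw [indicator_of_notMem hz, hR (x - z)]
        · simp
        · simp at hz
          have := norm_sub_norm_le z x
          rw [norm_sub_rev] at this
          linarith
  have := this.comp_sub_left x
  simpa using this

lemma pd_refl {f : E2 → ℝ} (hf : ContDiff ℝ 1 f) (x z : E2) (i : Fin 2) :
    pd (fun z => f (x - z)) i z = - pd f i (x - z) := by
  have h1 : HasFDerivAt (fun z : E2 => x - z) (-ContinuousLinearMap.id ℝ E2) z := (hasFDerivAt_id z).const_sub x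
  have h2 := ((hf.differentiable one_ne_zero) (x - z)).hasFDerivAt.comp z h1
  have h3 := h2.fderiv
  unfold pd
  simp only [Function.comp_def] at h3
  rw [h3]; simp

lemma cauchy1 {f g : E2 → ℝ} (hf : ContDiff ℝ 1 f) (hfc : HasCompactSupport f)
    (hg : ContDiff ℝ 1 g) (hgc : HasCompactSupport g) (x : E2) :
    ∫ y, (EK (x - y) 0 * (pd f 0 y + pd g 1 y) + EK (x - y) 1 * (pd f 1 y - pd g 0 y)) = 2 * π * f x := by
  have cs : ContDiff ℝ 1 fun z : E2 => x - z := contDiff_const.sub contDiff_id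
  have hs : ∀ {f : E2 → ℝ}, HasCompactSupport f → HasCompactSupport fun z => f (x - z) := by
    intro f h
    exact h.comp_homeomorph (Homeomorph.subLeft x)
  have h := cauchy0 (hf.comp cs) (hs hfc) (hg.comp cs) (hs hgc)
  rw [← integral_sub_left_eq_self (fun y => EK (x - y) 0 * (pd f 0 y + pd g 1 y) + EK (x - y) 1 * (pd f 1 y - pd g 0 y)) volume x]
  simp only [_root_.sub_sub_cancel]
  rw [← neg_inj, ← integral_neg]
  simp only [Function.comp_def, pd_refl hf, pd_refl hg, sub_zero] at h
  rw [← h]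
  congr 1; ext z
  unfold EK; ring

def KK (x y : E2) : ℝ := (‖x - y‖ * max ‖x‖ ‖y‖)⁻¹

def EKc (ρ : ℝ) (y : E2) (i : Fin 2) : ℝ := if ρ ≤ ‖y‖ then EK (-y) i else 0

lemma EK_diff {ρ : ℝ} (hρ : 0 < ρ) {x y : E2} (h1 : ρ / 2 ≤ ‖x‖) (h2 : ‖x‖ ≤ 4 * ρ) (hy : y ≠ x) (i : Fin 2) :
    |EK (x - y) i - EKc ρ y i| ≤ 4 * ‖x‖ * KK x y := by
  have hx0 : 0 < ‖x‖ := by linarith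
  have hxy : 0 < ‖x - y‖ := norm_pos_iff.2 (sub_ne_zero.2 hy.symm)
  unfold EKc KK
  split_ifs with h
  · have hy0 : 0 < ‖y‖ := by linarith
    refine (EK_sub (sub_ne_zero.2 hy.symm) (neg_ne_zero.2 (norm_pos_iff.1 hy0)) i).trans ?_
    rw [norm_neg, show x - y - -y = x by abel]
    have : max ‖x‖ ‖y‖ ≤ 4 * ‖y‖ := max_le (by linarith) (by linarith)
    have hm : 0 < max ‖x‖ ‖y‖ := lt_max_of_lt_left hx0
    rw [← div_eq_mul_inv, div_le_div_iff₀ (by positivity) (by positivity)]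
    calc ‖x‖ * (‖x - y‖ * max ‖x‖ ‖y‖) ≤ ‖x‖ * (‖x - y‖ * (4 * ‖y‖)) := by gcongr
      _ = _ := by ring
  · push Not at h
    rw [sub_zero]
    refine (EK_le _ i).trans ?_
    have : max ‖x‖ ‖y‖ ≤ 4 * ‖x‖ := max_le (by linarith) (by linarith)
    have hm : 0 < max ‖x‖ ‖y‖ := lt_max_of_lt_left hx0
    rw [← div_eq_mul_inv, ← one_div, div_le_div_iff₀ (by positivity) (by positivity)]
    calc 1 * (‖x - y‖ * max ‖x‖ ‖y‖) ≤ 1 * (‖x - y‖ * (4 * ‖x‖)) := by gcongr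
      _ = _ := by ring

lemma EKc_int {f : E2 → ℝ} (hf : Continuous f) (hc : HasCompactSupport f) (ρ : ℝ) (i : Fin 2) :
    Integrable (fun y => f y * EKc ρ y i) := by
  have := (EK_int hf hc 0 i).indicator (s := {y : E2 | ρ ≤ ‖y‖}) (measurableSet_le measurable_const measurable_norm)
  refine this.congr (Filter.Eventually.of_forall fun y => ?_)
  simp only [indicator, EKc, mem_ofPred_eq, zero_sub]
  split_ifs <;> simp

/-- pointwise bound of `u - c_ρ` -/
lemma u_bound {v : Fin 2 → E2 → ℝ} (hv : ∀ b, ContDiff ℝ 2 (v b)) (hc : ∀ b, HasCompactSupport (v b))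
    {ρ : ℝ} (hρ : 0 < ρ) : ∃ c : Fin 2 → ℝ, ∀ x, ρ / 2 ≤ ‖x‖ → ‖x‖ ≤ 4 * ρ → ∀ b,
      ENNReal.ofReal |v b x - c b| ≤ ENNReal.ofReal ‖x‖ *
        ∫⁻ y, ENNReal.ofReal (KK x y) * ENNReal.ofReal (|dv v y| + |vo v y|) := by
  have key : ∀ b, ∃ (s : ℝ) (i j : Fin 2), |s| = 1 ∧ ∀ x,
      ∫ y, (dv v y * EK (x - y) i + s * (vo v y * EK (x - y) j)) = 2 * π * v b x := by
    have hv1 : ∀ b, ContDiff ℝ 1 (v b) := fun b => (hv b).of_le (by norm_num)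
    refine Fin.forall_fin_two.2 ⟨?_, ?_⟩
    · refine ⟨-1, 0, 1, by simp, fun x => ?_⟩
      rw [← cauchy1 (hv1 0) (hc 0) (hv1 1) (hc 1) x]
      congr 1; ext y; unfold dv vo; ring
    · refine ⟨1, 1, 0, by simp, fun x => ?_⟩
      have := cauchy1 (hv1 1) (hc 1) (hv1 0).neg (hc 0).neg x
      rw [← this]
      have e : ∀ i y, pd (-v 0) i y = - pd (v 0) i y := by
        intro i y; unfold pd; rw [fderiv_neg]; simp
      have e' : ∀ i y, pd (fun x => - v 0 x) i y = - pd (v 0) i y := e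
      congr 1; ext y; simp only [e']; unfold dv vo; ring
  choose s i j hs hk using key
  refine ⟨fun b => (2 * π)⁻¹ * ∫ y, (dv v y * EKc ρ y (i b) + s b * (vo v y * EKc ρ y (j b))), fun x h1 h2 b => ?_⟩
  have hpi := pi_gt_three
  have e : v b x = (2 * π)⁻¹ * ∫ y, (dv v y * EK (x - y) (i b) + s b * (vo v y * EK (x - y) (j b))) := by
    rw [hk b x]; field_simp
  have I1 := (EK_int (dv_cont hv) (dv_supp hc) x (i b)).add ((EK_int (vo_cont hv) (vo_supp hc) x (j b)).const_mul (s b))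
  have I2 := (EKc_int (dv_cont hv) (dv_supp hc) ρ (i b)).add ((EKc_int (vo_cont hv) (vo_supp hc) ρ (j b)).const_mul (s b))
  rw [e, ← mul_sub]
  have e2 := integral_sub I1 I2
  simp only [Pi.add_apply] at e2
  rw [← e2, abs_mul, ENNReal.ofReal_mul (abs_nonneg _)]
  rw [← Real.norm_eq_abs (∫ _, _), ofReal_norm]
  have hx : ∀ᵐ y : E2, y ≠ x := by
    simp [ae_iff]
  have b1 : ∀ᵐ y : E2, ‖dv v y * EK (x - y) (i b) + s b * (vo v y * EK (x - y) (j b)) - (dv v y * EKc ρ y (i b) + s b * (vo v y * EKc ρ y (j b)))‖ₑ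
      ≤ ENNReal.ofReal 4 * (ENNReal.ofReal ‖x‖ * (ENNReal.ofReal (KK x y) * ENNReal.ofReal (|dv v y| + |vo v y|))) := by
    filter_upwards [hx] with y hy
    have hK : 0 ≤ KK x y := by unfold KK; positivity
    rw [← ENNReal.ofReal_mul hK, ← ENNReal.ofReal_mul (norm_nonneg _), ← ENNReal.ofReal_mul (by norm_num), ← ofReal_norm]
    apply ENNReal.ofReal_le_ofReal
    rw [Real.norm_eq_abs]
    have d1 := EK_diff hρ h1 h2 hy (i b)
    have d2 := EK_diff hρ h1 h2 hy (j b)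
    have : dv v y * EK (x - y) (i b) + s b * (vo v y * EK (x - y) (j b)) - (dv v y * EKc ρ y (i b) + s b * (vo v y * EKc ρ y (j b)))
      = dv v y * (EK (x - y) (i b) - EKc ρ y (i b)) + s b * (vo v y * (EK (x - y) (j b) - EKc ρ y (j b))) := by ring
    rw [this]
    refine (abs_add_le _ _).trans ?_
    rw [abs_mul, abs_mul, abs_mul, hs b, one_mul]
    calc _ ≤ |dv v y| * (4 * ‖x‖ * KK x y) + |vo v y| * (4 * ‖x‖ * KK x y) := by gcongr
      _ = _ := by ring
  have b2 := (enorm_integral_le_lintegral_enorm _).trans (lintegral_mono_ae b1)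
  rw [lintegral_const_mul' _ _ (by simp), lintegral_const_mul' _ _ (by simp)] at b2
  calc _ ≤ ENNReal.ofReal |(2 * π)⁻¹| * (ENNReal.ofReal 4 * (ENNReal.ofReal ‖x‖ *
        ∫⁻ y, ENNReal.ofReal (KK x y) * ENNReal.ofReal (|dv v y| + |vo v y|))) := by gcongr
    _ = ENNReal.ofReal (|(2 * π)⁻¹| * 4) * (ENNReal.ofReal ‖x‖ *
        ∫⁻ y, ENNReal.ofReal (KK x y) * ENNReal.ofReal (|dv v y| + |vo v y|)) := by
      rw [ENNReal.ofReal_mul (abs_nonneg _), mul_assoc]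
    _ ≤ 1 * _ := by
      gcongr
      rw [ENNReal.ofReal_le_one, abs_of_pos (by positivity), inv_mul_le_iff₀ (by positivity)]
      linarith
    _ = _ := one_mul _


lemma KK_nn (x y : E2) : 0 ≤ KK x y := by unfold KK; positivity
lemma KK_symm (x y : E2) : KK x y = KK y x := by unfold KK; rw [norm_sub_rev, max_comm]
lemma KK_meas : Measurable fun q : E2 × E2 => KK q.1 q.2 := by unfold KK; fun_prop

lemma KK_measx (x : E2) : Measurable fun y => KK x y := by unfold KK; fun_prop

def ww (x : E2) : ℝ≥0∞ := ENNReal.ofReal ‖x‖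
lemma ww_meas : Measurable ww := by unfold ww; fun_prop
lemma ww_pos {x : E2} (hx : x ≠ 0) : ww x ≠ 0 := by
  unfold ww; simpa using hx
lemma ww_top (x : E2) : ww x ≠ ⊤ := by unfold ww; simp
lemma ww_rpow {x : E2} (hx : x ≠ 0) (a : ℝ) : ww x ^ a = ENNReal.ofReal (‖x‖ ^ a) :=
  ENNReal.ofReal_rpow_of_pos (norm_pos_iff.2 hx)

lemma schur_KK {τ : ℝ} (h0 : 0 < τ) (h2 : τ < 2) : ∃ C : ℝ≥0∞, C ≠ ⊤ ∧ ∀ x : E2, x ≠ 0 →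
    ∫⁻ y, ENNReal.ofReal (KK x y) * ww y ^ (-τ) ≤ C * ww x ^ (-τ) := by
  obtain ⟨C1, hC1, H1⟩ := rad_in (a := -τ) (by linarith)
  obtain ⟨C2, hC2, H2⟩ := rad_out (a := -2 - τ) (by linarith)
  obtain ⟨C3, hC3, H3⟩ := rad_in (a := -1) (by norm_num)
  refine ⟨ENNReal.ofReal (2 * C1 * (1 / 2) ^ (-τ + 2)) + (ENNReal.ofReal (2 * C2 * 2 ^ (-τ)) +
    ENNReal.ofReal (4 * C3 * (1 / 2) ^ (-τ))), by finiteness, fun x hx => ?_⟩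
  have hr : 0 < ‖x‖ := norm_pos_iff.2 hx
  rw [ww_rpow hx]
  set r := ‖x‖ with hrdef
  have hm : ∀ y : E2, r ≤ max ‖x‖ ‖y‖ := fun y => le_max_left _ _
  have hcov : (univ : Set E2) ⊆ Metric.ball 0 (r / 2) ∪ ({y | 2 * r < ‖y‖} ∪ {y | r / 2 ≤ ‖y‖ ∧ ‖y‖ ≤ 2 * r}) := by
    intro y _
    simp only [mem_union, Metric.mem_ball, dist_zero_right, mem_ofPred_eq]
    rcases lt_or_ge ‖y‖ (r / 2) with h | h
    · exact Or.inl h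
    · rcases lt_or_ge (2 * r) ‖y‖ with h' | h'
      · exact Or.inr (Or.inl h')
      · exact Or.inr (Or.inr ⟨h, h'⟩)
  have ae0 : ∀ᵐ y : E2, y ≠ 0 := by simp [ae_iff]
  have aex : ∀ᵐ y : E2, y ≠ x := by simp [ae_iff]
  have e0 : ∫⁻ y, ENNReal.ofReal (KK x y) * ww y ^ (-τ) = ∫⁻ y, ENNReal.ofReal (KK x y * ‖y‖ ^ (-τ)) := by
    refine lintegral_congr_ae ?_
    filter_upwards [ae0] with y hy
    rw [ww_rpow hy, ENNReal.ofReal_mul (KK_nn x y)]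
  rw [e0, ← setLIntegral_univ]
  refine (lintegral_mono_set hcov).trans ?_
  refine (lintegral_union_le _ _ _).trans ?_
  rw [add_mul, add_mul]
  refine add_le_add ?_ ((lintegral_union_le _ _ _).trans (add_le_add ?_ ?_))
  · have b : ∀ y ∈ Metric.ball (0 : E2) (r / 2), ENNReal.ofReal (KK x y * ‖y‖ ^ (-τ)) ≤ ENNReal.ofReal (2 / r ^ 2) * ENNReal.ofReal (‖y‖ ^ (-τ)) := by
      intro y hy
      rw [← ENNReal.ofReal_mul (by positivity)]
      apply ENNReal.ofReal_le_ofReal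
      gcongr
      simp at hy
      have h3 : r / 2 ≤ ‖x - y‖ := by linarith [norm_sub_norm_le x y]
      unfold KK
      calc (‖x - y‖ * max ‖x‖ ‖y‖)⁻¹ ≤ (r / 2 * r)⁻¹ := by
            gcongr; exact hm y
        _ = _ := by field_simp
    refine (setLIntegral_mono' measurableSet_ball b).trans ?_
    rw [lintegral_const_mul' _ _ (by simp)]
    refine (mul_le_mul_right (H1 (r / 2) (by positivity)).2 _).trans (le_of_eq ?_)
    rw [← ENNReal.ofReal_mul (by positivity), ← ENNReal.ofReal_mul (by positivity)]
    congr 1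
    rw [div_eq_mul_one_div r 2, Real.mul_rpow hr.le (by norm_num), Real.rpow_add hr, Real.rpow_two]
    field_simp
  · have ms : MeasurableSet {y : E2 | 2 * r < ‖y‖} := measurableSet_lt measurable_const measurable_norm
    have b : ∀ y ∈ {y : E2 | 2 * r < ‖y‖}, ENNReal.ofReal (KK x y * ‖y‖ ^ (-τ)) ≤ ENNReal.ofReal 2 * ENNReal.ofReal (‖y‖ ^ (-2 - τ)) := by
      intro y hy
      rw [← ENNReal.ofReal_mul (by positivity)]
      apply ENNReal.ofReal_le_ofReal
      simp at hy
      have hy0 : 0 < ‖y‖ := by linarith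
      have h3 : ‖y‖ / 2 ≤ ‖x - y‖ := by
        have := norm_sub_norm_le y x
        rw [norm_sub_rev] at this; linarith
      unfold KK
      calc (‖x - y‖ * max ‖x‖ ‖y‖)⁻¹ * ‖y‖ ^ (-τ) ≤ (‖y‖ / 2 * ‖y‖)⁻¹ * ‖y‖ ^ (-τ) := by
            gcongr; exact le_max_right _ _
        _ = 2 * ‖y‖ ^ (-2 - τ) := by
          rw [sub_eq_add_neg, Real.rpow_add hy0, Real.rpow_neg hy0.le 2, Real.rpow_two]
          field_simp
    refine (setLIntegral_mono' ms b).trans ?_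
    rw [lintegral_const_mul' _ _ (by simp)]
    refine (mul_le_mul_right (H2 (2 * r) (by positivity)) _).trans (le_of_eq ?_)
    rw [← ENNReal.ofReal_mul (by positivity), ← ENNReal.ofReal_mul (by positivity)]
    congr 1
    rw [show -2 - τ + 2 = -τ by ring, Real.mul_rpow (by norm_num) hr.le]
    ring
  · have ms : MeasurableSet {y : E2 | r / 2 ≤ ‖y‖ ∧ ‖y‖ ≤ 2 * r} :=
      (measurableSet_le measurable_const measurable_norm).inter (measurableSet_le measurable_norm measurable_const)
    have b : ∀ y ∈ {y : E2 | r / 2 ≤ ‖y‖ ∧ ‖y‖ ≤ 2 * r}, ENNReal.ofReal (KK x y * ‖y‖ ^ (-τ)) ≤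
        ENNReal.ofReal (r⁻¹ * (r / 2) ^ (-τ)) * (Metric.ball (0 : E2) (4 * r)).indicator (fun z => ENNReal.ofReal (‖z‖ ^ (-1 : ℝ))) (x - y) := by
      intro y hy
      obtain ⟨ha, hb⟩ := hy
      have hmem : x - y ∈ Metric.ball (0 : E2) (4 * r) := by
        simp
        linarith [norm_sub_le x y]
      rw [indicator_of_mem hmem, ← ENNReal.ofReal_mul (by positivity)]
      apply ENNReal.ofReal_le_ofReal
      unfold KK
      rw [mul_inv]
      have k1 : (max ‖x‖ ‖y‖)⁻¹ ≤ r⁻¹ := by gcongr; exact hm y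
      have k2 : ‖y‖ ^ (-τ) ≤ (r / 2) ^ (-τ) := Real.rpow_le_rpow_of_nonpos (by positivity) ha (by linarith)
      rw [Real.rpow_neg_one]
      calc ‖x - y‖⁻¹ * (max ‖x‖ ‖y‖)⁻¹ * ‖y‖ ^ (-τ) ≤ ‖x - y‖⁻¹ * r⁻¹ * (r / 2) ^ (-τ) := by gcongr
        _ = _ := by ring
    refine (setLIntegral_mono' ms b).trans ((setLIntegral_le_lintegral _ _).trans ?_)
    rw [lintegral_const_mul' _ _ (by simp),
      lintegral_sub_left_eq_self (fun z => (Metric.ball (0 : E2) (4 * r)).indicator (fun z => ENNReal.ofReal (‖z‖ ^ (-1 : ℝ))) z) x,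
      lintegral_indicator measurableSet_ball]
    refine (mul_le_mul_right (H3 (4 * r) (by positivity)).2 _).trans (le_of_eq ?_)
    rw [← ENNReal.ofReal_mul (by positivity), ← ENNReal.ofReal_mul (by positivity)]
    congr 1
    rw [div_eq_mul_one_div r 2, Real.mul_rpow hr.le (by norm_num)]
    norm_num
    field_simp

lemma schur {p α : ℝ} (hp : 1 < p) (h1 : -2 < α) (h2 : α < 2 * (p - 1)) : ∃ C : ℝ≥0∞, C ≠ ⊤ ∧
    ∀ g : E2 → ℝ≥0∞, Measurable g →
    ∫⁻ x, (∫⁻ y, ENNReal.ofReal (KK x y) * g y) ^ p * ww x ^ α ≤ C * ∫⁻ y, g y ^ p * ww y ^ α := by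
  obtain ⟨q, hpq⟩ : ∃ q, p.HolderConjugate q := ⟨_, Real.HolderConjugate.conjExponent hp⟩
  have hq := hpq.symm.lt
  have hp0 : 0 < p := by linarith
  have hq0 : 0 < q := by linarith
  obtain ⟨t, ht1, ht2⟩ : ∃ t, max 0 α < t ∧ t < min (2 * (p - 1)) (α + 2) :=
    exists_between (max_lt (lt_min (by linarith) (by linarith)) (lt_min (by linarith) (by linarith)))
  obtain ⟨ht0, htα⟩ := max_lt_iff.1 ht1
  obtain ⟨htp, htα2⟩ := lt_min_iff.1 ht2
  have hqp : q * (p - 1) = p := by have := hpq.sub_one_mul_conj; linarith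
  obtain ⟨τ, hτ⟩ : ∃ τ, τ = t * q / p := ⟨_, rfl⟩
  obtain ⟨C1, hC1, H1⟩ := schur_KK (τ := τ) (by rw [hτ]; positivity) (by
    rw [hτ, div_lt_iff₀ hp0]
    have := mul_lt_mul_of_pos_right htp hq0
    linarith)
  obtain ⟨C2, hC2, H2⟩ := schur_KK (τ := t - α) (by linarith) (by linarith)
  refine ⟨C1 ^ (p / q) * C2, ENNReal.mul_ne_top (ENNReal.rpow_ne_top_of_nonneg (by positivity) hC1) hC2, fun g hg => ?_⟩
  have ae0 : ∀ᵐ y : E2, y ≠ 0 := by simp [ae_iff]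
  have wm := ww_meas
  have km := KK_meas
  have kmx : ∀ x, Measurable fun y => KK x y := KK_measx
  have step : ∀ᵐ x : E2, (∫⁻ y, ENNReal.ofReal (KK x y) * g y) ^ p * ww x ^ α ≤
      C1 ^ (p / q) * ∫⁻ y, ww x ^ (-(t - α)) * (ENNReal.ofReal (KK x y) * (ww y ^ t * g y ^ p)) := by
    filter_upwards [ae0] with x hx
    set f : E2 → ℝ≥0∞ := fun y => ENNReal.ofReal (KK x y) ^ (1 / p) * (ww y ^ (t / p) * g y)
    set h : E2 → ℝ≥0∞ := fun y => ENNReal.ofReal (KK x y) ^ (1 / q) * ww y ^ (-(t / p))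
    have := kmx x
    have fm : Measurable f := by fun_prop
    have hm : Measurable h := by fun_prop
    have hol := ENNReal.lintegral_mul_le_Lp_mul_Lq volume hpq fm.aemeasurable hm.aemeasurable
    have ef : ∀ y, f y ^ p = ENNReal.ofReal (KK x y) * (ww y ^ t * g y ^ p) := by
      intro y
      simp only [f]
      rw [ENNReal.mul_rpow_of_nonneg _ _ hp0.le, ENNReal.mul_rpow_of_nonneg _ _ hp0.le, ← ENNReal.rpow_mul, ← ENNReal.rpow_mul]
      rw [one_div_mul_cancel hp0.ne', div_mul_cancel₀ _ hp0.ne', ENNReal.rpow_one]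
    have eh : ∀ y, h y ^ q = ENNReal.ofReal (KK x y) * ww y ^ (-τ) := by
      intro y
      simp only [h]
      rw [ENNReal.mul_rpow_of_nonneg _ _ hq0.le, ← ENNReal.rpow_mul, ← ENNReal.rpow_mul]
      rw [one_div_mul_cancel hq0.ne', ENNReal.rpow_one, hτ]
      congr 2; ring
    have efh : ∀ᵐ y, ENNReal.ofReal (KK x y) * g y = (f * h) y := by
      filter_upwards [ae0] with y hy
      simp only [f, h, Pi.mul_apply]
      have a1 : ENNReal.ofReal (KK x y) ^ (1 / p) * ENNReal.ofReal (KK x y) ^ (1 / q) = ENNReal.ofReal (KK x y) := by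
        rw [← ENNReal.rpow_add_of_nonneg _ _ (by positivity) (by positivity)]
        have := hpq.inv_add_inv_eq_one
        rw [one_div, one_div, this, ENNReal.rpow_one]
      have a2 : ww y ^ (t / p) * ww y ^ (-(t / p)) = 1 := by
        rw [← ENNReal.rpow_add _ _ (ww_pos hy) (ww_top y), add_neg_cancel, ENNReal.rpow_zero]
      calc _ = (ENNReal.ofReal (KK x y) ^ (1 / p) * ENNReal.ofReal (KK x y) ^ (1 / q)) * (ww y ^ (t / p) * ww y ^ (-(t / p))) * g y := by rw [a1, a2, mul_one]
        _ = _ := by ring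
    rw [lintegral_congr_ae efh]
    simp only [ef, eh] at hol
    calc _ ≤ ((∫⁻ y, ENNReal.ofReal (KK x y) * (ww y ^ t * g y ^ p)) ^ (1 / p) * (C1 * ww x ^ (-τ)) ^ (1 / q)) ^ p * ww x ^ α := by
          gcongr
          refine hol.trans ?_
          gcongr
          exact H1 x hx
      _ = C1 ^ (p / q) * (ww x ^ (-t) * ww x ^ α * ∫⁻ y, ENNReal.ofReal (KK x y) * (ww y ^ t * g y ^ p)) := by
          rw [ENNReal.mul_rpow_of_nonneg _ _ hp0.le, ← ENNReal.rpow_mul, ← ENNReal.rpow_mul, one_div_mul_cancel hp0.ne', ENNReal.rpow_one,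
            ENNReal.mul_rpow_of_nonneg _ _ (by positivity), ← ENNReal.rpow_mul]
          have e1 : 1 / q * p = p / q := by ring
          have e2 : -τ * (1 / q * p) = -t := by rw [hτ]; field_simp
          rw [e2, e1]; ring
      _ = _ := by
          rw [lintegral_const_mul' _ _ (by rw [ww_rpow hx]; simp), ← ENNReal.rpow_add _ _ (ww_pos hx) (ww_top x)]
          congr 4; ring
  refine (lintegral_mono_ae step).trans ?_
  rw [lintegral_const_mul' _ _ (ENNReal.rpow_ne_top_of_nonneg (by positivity) hC1), mul_assoc]
  gcongr
  rw [lintegral_lintegral_swap (by fun_prop), ← lintegral_const_mul' _ _ hC2]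
  refine lintegral_mono_ae ?_
  filter_upwards [ae0] with y hy
  calc _ = ∫⁻ x, (ww y ^ t * g y ^ p) * (ENNReal.ofReal (KK y x) * ww x ^ (-(t - α))) := by
        refine lintegral_congr fun x => ?_
        rw [KK_symm]; ring
    _ = (ww y ^ t * g y ^ p) * ∫⁻ x, (ENNReal.ofReal (KK y x) * ww x ^ (-(t - α))) := by
        have := kmx y
        rw [lintegral_const_mul _ (by fun_prop)]
    _ ≤ (ww y ^ t * g y ^ p) * (C2 * ww y ^ (-(t - α))) := by gcongr; exact H2 y hy
    _ = C2 * (g y ^ p * (ww y ^ t * ww y ^ (-(t - α)))) := by ring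
    _ = _ := by
        rw [← ENNReal.rpow_add _ _ (ww_pos hy) (ww_top y)]
        congr 4; ring


def chi (x : E2) : ℝ :=
  Real.smoothTransition ((‖x‖ ^ 2 - 1 / 4) * (4 / 3)) * Real.smoothTransition ((16 - ‖x‖ ^ 2) / 12)

lemma chi_cd : ContDiff ℝ 2 chi := by
  have h : ContDiff ℝ 2 fun x : E2 => ‖x‖ ^ 2 := contDiff_norm_sq ℝ
  have h1 : ContDiff ℝ 2 fun x : E2 => (‖x‖ ^ 2 - 1 / 4) * (4 / 3) := (h.sub contDiff_const).mul contDiff_const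
  have h2 : ContDiff ℝ 2 fun x : E2 => (16 - ‖x‖ ^ 2) / 12 := (contDiff_const.sub h).div_const _
  exact (Real.smoothTransition.contDiff.comp h1).mul (Real.smoothTransition.contDiff.comp h2)

lemma chi_nn (x : E2) : 0 ≤ chi x := mul_nonneg (Real.smoothTransition.nonneg _) (Real.smoothTransition.nonneg _)
lemma chi_le (x : E2) : chi x ≤ 1 := mul_le_one₀ (Real.smoothTransition.le_one _) (Real.smoothTransition.nonneg _) (Real.smoothTransition.le_one _)

lemma chi_one {x : E2} (h1 : 1 ≤ ‖x‖) (h2 : ‖x‖ ≤ 2) : chi x = 1 := by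
  unfold chi
  rw [Real.smoothTransition.one_of_one_le (by nlinarith), Real.smoothTransition.one_of_one_le (by
    rw [le_div_iff₀ (by norm_num)]; nlinarith), one_mul]

lemma chi_zero {x : E2} (h : ¬ (1 / 2 ≤ ‖x‖ ∧ ‖x‖ < 4)) : chi x = 0 := by
  unfold chi
  have h0 := norm_nonneg x
  by_cases h1 : 1 / 2 ≤ ‖x‖
  · have : 4 ≤ ‖x‖ := by by_contra! hh; exact h ⟨h1, hh⟩
    rw [Real.smoothTransition.zero_of_nonpos (x := (16 - ‖x‖ ^ 2) / 12) (by
      apply div_nonpos_of_nonpos_of_nonneg <;> nlinarith), mul_zero]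
  · push Not at h1
    rw [Real.smoothTransition.zero_of_nonpos (by nlinarith), zero_mul]

lemma chi_pd1 {x : E2} (h : chi x = 1) (i : Fin 2) : pd chi i x = 0 := by
  have : IsLocalMax chi x := Filter.Eventually.of_forall fun y => by rw [h]; exact chi_le y
  unfold pd; rw [this.fderiv_eq_zero]; simp

lemma chi_pd0 {x : E2} (h : chi x = 0) (i : Fin 2) : pd chi i x = 0 := by
  have : IsLocalMin chi x := Filter.Eventually.of_forall fun y => by rw [h]; exact chi_nn y
  unfold pd; rw [this.fderiv_eq_zero]; simp

lemma chi_supp : HasCompactSupport chi := by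
  refine HasCompactSupport.of_support_subset_isCompact (isCompact_closedBall (0 : E2) 4) ?_
  intro x hx
  by_contra h
  apply hx
  apply chi_zero
  simp at h
  intro h'; linarith [h'.2]

lemma chi_bd : ∃ M : ℝ, 0 ≤ M ∧ ∀ i x, |pd chi i x| ≤ M := by
  have c : ∀ i, Continuous (pd chi i) := fun i => (pd_cd (m := 0) chi_cd (by norm_num) i).continuous
  obtain ⟨M0, h0⟩ := (c 0).bounded_above_of_compact_support (pd_supp chi_supp 0)
  obtain ⟨M1, h1⟩ := (c 1).bounded_above_of_compact_support (pd_supp chi_supp 1)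
  refine ⟨max M0 M1, (norm_nonneg _).trans ((h0 0).trans (le_max_left _ _)), Fin.forall_fin_two.2 ⟨fun x => (h0 x).trans (le_max_left _ _), fun x => (h1 x).trans (le_max_right _ _)⟩⟩

def loc (ρ c : ℝ) (v : E2 → ℝ) (x : E2) : ℝ := chi (ρ⁻¹ • x) * (v x - c)

lemma loc_cd {ρ c : ℝ} {v : E2 → ℝ} (hv : ContDiff ℝ 2 v) : ContDiff ℝ 2 (loc ρ c v) :=
  (chi_cd.comp (contDiff_const_smul ρ⁻¹)).mul (hv.sub contDiff_const)

lemma loc_supp {ρ c : ℝ} (hρ : 0 < ρ) {v : E2 → ℝ} : HasCompactSupport (loc ρ c v) := by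
  have : HasCompactSupport fun x : E2 => chi (ρ⁻¹ • x) :=
    chi_supp.comp_homeomorph (Homeomorph.smulOfNeZero ρ⁻¹ (inv_ne_zero hρ.ne'))
  exact this.mul_right

lemma loc_pd {ρ c : ℝ} {v : E2 → ℝ} (hv : ContDiff ℝ 2 v) (i : Fin 2) (x : E2) :
    pd (loc ρ c v) i x = chi (ρ⁻¹ • x) * pd v i x + (v x - c) * (ρ⁻¹ * pd chi i (ρ⁻¹ • x)) := by
  have h1 : HasFDerivAt (fun z : E2 => ρ⁻¹ • z) (ρ⁻¹ • ContinuousLinearMap.id ℝ E2) x := (hasFDerivAt_id x).const_smul ρ⁻¹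
  have h2 := ((chi_cd.differentiable two_ne_zero) (ρ⁻¹ • x)).hasFDerivAt.comp x h1
  have h3 := ((hv.differentiable two_ne_zero) x).hasFDerivAt.sub_const c
  have h4 := (h2.mul h3).fderiv
  have e : loc ρ c v = (chi ∘ fun z : E2 => ρ⁻¹ • z) * fun z => v z - c := rfl
  unfold pd
  rw [e, h4]
  simp

lemma abs_rpow_int {f : E2 → ℝ} (hf : Continuous f) (hc : HasCompactSupport f) {p : ℝ} (hp : 0 < p) :
    Integrable (fun x => |f x| ^ p) := by
  refine (hf.abs.rpow_const fun _ => Or.inr hp.le).integrable_of_hasCompactSupport ?_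
  refine hc.mono ?_
  intro x hx
  contrapose! hx
  simp only [Function.mem_support, ne_eq, not_not] at hx ⊢
  simp [hx, hp.ne']

lemma abs_rpow_lint {f : E2 → ℝ} (hf : Continuous f) (hc : HasCompactSupport f) {p : ℝ} (hp : 0 < p) :
    ∫⁻ x, ENNReal.ofReal |f x| ^ p = ENNReal.ofReal (∫ x, |f x| ^ p) := by
  rw [ofReal_integral_eq_lintegral_ofReal (abs_rpow_int hf hc hp) (Filter.Eventually.of_forall fun x => by positivity)]
  refine lintegral_congr fun x => ?_
  rw [ENNReal.ofReal_rpow_of_nonneg (abs_nonneg _) hp.le]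

lemma unweighted' {p : ℝ} (hp : 1 < p) : ∃ C : ℝ≥0∞, C ≠ ⊤ ∧ ∀ (v : Fin 2 → E2 → ℝ),
    (∀ b, ContDiff ℝ 2 (v b)) → (∀ b, HasCompactSupport (v b)) → ∀ a b,
    ∫⁻ x, ENNReal.ofReal |pd (v b) a x| ^ p ≤
      C * ((∫⁻ x, ENNReal.ofReal |dv v x| ^ p) + ∫⁻ x, ENNReal.ofReal |vo v x| ^ p) := by
  obtain ⟨C, hC, H⟩ := unweighted hp
  refine ⟨ENNReal.ofReal C, by simp, fun v hv hc a b => ?_⟩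
  have hp0 : 0 < p := by linarith
  rw [abs_rpow_lint (pdv_cont hv a b) (pd_supp (hc b) a) hp0, abs_rpow_lint (dv_cont hv) (dv_supp hc) hp0,
    abs_rpow_lint (vo_cont hv) (vo_supp hc) hp0, ← ENNReal.ofReal_add (by positivity) (by positivity), ← ENNReal.ofReal_mul hC]
  exact ENNReal.ofReal_le_ofReal (H v hv hc a b)

def gg (v : Fin 2 → E2 → ℝ) (y : E2) : ℝ≥0∞ := ENNReal.ofReal (|dv v y| + |vo v y|)
def TT (v : Fin 2 → E2 → ℝ) (x : E2) : ℝ≥0∞ := ∫⁻ y, ENNReal.ofReal (KK x y) * gg v y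

lemma gg_meas {v : Fin 2 → E2 → ℝ} (hv : ∀ b, ContDiff ℝ 2 (v b)) : Measurable (gg v) := by
  have := dv_cont hv; have := vo_cont hv
  exact ENNReal.measurable_ofReal.comp (Continuous.measurable (by fun_prop))

lemma TT_meas {v : Fin 2 → E2 → ℝ} (hv : ∀ b, ContDiff ℝ 2 (v b)) : Measurable (TT v) := by
  have := gg_meas hv; have := KK_meas
  exact Measurable.lintegral_prod_right' (f := fun q : E2 × E2 => ENNReal.ofReal (KK q.1 q.2) * gg v q.2) (by fun_prop)

lemma local_est {p : ℝ} (hp : 1 < p) : ∃ C : ℝ≥0∞, C ≠ ⊤ ∧ ∀ (v : Fin 2 → E2 → ℝ),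
    (∀ b, ContDiff ℝ 2 (v b)) → (∀ b, HasCompactSupport (v b)) → ∀ a b, ∀ ρ : ℝ, 0 < ρ →
    ∫⁻ x in {x | ρ ≤ ‖x‖ ∧ ‖x‖ < 2 * ρ}, ENNReal.ofReal |pd (v b) a x| ^ p ≤
      C * ∫⁻ x in {x | ρ / 2 ≤ ‖x‖ ∧ ‖x‖ < 4 * ρ}, (gg v x ^ p + TT v x ^ p) := by
  obtain ⟨C, hC, H⟩ := unweighted' hp
  obtain ⟨M, hM, HM⟩ := chi_bd
  have hp0 : 0 < p := by linarith
  set B : ℝ≥0∞ := 2 ^ (p - 1) * (1 + ENNReal.ofReal (8 * M) ^ p) with hB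
  have hBt : B ≠ ⊤ := by
    refine ENNReal.mul_ne_top (ENNReal.rpow_ne_top_of_nonneg (by linarith) (by simp)) ?_
    exact ENNReal.add_ne_top.2 ⟨by simp, ENNReal.rpow_ne_top_of_nonneg hp0.le ENNReal.ofReal_ne_top⟩
  refine ⟨C * (B + B), ENNReal.mul_ne_top hC (ENNReal.add_ne_top.2 ⟨hBt, hBt⟩), fun v hv hc a b ρ hρ => ?_⟩
  obtain ⟨c, hcb⟩ := u_bound hv hc hρ
  set w : Fin 2 → E2 → ℝ := fun b => loc ρ (c b) (v b) with hw
  have hwc : ∀ b, ContDiff ℝ 2 (w b) := fun b => loc_cd (hv b)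
  have hws : ∀ b, HasCompactSupport (w b) := fun b => loc_supp hρ
  have hwp : ∀ a b x, pd (w b) a x = chi (ρ⁻¹ • x) * pd (v b) a x + (v b x - c b) * (ρ⁻¹ * pd chi a (ρ⁻¹ • x)) :=
    fun a b x => loc_pd (hv b) a x
  have hn : ∀ x : E2, ‖ρ⁻¹ • x‖ = ‖x‖ / ρ := by
    intro x; rw [norm_smul, norm_inv, Real.norm_of_nonneg hρ.le]; ring
  have mA : MeasurableSet {x : E2 | ρ ≤ ‖x‖ ∧ ‖x‖ < 2 * ρ} :=
    (measurableSet_le measurable_const measurable_norm).inter (measurableSet_lt measurable_norm measurable_const)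
  have mB : MeasurableSet {x : E2 | ρ / 2 ≤ ‖x‖ ∧ ‖x‖ < 4 * ρ} :=
    (measurableSet_le measurable_const measurable_norm).inter (measurableSet_lt measurable_norm measurable_const)
  -- core
  have s1 : ∫⁻ x in {x | ρ ≤ ‖x‖ ∧ ‖x‖ < 2 * ρ}, ENNReal.ofReal |pd (v b) a x| ^ p ≤ ∫⁻ x, ENNReal.ofReal |pd (w b) a x| ^ p := by
    refine le_trans (le_of_eq ?_) (setLIntegral_le_lintegral {x | ρ ≤ ‖x‖ ∧ ‖x‖ < 2 * ρ} _)
    refine setLIntegral_congr_fun mA fun x hx => ?_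
    have h1 : chi (ρ⁻¹ • x) = 1 := chi_one (by rw [hn, le_div_iff₀ hρ]; linarith [hx.1]) (by rw [hn, div_le_iff₀ hρ]; exact hx.2.le)
    rw [hwp, h1, chi_pd1 h1]; simp
  have out : ∀ x, x ∉ {x : E2 | ρ / 2 ≤ ‖x‖ ∧ ‖x‖ < 4 * ρ} → ∀ a b, pd (w b) a x = 0 := by
    intro x hx a b
    have h1 : chi (ρ⁻¹ • x) = 0 := by
      apply chi_zero
      intro h
      apply hx
      rw [hn, le_div_iff₀ hρ, div_lt_iff₀ hρ] at h
      exact ⟨by linarith [h.1], h.2⟩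
    rw [hwp, h1, chi_pd0 h1]; simp
  have inn : ∀ x ∈ {x : E2 | ρ / 2 ≤ ‖x‖ ∧ ‖x‖ < 4 * ρ}, ∀ b a, ENNReal.ofReal |(v b x - c b) * (ρ⁻¹ * pd chi a (ρ⁻¹ • x))| ≤
      ENNReal.ofReal (4 * M) * TT v x := by
    intro x hx b a
    rw [abs_mul, ENNReal.ofReal_mul (abs_nonneg _)]
    calc _ ≤ (ENNReal.ofReal ‖x‖ * TT v x) * ENNReal.ofReal |ρ⁻¹ * pd chi a (ρ⁻¹ • x)| := by
          gcongr; exact hcb x hx.1 hx.2.le b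
      _ = (ENNReal.ofReal ‖x‖ * ENNReal.ofReal |ρ⁻¹ * pd chi a (ρ⁻¹ • x)|) * TT v x := by ring
      _ ≤ _ := by
          gcongr
          rw [← ENNReal.ofReal_mul (norm_nonneg _)]
          apply ENNReal.ofReal_le_ofReal
          rw [abs_mul, abs_of_pos (inv_pos.2 hρ)]
          calc ‖x‖ * (ρ⁻¹ * |pd chi a (ρ⁻¹ • x)|) ≤ (4 * ρ) * (ρ⁻¹ * M) := by
                gcongr
                · exact hx.2.le
                · exact HM _ _
            _ = _ := by field_simp
  have fin : ∀ x ∈ {x : E2 | ρ / 2 ≤ ‖x‖ ∧ ‖x‖ < 4 * ρ}, ∀ (D E : ℝ), |D| ≤ |dv v x| + |vo v x| →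
      ENNReal.ofReal |E| ≤ ENNReal.ofReal (8 * M) * TT v x → ENNReal.ofReal |chi (ρ⁻¹ • x) * D + E| ^ p ≤ B * (gg v x ^ p + TT v x ^ p) := by
    intro x hx D E hD hE
    have k1 : ENNReal.ofReal |chi (ρ⁻¹ • x) * D + E| ≤ gg v x + ENNReal.ofReal (8 * M) * TT v x := by
      refine (ENNReal.ofReal_le_ofReal (abs_add_le _ _)).trans ?_
      rw [ENNReal.ofReal_add (abs_nonneg _) (abs_nonneg _)]
      refine add_le_add (ENNReal.ofReal_le_ofReal ?_) hE
      rw [abs_mul, abs_of_nonneg (chi_nn _)]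
      calc _ ≤ 1 * |D| := by gcongr; exact chi_le _
        _ ≤ _ := by linarith
    calc _ ≤ (gg v x + ENNReal.ofReal (8 * M) * TT v x) ^ p := by gcongr
      _ ≤ 2 ^ (p - 1) * (gg v x ^ p + (ENNReal.ofReal (8 * M) * TT v x) ^ p) := ENNReal.rpow_add_le_mul_rpow_add_rpow _ _ hp.le
      _ = 2 ^ (p - 1) * (1 * gg v x ^ p + ENNReal.ofReal (8 * M) ^ p * TT v x ^ p) := by
          rw [ENNReal.mul_rpow_of_nonneg _ _ hp0.le, one_mul]
      _ ≤ 2 ^ (p - 1) * ((1 + ENNReal.ofReal (8 * M) ^ p) * gg v x ^ p + (1 + ENNReal.ofReal (8 * M) ^ p) * TT v x ^ p) := by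
          gcongr
          · exact le_self_add
          · exact le_add_self
      _ = _ := by rw [hB]; ring
  have sum2 : ∀ x ∈ {x : E2 | ρ / 2 ≤ ‖x‖ ∧ ‖x‖ < 4 * ρ}, ∀ E F : ℝ, ENNReal.ofReal |E| ≤ ENNReal.ofReal (4 * M) * TT v x →
      ENNReal.ofReal |F| ≤ ENNReal.ofReal (4 * M) * TT v x → ENNReal.ofReal |E + F| ≤ ENNReal.ofReal (8 * M) * TT v x := by
    intro x hx E F hE hF
    refine (ENNReal.ofReal_le_ofReal (abs_add_le _ _)).trans ?_
    rw [ENNReal.ofReal_add (abs_nonneg _) (abs_nonneg _)]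
    refine (add_le_add hE hF).trans (le_of_eq ?_)
    rw [← add_mul, ← ENNReal.ofReal_add (by positivity) (by positivity)]
    congr 2; ring
  have s2 : ∫⁻ x, ENNReal.ofReal |dv w x| ^ p ≤ B * ∫⁻ x in {x | ρ / 2 ≤ ‖x‖ ∧ ‖x‖ < 4 * ρ}, (gg v x ^ p + TT v x ^ p) := by
    rw [← lintegral_const_mul' _ _ hBt, ← lintegral_indicator mB]
    refine lintegral_mono fun x => ?_
    by_cases hx : x ∈ {x : E2 | ρ / 2 ≤ ‖x‖ ∧ ‖x‖ < 4 * ρ}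
    · rw [indicator_of_mem hx]
      have e : dv w x = chi (ρ⁻¹ • x) * dv v x + ((v 0 x - c 0) * (ρ⁻¹ * pd chi 0 (ρ⁻¹ • x)) + (v 1 x - c 1) * (ρ⁻¹ * pd chi 1 (ρ⁻¹ • x))) := by
        unfold dv; rw [hwp, hwp]; ring
      rw [e]
      exact fin x hx _ _ (by linarith [abs_nonneg (vo v x)]) (sum2 x hx _ _ (inn x hx 0 0) (inn x hx 1 1))
    · rw [indicator_of_notMem hx]
      unfold dv; rw [out x hx, out x hx]; simp [hp0]
  have s3 : ∫⁻ x, ENNReal.ofReal |vo w x| ^ p ≤ B * ∫⁻ x in {x | ρ / 2 ≤ ‖x‖ ∧ ‖x‖ < 4 * ρ}, (gg v x ^ p + TT v x ^ p) := by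
    rw [← lintegral_const_mul' _ _ hBt, ← lintegral_indicator mB]
    refine lintegral_mono fun x => ?_
    by_cases hx : x ∈ {x : E2 | ρ / 2 ≤ ‖x‖ ∧ ‖x‖ < 4 * ρ}
    · rw [indicator_of_mem hx]
      have e : vo w x = chi (ρ⁻¹ • x) * vo v x + ((v 1 x - c 1) * (ρ⁻¹ * pd chi 0 (ρ⁻¹ • x)) + -((v 0 x - c 0) * (ρ⁻¹ * pd chi 1 (ρ⁻¹ • x)))) := by
        unfold vo; rw [hwp, hwp]; ring
      rw [e]
      exact fin x hx _ _ (by linarith [abs_nonneg (dv v x)]) (sum2 x hx _ _ (inn x hx 1 0) (by rw [abs_neg]; exact inn x hx 0 1))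
    · rw [indicator_of_notMem hx]
      unfold vo; rw [out x hx, out x hx]; simp [hp0]
  calc _ ≤ _ := s1
    _ ≤ _ := H w hwc hws a b
    _ ≤ C * (B * (∫⁻ x in {x | ρ / 2 ≤ ‖x‖ ∧ ‖x‖ < 4 * ρ}, (gg v x ^ p + TT v x ^ p)) + B * ∫⁻ x in {x | ρ / 2 ≤ ‖x‖ ∧ ‖x‖ < 4 * ρ}, (gg v x ^ p + TT v x ^ p)) := by gcongr
    _ = _ := by ring


def An (k : ℤ) : Set E2 := {x | (2 : ℝ) ^ k ≤ ‖x‖ ∧ ‖x‖ < 2 ^ (k + 1)}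

lemma An_meas (k : ℤ) : MeasurableSet (An k) :=
  (measurableSet_le measurable_const measurable_norm).inter (measurableSet_lt measurable_norm measurable_const)

lemma An_disj : Pairwise (Function.onFun Disjoint An) := by
  have h : Monotone fun k : ℤ => (2 : ℝ) ^ k := zpow_right_mono₀ (by norm_num)
  intro i j hij
  have := h.pairwise_disjoint_on_Ico_succ hij
  exact Disjoint.preimage (fun x : E2 => ‖x‖) this

lemma An_cov {x : E2} (hx : x ≠ 0) : x ∈ ⋃ k, An k := by
  obtain ⟨n, hn⟩ := exists_mem_Ico_zpow (norm_pos_iff.2 hx) (one_lt_two (α := ℝ))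
  exact mem_iUnion.2 ⟨n, hn.1, hn.2⟩

lemma An_sum (f : E2 → ℝ≥0∞) : ∑' k, ∫⁻ x in An k, f x = ∫⁻ x, f x := by
  rw [← lintegral_iUnion An_meas An_disj]
  conv_rhs => rw [← setLIntegral_univ f]
  refine setLIntegral_congr ?_
  have ae0 : ∀ᵐ y : E2, y ≠ 0 := by simp [ae_iff]
  rw [Filter.eventuallyEq_univ]
  filter_upwards [ae0] with x hx
  exact An_cov hx

lemma An_big (f : E2 → ℝ≥0∞) : ∑' k : ℤ, ∫⁻ x in {x | (2 : ℝ) ^ k / 2 ≤ ‖x‖ ∧ ‖x‖ < 4 * 2 ^ k}, f x ≤ 3 * ∫⁻ x, f x := by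
  have h1 : ∀ k : ℤ, ∫⁻ x in {x | (2 : ℝ) ^ k / 2 ≤ ‖x‖ ∧ ‖x‖ < 4 * 2 ^ k}, f x ≤
      (∫⁻ x in An (k - 1), f x) + ((∫⁻ x in An k, f x) + ∫⁻ x in An (k + 1), f x) := by
    intro k
    have hsub : {x : E2 | (2 : ℝ) ^ k / 2 ≤ ‖x‖ ∧ ‖x‖ < 4 * 2 ^ k} ⊆ An (k - 1) ∪ (An k ∪ An (k + 1)) := by
      rintro x ⟨ha, hb⟩
      have e1 : (2 : ℝ) ^ (k - 1) = 2 ^ k / 2 := by rw [zpow_sub₀ two_ne_zero]; simp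
      have e2 : (2 : ℝ) ^ (k + 1) = 2 ^ k * 2 := by rw [zpow_add₀ two_ne_zero]; simp
      have e3 : (2 : ℝ) ^ (k + 1 + 1) = 4 * 2 ^ k := by rw [zpow_add₀ two_ne_zero, e2]; simp; ring
      simp only [An, mem_union, mem_ofPred_eq, e1, e2, e3, sub_add_cancel]
      rcases lt_or_ge ‖x‖ (2 ^ k) with h | h
      · exact Or.inl ⟨ha, h⟩
      · rcases lt_or_ge ‖x‖ (2 ^ k * 2) with h' | h'
        · exact Or.inr (Or.inl ⟨h, h'⟩)
        · exact Or.inr (Or.inr ⟨h', hb⟩)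
    refine (lintegral_mono_set hsub).trans ((lintegral_union_le _ _ _).trans ?_)
    gcongr
    exact lintegral_union_le _ _ _
  refine (ENNReal.tsum_le_tsum h1).trans (le_of_eq ?_)
  rw [ENNReal.tsum_add, ENNReal.tsum_add]
  have e1 : ∑' k : ℤ, ∫⁻ x in An (k - 1), f x = ∑' k, ∫⁻ x in An k, f x :=
    (Equiv.subRight (1 : ℤ)).tsum_eq (fun k => ∫⁻ x in An k, f x)
  have e2 : ∑' k : ℤ, ∫⁻ x in An (k + 1), f x = ∑' k, ∫⁻ x in An k, f x :=
    (Equiv.addRight (1 : ℤ)).tsum_eq (fun k => ∫⁻ x in An k, f x)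
  rw [e1, e2, An_sum]; ring

/-- comparability of powers -/
lemma pow_cmp (α : ℝ) : ∃ c : ℝ, 0 < c ∧ ∀ r s : ℝ, 0 < r → 0 < s → r ≤ 4 * s → s ≤ 4 * r → r ^ α ≤ c * s ^ α := by
  refine ⟨4 ^ |α|, by positivity, fun r s hr hs h1 h2 => ?_⟩
  rcases le_total 0 α with h | h
  · rw [abs_of_nonneg h, ← Real.mul_rpow (by norm_num) hs.le]
    exact Real.rpow_le_rpow hr.le h1 h
  · rw [abs_of_nonpos h]
    have : r ^ α ≤ (s / 4) ^ α := Real.rpow_le_rpow_of_nonpos (by positivity) (by linarith) h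
    refine this.trans (le_of_eq ?_)
    rw [Real.div_rpow hs.le (by norm_num), Real.rpow_neg (by norm_num)]
    ring

lemma ww_cmp (α : ℝ) : ∃ c : ℝ≥0∞, c ≠ ⊤ ∧ ∀ r : ℝ, 0 < r → ∀ x : E2, r / 4 ≤ ‖x‖ → ‖x‖ ≤ 4 * r →
    ww x ^ α ≤ c * ENNReal.ofReal (r ^ α) ∧ ENNReal.ofReal (r ^ α) ≤ c * ww x ^ α := by
  obtain ⟨c, hc, H⟩ := pow_cmp α
  refine ⟨ENNReal.ofReal c, by simp, fun r hr x h1 h2 => ?_⟩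
  have hx : 0 < ‖x‖ := by linarith
  rw [ww_rpow (norm_pos_iff.1 hx), ← ENNReal.ofReal_mul hc.le, ← ENNReal.ofReal_mul hc.le]
  exact ⟨ENNReal.ofReal_le_ofReal (H _ _ hx hr (by linarith) (by linarith)),
    ENNReal.ofReal_le_ofReal (H _ _ hr hx (by linarith) (by linarith))⟩

lemma weighted {p α : ℝ} (hp : 1 < p) (h1 : -2 < α) (h2 : α < 2 * (p - 1)) : ∃ C : ℝ≥0∞, C ≠ ⊤ ∧
    ∀ (v : Fin 2 → E2 → ℝ), (∀ b, ContDiff ℝ 2 (v b)) → (∀ b, HasCompactSupport (v b)) → ∀ a b,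
    ∫⁻ x, ENNReal.ofReal |pd (v b) a x| ^ p * ww x ^ α ≤ C * ∫⁻ x, gg v x ^ p * ww x ^ α := by
  obtain ⟨C1, hC1, H1⟩ := local_est hp
  obtain ⟨C2, hC2, H2⟩ := schur hp h1 h2
  obtain ⟨c, hc, H3⟩ := ww_cmp α
  refine ⟨c * C1 * c * 3 * (1 + C2), by finiteness, fun v hv hcs a b => ?_⟩
  have gm := gg_meas hv
  have tm := TT_meas hv
  have wm := ww_meas
  have step : ∀ k : ℤ, ∫⁻ x in An k, ENNReal.ofReal |pd (v b) a x| ^ p * ww x ^ α ≤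
      c * C1 * c * ∫⁻ x in {x | (2 : ℝ) ^ k / 2 ≤ ‖x‖ ∧ ‖x‖ < 4 * 2 ^ k}, (gg v x ^ p + TT v x ^ p) * ww x ^ α := by
    intro k
    have hρ : (0 : ℝ) < 2 ^ k := by positivity
    have eA : An k = {x : E2 | (2 : ℝ) ^ k ≤ ‖x‖ ∧ ‖x‖ < 2 * 2 ^ k} := by
      unfold An; rw [zpow_add₀ two_ne_zero, zpow_one, mul_comm]
    have mB : MeasurableSet {x : E2 | (2 : ℝ) ^ k / 2 ≤ ‖x‖ ∧ ‖x‖ < 4 * 2 ^ k} :=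
      (measurableSet_le measurable_const measurable_norm).inter (measurableSet_lt measurable_norm measurable_const)
    have W : ENNReal.ofReal (((2 : ℝ) ^ k) ^ α) ≠ ⊤ := ENNReal.ofReal_ne_top
    calc _ ≤ ∫⁻ x in An k, (c * ENNReal.ofReal (((2 : ℝ) ^ k) ^ α)) * ENNReal.ofReal |pd (v b) a x| ^ p := by
          refine setLIntegral_mono' (An_meas k) fun x hx => ?_
          rw [eA] at hx
          rw [mul_comm]
          gcongr
          exact (H3 _ hρ x (by linarith [hx.1]) (by linarith [hx.2])).1
      _ = (c * ENNReal.ofReal (((2 : ℝ) ^ k) ^ α)) * ∫⁻ x in An k, ENNReal.ofReal |pd (v b) a x| ^ p :=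
          lintegral_const_mul' _ _ (ENNReal.mul_ne_top hc W)
      _ ≤ (c * ENNReal.ofReal (((2 : ℝ) ^ k) ^ α)) * (C1 * ∫⁻ x in {x | (2 : ℝ) ^ k / 2 ≤ ‖x‖ ∧ ‖x‖ < 4 * 2 ^ k}, (gg v x ^ p + TT v x ^ p)) := by
          gcongr
          rw [eA]
          exact H1 v hv hcs a b _ hρ
      _ = c * C1 * ∫⁻ x in {x | (2 : ℝ) ^ k / 2 ≤ ‖x‖ ∧ ‖x‖ < 4 * 2 ^ k}, ENNReal.ofReal (((2 : ℝ) ^ k) ^ α) * (gg v x ^ p + TT v x ^ p) := by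
          rw [lintegral_const_mul' _ _ W]; ring
      _ ≤ c * C1 * ∫⁻ x in {x | (2 : ℝ) ^ k / 2 ≤ ‖x‖ ∧ ‖x‖ < 4 * 2 ^ k}, c * ((gg v x ^ p + TT v x ^ p) * ww x ^ α) := by
          refine mul_le_mul_right ?_ _
          refine setLIntegral_mono' mB fun x hx => ?_
          calc _ ≤ (c * ww x ^ α) * (gg v x ^ p + TT v x ^ p) := by
                gcongr
                exact (H3 _ hρ x (by linarith [hx.1]) (by linarith [hx.2])).2
            _ = _ := by ring
      _ = _ := by rw [lintegral_const_mul' _ _ hc]; ring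
  rw [← An_sum]
  calc _ ≤ _ := ENNReal.tsum_le_tsum step
    _ = c * C1 * c * ∑' k : ℤ, ∫⁻ x in {x | (2 : ℝ) ^ k / 2 ≤ ‖x‖ ∧ ‖x‖ < 4 * 2 ^ k}, (gg v x ^ p + TT v x ^ p) * ww x ^ α :=
        ENNReal.tsum_mul_left
    _ ≤ c * C1 * c * (3 * ∫⁻ x, (gg v x ^ p + TT v x ^ p) * ww x ^ α) := by gcongr; exact An_big _
    _ = c * C1 * c * 3 * ((∫⁻ x, gg v x ^ p * ww x ^ α) + ∫⁻ x, TT v x ^ p * ww x ^ α) := by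
        rw [← lintegral_add_left (by fun_prop), mul_assoc _ 3]
        congr 3; ext x; ring
    _ ≤ c * C1 * c * 3 * ((∫⁻ x, gg v x ^ p * ww x ^ α) + C2 * ∫⁻ x, gg v x ^ p * ww x ^ α) := by
        gcongr; exact H2 _ gm
    _ = _ := by ring

lemma clm_norm (L : E2 →L[ℝ] E2) : ‖L‖ ≤ (|L (EuclideanSpace.single 0 1) 0| + |L (EuclideanSpace.single 0 1) 1|) +
    (|L (EuclideanSpace.single 1 1) 0| + |L (EuclideanSpace.single 1 1) 1|) := by
  have hn : ∀ y : E2, ‖y‖ ≤ |y 0| + |y 1| := by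
    intro y
    rw [EuclideanSpace.norm_eq, Real.sqrt_le_left (by positivity)]
    simp only [Fin.sum_univ_two, Real.norm_eq_abs]
    nlinarith [abs_nonneg (y 0), abs_nonneg (y 1)]
  refine L.opNorm_le_bound (by positivity) fun z => ?_
  have e : z = z 0 • EuclideanSpace.single 0 (1:ℝ) + z 1 • EuclideanSpace.single 1 (1:ℝ) := by
    ext i; fin_cases i <;> simp
  have h0 := PiLp.norm_apply_le z 0
  have h1 := PiLp.norm_apply_le z 1
  calc ‖L z‖ = ‖z 0 • L (EuclideanSpace.single 0 (1:ℝ)) + z 1 • L (EuclideanSpace.single 1 (1:ℝ))‖ := by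
        conv_lhs => rw [e]
        simp
    _ ≤ ‖z 0‖ * ‖L (EuclideanSpace.single 0 (1:ℝ))‖ + ‖z 1‖ * ‖L (EuclideanSpace.single 1 (1:ℝ))‖ := by
        refine (norm_add_le _ _).trans ?_
        rw [norm_smul, norm_smul]
    _ ≤ ‖z‖ * (|L (EuclideanSpace.single 0 1) 0| + |L (EuclideanSpace.single 0 1) 1|) + ‖z‖ * (|L (EuclideanSpace.single 1 1) 0| + |L (EuclideanSpace.single 1 1) 1|) := by
        gcongr
        · exact hn _
        · exact hn _
    _ = _ := by ring

lemma pd_comp {u : E2 → E2} (hu : ContDiff ℝ 2 u) (a b : Fin 2) (x : E2) :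
    pd (fun y => u y b) a x = fderiv ℝ u x (EuclideanSpace.single a 1) b := by
  have h := ((hu.differentiable two_ne_zero) x).hasFDerivAt
  have h2 := ((EuclideanSpace.proj (𝕜 := ℝ) b).hasFDerivAt (x := u x)).comp x h
  have h3 := h2.fderiv
  unfold pd
  have e : (fun y => u y b) = (EuclideanSpace.proj (𝕜 := ℝ) b : E2 → ℝ) ∘ u := rfl
  rw [e, h3]; rfl

lemma wint {f : E2 → ℝ} (hf : Continuous f) (hc : HasCompactSupport f) {p α : ℝ} (hp : 0 < p) (hα : -2 < α) :
    Integrable (fun x => |f x| ^ p * ‖x‖ ^ α) := by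
  obtain ⟨R, hR1, hR⟩ := exists_supp_ball hc
  obtain ⟨M, hM⟩ := hf.bounded_above_of_compact_support hc
  have hM0 : 0 ≤ M := (norm_nonneg _).trans (hM 0)
  obtain ⟨C, -, h⟩ := rad_in hα
  have h1 := (h (R + 1) (by positivity)).1
  have h2 := ((integrable_indicator_iff measurableSet_ball).2 h1).const_mul (M ^ p)
  refine h2.mono' ?_ (Filter.Eventually.of_forall fun z => ?_)
  · have a1 : Measurable fun x => |f x| ^ p := (hf.abs.rpow_const fun _ => Or.inr hp.le).measurable
    exact (a1.mul (by fun_prop)).aestronglyMeasurable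
  · rw [Real.norm_of_nonneg (by positivity)]
    by_cases hz : z ∈ Metric.ball (0 : E2) (R + 1)
    · rw [indicator_of_mem hz]
      gcongr
      exact hM z
    · rw [indicator_of_notMem hz, hR z]
      · simp [hp.ne']
      · simp at hz; linarith

lemma final_est {p α : ℝ} (hp : 1 < p) (h1 : -2 < α) (h2 : α < 2 * (p - 1)) :
    ∃ C : ℝ, 0 < C ∧ ∀ u : E2 → E2, ContDiff ℝ (⊤ : ℕ∞) u → HasCompactSupport u →
      (∫ x : E2, ‖fderiv ℝ u x‖ ^ p * ‖x‖ ^ α) ≤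
        C * ((∫ x : E2, |div2 u x| ^ p * ‖x‖ ^ α) + ∫ x : E2, |vort u x| ^ p * ‖x‖ ^ α) := by
  obtain ⟨C, hC, H⟩ := weighted hp h1 h2
  have hp0 : 0 < p := by linarith
  set D : ℝ≥0∞ := 2 ^ (p - 1) with hD
  have hDt : D ≠ ⊤ := ENNReal.rpow_ne_top_of_nonneg (by linarith) (by simp)
  set K : ℝ≥0∞ := D * (D * (C + C) + D * (C + C)) * D with hK
  have hKt : K ≠ ⊤ := by finiteness
  refine ⟨K.toReal + 1, by positivity, fun u hu hc => ?_⟩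
  have hu2 : ContDiff ℝ 2 u := hu.of_le (by norm_cast)
  set v : Fin 2 → E2 → ℝ := fun b y => u y b with hvdef
  have hv : ∀ b, ContDiff ℝ 2 (v b) := fun b => (EuclideanSpace.proj (𝕜 := ℝ) b).contDiff.comp hu2
  have hvc : ∀ b, HasCompactSupport (v b) := fun b => hc.comp_left (g := fun y : E2 => y b) rfl
  have ed : div2 u = dv v := by
    ext x; unfold div2 dv; rw [Fin.sum_univ_two]
  have ev : vort u = vo v := rfl
  rw [ed, ev]
  have ae0 : ∀ᵐ y : E2, y ≠ 0 := by simp [ae_iff]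
  have iD := wint (dv_cont hv) (dv_supp hvc) hp0 h1
  have iV := wint (vo_cont hv) (vo_supp hvc) hp0 h1
  have nD : 0 ≤ ∫ x : E2, |dv v x| ^ p * ‖x‖ ^ α := integral_nonneg fun x => by positivity
  have nV : 0 ≤ ∫ x : E2, |vo v x| ^ p * ‖x‖ ^ α := integral_nonneg fun x => by positivity
  have conv : ∀ f : E2 → ℝ, ∫⁻ x, ENNReal.ofReal |f x| ^ p * ww x ^ α = ∫⁻ x, ENNReal.ofReal (|f x| ^ p * ‖x‖ ^ α) := by
    intro f
    refine lintegral_congr_ae ?_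
    filter_upwards [ae0] with x hx
    rw [ww_rpow hx, ENNReal.ofReal_mul (by positivity), ENNReal.ofReal_rpow_of_nonneg (abs_nonneg _) hp0.le]
  have add_p : ∀ f g : E2 → ℝ≥0∞, Measurable f → ∫⁻ x, (f x + g x) ^ p * ww x ^ α ≤ D * ((∫⁻ x, f x ^ p * ww x ^ α) + ∫⁻ x, g x ^ p * ww x ^ α) := by
    intro f g hf
    have wm := ww_meas
    rw [← lintegral_add_left (by fun_prop), ← lintegral_const_mul' _ _ hDt]
    refine lintegral_mono fun x => ?_
    rw [← add_mul, ← mul_assoc]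
    gcongr
    exact ENNReal.rpow_add_le_mul_rpow_add_rpow _ _ hp.le
  have g_le : ∫⁻ x, gg v x ^ p * ww x ^ α ≤ D * ENNReal.ofReal ((∫ x : E2, |dv v x| ^ p * ‖x‖ ^ α) + ∫ x : E2, |vo v x| ^ p * ‖x‖ ^ α) := by
    have e : ∀ x, gg v x = ENNReal.ofReal |dv v x| + ENNReal.ofReal |vo v x| := fun x => ENNReal.ofReal_add (abs_nonneg _) (abs_nonneg _)
    simp only [e]
    have dm : Measurable fun x => ENNReal.ofReal |dv v x| := ENNReal.measurable_ofReal.comp (dv_cont hv).abs.measurable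
    refine (add_p _ _ dm).trans (le_of_eq ?_)
    rw [conv (dv v), conv (vo v), ENNReal.ofReal_add nD nV, ofReal_integral_eq_lintegral_ofReal iD (Filter.Eventually.of_forall fun x => by positivity),
      ofReal_integral_eq_lintegral_ofReal iV (Filter.Eventually.of_forall fun x => by positivity)]
  have pm : ∀ a b, Measurable fun x => ENNReal.ofReal |pd (v b) a x| :=
    fun a b => ENNReal.measurable_ofReal.comp (pdv_cont hv a b).abs.measurable
  have fc : Continuous (fderiv ℝ u) := hu2.continuous_fderiv two_ne_zero
  have lhs : ∫⁻ x, ENNReal.ofReal (‖fderiv ℝ u x‖ ^ p * ‖x‖ ^ α) ≤ K * ENNReal.ofReal ((∫ x : E2, |dv v x| ^ p * ‖x‖ ^ α) + ∫ x : E2, |vo v x| ^ p * ‖x‖ ^ α) := by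
    have c1 := conv (fun x => ‖fderiv ℝ u x‖)
    simp only [abs_norm] at c1
    rw [← c1]
    have pt : ∀ x, ENNReal.ofReal ‖fderiv ℝ u x‖ ≤ (ENNReal.ofReal |pd (v 0) 0 x| + ENNReal.ofReal |pd (v 1) 0 x|) +
        (ENNReal.ofReal |pd (v 0) 1 x| + ENNReal.ofReal |pd (v 1) 1 x|) := by
      intro x
      rw [← ENNReal.ofReal_add (by positivity) (by positivity), ← ENNReal.ofReal_add (by positivity) (by positivity), ← ENNReal.ofReal_add (by positivity) (by positivity)]
      apply ENNReal.ofReal_le_ofReal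
      simp only [hvdef, pd_comp hu2]
      exact clm_norm _
    calc _ ≤ ∫⁻ x, ((ENNReal.ofReal |pd (v 0) 0 x| + ENNReal.ofReal |pd (v 1) 0 x|) +
        (ENNReal.ofReal |pd (v 0) 1 x| + ENNReal.ofReal |pd (v 1) 1 x|)) ^ p * ww x ^ α := by
          refine lintegral_mono fun x => ?_
          gcongr
          exact pt x
      _ ≤ D * (D * (C * (∫⁻ x, gg v x ^ p * ww x ^ α) + C * (∫⁻ x, gg v x ^ p * ww x ^ α)) + D * (C * (∫⁻ x, gg v x ^ p * ww x ^ α) + C * (∫⁻ x, gg v x ^ p * ww x ^ α))) := by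
          refine (add_p _ _ ((pm 0 0).add (pm 0 1))).trans ?_
          refine mul_le_mul_right (add_le_add ?_ ?_) _
          · refine (add_p _ _ (pm 0 0)).trans ?_
            exact mul_le_mul_right (add_le_add (H v hv hvc 0 0) (H v hv hvc 0 1)) _
          · refine (add_p _ _ (pm 1 0)).trans ?_
            exact mul_le_mul_right (add_le_add (H v hv hvc 1 0) (H v hv hvc 1 1)) _
      _ = D * (D * (C + C) + D * (C + C)) * ∫⁻ x, gg v x ^ p * ww x ^ α := by ring
      _ ≤ D * (D * (C + C) + D * (C + C)) * (D * ENNReal.ofReal ((∫ x : E2, |dv v x| ^ p * ‖x‖ ^ α) + ∫ x : E2, |vo v x| ^ p * ‖x‖ ^ α)) := by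
          gcongr
      _ = _ := by rw [hK]; ring
  rw [integral_eq_lintegral_of_nonneg_ae (Filter.Eventually.of_forall fun x => by positivity)]
  · have t := ENNReal.toReal_mono (by finiteness) lhs
    refine t.trans ?_
    rw [ENNReal.toReal_mul, ENNReal.toReal_ofReal (by positivity)]
    gcongr
    linarith
  · have a1 : Measurable fun x => ‖fderiv ℝ u x‖ ^ p := (fc.norm.rpow_const fun _ => Or.inr hp0.le).measurable
    exact (a1.mul (by fun_prop)).aestronglyMeasurable

/-- **Weighted `L^p` bound of the gradient by divergence and vorticity** (Lemma 2.4(2)):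
for `1 < p < ∞` and `−2 < α < 2(p−1)` there is `C = C(p,α) > 0` such that for all
`u ∈ C_c^∞(ℝ²;ℝ²)`,
`∫ |∇u|^p |x|^α ≤ C (∫ |div u|^p |x|^α + ∫ |ω|^p |x|^α)`. -/
theorem weighted_gradient_bound_div_vort (p α : ℝ) (hp : 1 < p) (hα₁ : -2 < α)
    (hα₂ : α < 2 * (p - 1)) :
    ∃ C : ℝ, 0 < C ∧ ∀ u : E2 → E2, ContDiff ℝ (⊤ : ℕ∞) u → HasCompactSupport u →
      (∫ x : E2, ‖fderiv ℝ u x‖ ^ p * ‖x‖ ^ α) ≤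
        C * ((∫ x : E2, |div2 u x| ^ p * ‖x‖ ^ α) + ∫ x : E2, |vort u x| ^ p * ‖x‖ ^ α) := by
  exact final_est hp hα₁ hα₂
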